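/- Let C be a nodal plane quartic over ℂ that is the union of a smooth irreducible cubic Y and a line Z, with Y ∩ Z = {p₁,p₂,p₃}. If f: 𝒞 → B is a regular smoothing of C, then the cycle of the limit Weierstrass scheme is [W_{f,0}] = R + (s₁ + ⋯ + s₆) + 3(p₁ + p₂ + p₃), where s₁,…,s₆ are points of Z lying in the smooth locus of C and R is the ramification divisor of the linear system |𝒪_Y(1)| on Y. -/

import Mathlib

/-!
STATEMENT 10 (Pacini–Testa, Lemma `degen`): let `C` be a nodal plane quartic over ℂ
which is the union of a smooth irreducible cubic `Y` and a line `Z`, with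
`Y ∩ Z = {p₁, p₂, p₃}`.  If `f : 𝒞 → B` is a regular smoothing of `C`, then the cycle
of the limit Weierstrass scheme is
`[W_{f,0}] = R + (s₁ + ⋯ + s₆) + 3(p₁ + p₂ + p₃)`,
where `s₁, …, s₆` are points of `Z` in the smooth locus of `C` and `R` is the
ramification divisor of the linear system `|𝒪_Y(1)|` of lines on `Y` (the inflection
divisor of the cubic, with weight (tangent-contact − 2) at each point).

The cycle `[W_{f,0}]` is characterized as the limit, as `t → 0`, of the cycles of
inflection points (weighted by contact − 2) of the smooth quartic fibers; a regular
smoothing is one whose total space is smooth at the points of `C` lying on both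
components, i.e. at `p₁, p₂, p₃`.
-/

open MvPolynomial Polynomial Filter

noncomputable section

namespace Infl

def dotv (w p : Fin 3 → ℂ) : ℂ := ∑ i, w i * p i

def lineRestrict (F : MvPolynomial (Fin 3) ℂ) (a b : Fin 3 → ℂ) : Polynomial ℂ :=
  MvPolynomial.aeval (fun i => Polynomial.C (a i) + Polynomial.C (b i) * Polynomial.X) F

def contactAt (F : MvPolynomial (Fin 3) ℂ) (a b : Fin 3 → ℂ) : ℕ :=
  (lineRestrict F a b).rootMultiplicity 0

def IsSmoothCurve (F : MvPolynomial (Fin 3) ℂ) (d : ℕ) : Prop :=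
  F.IsHomogeneous d ∧ F ≠ 0 ∧
    ∀ p : Fin 3 → ℂ, p ≠ 0 → eval p F = 0 → ∃ i, eval p (pderiv i F) ≠ 0

def SingAt (F : MvPolynomial (Fin 3) ℂ) (p : Fin 3 → ℂ) : Prop :=
  eval p F = 0 ∧ ∀ i, eval p (pderiv i F) = 0

def gradVec (F : MvPolynomial (Fin 3) ℂ) (p : Fin 3 → ℂ) : Fin 3 → ℂ :=
  fun i => eval p (pderiv i F)

def padm (n : ℕ) : ℕ := n - 2

/-- The inflectionary (Weierstrass) weight of the point `p` on a smooth plane quartic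
`{F = 0}`: the contact order of its tangent line minus 2. -/
def flexWeightAt (F : MvPolynomial (Fin 3) ℂ) (p : Fin 3 → ℂ) : ℕ :=
  ⨆ v, ⨆ _ : LinearIndependent ℂ ![p, v] ∧ dotv (gradVec F p) v = 0,
    padm (contactAt F p v)

def projNear (ε : ℝ) (w w₀ : Fin 3 → ℂ) : Prop := ∃ c : ℂ, ‖c • w - w₀‖ < ε

open Classical in
/-- The total inflectionary weight of `{F = 0}` at points `ε`-close to `p₀`. -/
def flexNear (F : MvPolynomial (Fin 3) ℂ) (p₀ : Fin 3 → ℂ) (ε : ℝ) : ℕ :=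
  ∑ᶠ x : Projectivization ℂ (Fin 3 → ℂ),
    if projNear ε x.rep p₀ then flexWeightAt F x.rep else 0

/-- An algebraic family of plane quartics over `B`: a polynomial in `x₀,x₁,x₂` and in
the parameter `t = X 3` of the base; `fiberAt Q t` is the quartic over `t ∈ B`. -/
def fiberAt (Q : MvPolynomial (Fin 4) ℂ) (t : ℂ) : MvPolynomial (Fin 3) ℂ :=
  MvPolynomial.aeval
    (fun i : Fin 4 => if h : (i : ℕ) < 3 then X ⟨i, h⟩ else MvPolynomial.C t) Q

/-- `Q` is a smoothing of the plane quartic `F₀` to plane quartics. -/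
def IsQuarticSmoothing (Q : MvPolynomial (Fin 4) ℂ) (F₀ : MvPolynomial (Fin 3) ℂ) : Prop :=
  fiberAt Q 0 = F₀ ∧ (∀ t, (fiberAt Q t).IsHomogeneous 4) ∧
    ∀ᶠ t in nhdsWithin (0 : ℂ) {0}ᶜ, IsSmoothCurve (fiberAt Q t) 4

/-- `c` is the cycle `[W_{f,0}]` of the limit Weierstrass (= inflection) scheme of the
family `Q`: `c` is scale invariant, and near every point `p₀` of the central fiber,
for every small `ε` and every small `t ≠ 0` the total inflectionary weight of the
fiber at `t` near `p₀` is `c p₀`. -/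
def IsLimitWeierstrassCycle (Q : MvPolynomial (Fin 4) ℂ) (c : (Fin 3 → ℂ) → ℕ) : Prop :=
  (∀ u : ℂ, u ≠ 0 → ∀ p, c (u • p) = c p) ∧
    ∀ p₀ : Fin 3 → ℂ, p₀ ≠ 0 →
      ∀ᶠ ε in nhdsWithin (0 : ℝ) (Set.Ioi 0),
        ∀ᶠ t in nhdsWithin (0 : ℂ) {0}ᶜ, flexNear (fiberAt Q t) p₀ ε = c p₀

/-- The total degree of a scale-invariant cycle of points. -/
def cycleDeg (c : (Fin 3 → ℂ) → ℕ) : ℕ :=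
  ∑ᶠ x : Projectivization ℂ (Fin 3 → ℂ), c x.rep

/-- Evaluation of the family `Q` at the point `(p, t₀)` of `ℙ² × B`. -/
def evalFam (Q : MvPolynomial (Fin 4) ℂ) (p : Fin 3 → ℂ) (t₀ : ℂ) : ℂ :=
  MvPolynomial.eval (fun i : Fin 4 => if h : (i : ℕ) < 3 then p ⟨i, h⟩ else t₀) Q

/-- The total space `𝒞 = {Q = 0} ⊆ ℙ² × B` is smooth at the point `(p, 0)`. -/
def TotalSpaceSmoothAt (Q : MvPolynomial (Fin 4) ℂ) (p : Fin 3 → ℂ) : Prop :=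
  ¬ (evalFam Q p 0 = 0 ∧ ∀ i : Fin 4, evalFam (pderiv i Q) p 0 = 0)

/-- The total space `𝒞 = {Q = 0} ⊆ ℙ² × B` is smooth (along the central fiber). -/
def TotalSpaceSmooth (Q : MvPolynomial (Fin 4) ℂ) : Prop :=
  ∀ p : Fin 3 → ℂ, p ≠ 0 → TotalSpaceSmoothAt Q p

end Infl

namespace Infl

/-- The linear form with coefficient vector `w`. -/
def linForm (w : Fin 3 → ℂ) : MvPolynomial (Fin 3) ℂ := ∑ i, MvPolynomial.C (w i) * X i

def propor (p q : Fin 3 → ℂ) : Prop := ∃ c : ℂ, c ≠ 0 ∧ p = c • q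

section basics

variable {A : Type*} [CommRing A] [Algebra ℂ A]

abbrev P3 := MvPolynomial (Fin 3) ℂ

theorem chain_rule {σ : Type*} [Fintype σ] [DecidableEq σ] (D : Derivation ℂ A A) (z : σ → A)
    (F : MvPolynomial σ ℂ) :
    D (MvPolynomial.aeval z F) = ∑ i, MvPolynomial.aeval z (MvPolynomial.pderiv i F) * D (z i) := by
  induction F using MvPolynomial.induction_on with
  | C a => simp
  | add p q hp hq => simp [hp, hq, add_mul, Finset.sum_add_distrib]
  | mul_X p j hp =>
    simp only [map_mul, MvPolynomial.aeval_X, Derivation.leibniz, hp, MvPolynomial.pderiv_X,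
      map_add, smul_eq_mul, add_mul, Finset.sum_add_distrib]
    congr 1
    · rw [Finset.sum_eq_single j]
      · simp
      · intro i _ hij
        simp [hij]
      · simp
    · rw [Finset.mul_sum]
      refine Finset.sum_congr rfl fun i _ => by ring

theorem aeval_scale {F : P3} {d : ℕ} (hF : F.IsHomogeneous d) (s : A) (z : Fin 3 → A) :
    MvPolynomial.aeval (fun i => s * z i) F = s ^ d * MvPolynomial.aeval z F := by
  simp only [MvPolynomial.aeval_def, MvPolynomial.eval₂_eq]
  rw [Finset.mul_sum]
  refine Finset.sum_congr rfl fun m hm => ?_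
  have h := hF (MvPolynomial.mem_support_iff.mp hm)
  have h2 : ∑ i ∈ m.support, m i = d := by
    rw [← h]; simp [Finsupp.weight_apply, Finsupp.sum]
  simp only [mul_pow, Finset.prod_mul_distrib, Finset.prod_pow_eq_pow_sum, h2]
  ring

theorem eval_scale {F : P3} {d : ℕ} (hF : F.IsHomogeneous d) (s : ℂ) (z : Fin 3 → ℂ) :
    MvPolynomial.eval (s • z) F = s ^ d * MvPolynomial.eval z F := by
  have := aeval_scale hF s z
  rw [MvPolynomial.aeval_eq_eval] at this
  exact this

theorem natDegree_aeval_lin {F : P3} {d : ℕ} (hF : F.IsHomogeneous d) (α β : Fin 3 → A) :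
    (MvPolynomial.aeval (fun i => Polynomial.C (α i) + Polynomial.C (β i) * Polynomial.X) F :
      Polynomial A).natDegree ≤ d := by
  simp only [MvPolynomial.aeval_def, MvPolynomial.eval₂_eq]
  refine Polynomial.natDegree_sum_le_of_forall_le _ _ fun m hm => ?_
  have h := hF (MvPolynomial.mem_support_iff.mp hm)
  have h2 : ∑ i ∈ m.support, m i = d := by
    rw [← h]; simp [Finsupp.weight_apply, Finsupp.sum]
  rw [Polynomial.algebraMap_apply]
  refine (Polynomial.natDegree_C_mul_le _ _).trans ?_
  refine (Polynomial.natDegree_prod_le _ _).trans ?_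
  rw [← h2]
  refine Finset.sum_le_sum fun i _ => ?_
  refine (Polynomial.natDegree_pow_le_of_le (m := 1) (m i) ?_).trans (by simp)
  compute_degree

theorem coeff_aeval_lin {F : P3} {d : ℕ} (hF : F.IsHomogeneous d) (α β : Fin 3 → A) :
    (MvPolynomial.aeval (fun i => Polynomial.C (α i) + Polynomial.C (β i) * Polynomial.X) F :
      Polynomial A).coeff d = MvPolynomial.aeval β F := by
  simp only [MvPolynomial.aeval_def, MvPolynomial.eval₂_eq, Polynomial.finsetSum_coeff]
  refine Finset.sum_congr rfl fun m hm => ?_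
  have h := hF (MvPolynomial.mem_support_iff.mp hm)
  have h2 : ∑ i ∈ m.support, m i = d := by
    rw [← h]; simp [Finsupp.weight_apply, Finsupp.sum]
  rw [Polynomial.algebraMap_apply, Polynomial.coeff_C_mul]
  congr 1
  have key : ∀ s : Finset (Fin 3), (∏ i ∈ s, (Polynomial.C (α i) + Polynomial.C (β i) *
      Polynomial.X) ^ m i).natDegree ≤ ∑ i ∈ s, m i ∧
      (∏ i ∈ s, (Polynomial.C (α i) + Polynomial.C (β i) *
      Polynomial.X) ^ m i).coeff (∑ i ∈ s, m i) = ∏ i ∈ s, β i ^ m i := by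
    intro s
    have h1 : ∀ i, (Polynomial.C (α i) + Polynomial.C (β i) * Polynomial.X).natDegree ≤ 1 :=
      fun i => by compute_degree
    have h3 : ∀ i, ((Polynomial.C (α i) + Polynomial.C (β i) * Polynomial.X) ^ m i).natDegree
        ≤ m i := fun i => (Polynomial.natDegree_pow_le_of_le (m i) (h1 i)).trans (by simp)
    induction s using Finset.induction_on with
    | empty => simp
    | insert i s hi ih =>
      rw [Finset.prod_insert hi, Finset.sum_insert hi, Finset.prod_insert hi]
      refine ⟨Polynomial.natDegree_mul_le_of_le (h3 i) ih.1, ?_⟩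
      rw [Polynomial.coeff_mul_add_eq_of_natDegree_le (h3 i) ih.1, ih.2]
      congr 1
      have := Polynomial.coeff_pow_of_natDegree_le (m := m i) (h1 i)
      rw [mul_one] at this
      rw [this]; simp
  rw [← h2, (key _).2]

/-- directional derivative -/
def dd (u : Fin 3 → ℂ) (F : P3) : P3 := ∑ i, MvPolynomial.C (u i) * MvPolynomial.pderiv i F

theorem aeval_dd (z : Fin 3 → A) (u : Fin 3 → ℂ) (F : P3) : MvPolynomial.aeval z (dd u F) =
    ∑ i, algebraMap ℂ A (u i) * MvPolynomial.aeval z (MvPolynomial.pderiv i F) := by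
  simp [dd]

theorem dd_add (u : Fin 3 → ℂ) (F G : P3) : dd u (F + G) = dd u F + dd u G := by
  simp [dd, mul_add, Finset.sum_add_distrib]

theorem dd_zero (u : Fin 3 → ℂ) : dd u 0 = 0 := by simp [dd]

theorem dd_Cmul (u : Fin 3 → ℂ) (c : ℂ) (F : P3) :
    dd u (MvPolynomial.C c * F) = MvPolynomial.C c * dd u F := by
  simp only [dd, Finset.mul_sum, MvPolynomial.pderiv_C_mul]
  refine Finset.sum_congr rfl fun i _ => by ring

theorem dd_mul (u : Fin 3 → ℂ) (F G : P3) : dd u (F * G) = dd u F * G + F * dd u G := by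
  simp only [dd, Finset.mul_sum, Finset.sum_mul, ← Finset.sum_add_distrib]
  refine Finset.sum_congr rfl fun i _ => ?_
  rw [MvPolynomial.pderiv_mul]; ring

theorem dd_sum {ι : Type*} (s : Finset ι) (u : Fin 3 → ℂ) (F : ι → P3) :
    dd u (∑ i ∈ s, F i) = ∑ i ∈ s, dd u (F i) := by
  classical
  induction s using Finset.induction_on with
  | empty => simp [dd_zero]
  | insert i s hi ih => rw [Finset.sum_insert hi, Finset.sum_insert hi, dd_add, ih]

theorem dd_hom {F : P3} {d : ℕ} (hF : F.IsHomogeneous d) (u : Fin 3 → ℂ) :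
    (dd u F).IsHomogeneous (d - 1) := by
  unfold dd
  refine MvPolynomial.IsHomogeneous.sum _ _ _ fun i _ => ?_
  have := (MvPolynomial.isHomogeneous_C (Fin 3) (u i)).mul (hF.pderiv (i := i))
  simpa using this

theorem dd_vec_add (u v : Fin 3 → ℂ) (F : P3) : dd (u + v) F = dd u F + dd v F := by
  simp [dd, add_mul, Finset.sum_add_distrib]

theorem dd_vec_smul (c : ℂ) (v : Fin 3 → ℂ) (F : P3) : dd (c • v) F = MvPolynomial.C c * dd v F := by
  simp [dd, Finset.mul_sum, mul_assoc]

theorem pderiv_comm' (i j : Fin 3) (F : P3) : MvPolynomial.pderiv i (MvPolynomial.pderiv j F) =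
    MvPolynomial.pderiv j (MvPolynomial.pderiv i F) := by
  induction F using MvPolynomial.induction_on with
  | C a => simp
  | add p q hp hq => simp [hp, hq]
  | mul_X p k hp =>
    simp only [MvPolynomial.pderiv_mul, MvPolynomial.pderiv_X, map_add, hp]
    have h1 : ∀ l : Fin 3, MvPolynomial.pderiv l
        (Pi.single (M := fun _ => P3) i 1 k) = 0 := by
      intro l; rw [Pi.single_apply]; split_ifs <;> simp
    have h2 : ∀ l : Fin 3, MvPolynomial.pderiv l
        (Pi.single (M := fun _ => P3) j 1 k) = 0 := by
      intro l; rw [Pi.single_apply]; split_ifs <;> simp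
    rw [h1, h2]
    ring

theorem dd_comm (u v : Fin 3 → ℂ) (F : P3) : dd u (dd v F) = dd v (dd u F) := by
  have : ∀ u v, dd u (dd v F) = ∑ i, ∑ j, MvPolynomial.C (u i) * MvPolynomial.C (v j) *
      MvPolynomial.pderiv i (MvPolynomial.pderiv j F) := by
    intro u v
    simp only [dd, map_sum, MvPolynomial.pderiv_C_mul, Finset.mul_sum]
    refine Finset.sum_congr rfl fun i _ => Finset.sum_congr rfl fun j _ => ?_
    ring
  rw [this, this, Finset.sum_comm]
  refine Finset.sum_congr rfl fun i _ => Finset.sum_congr rfl fun j _ => ?_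
  rw [pderiv_comm']; ring

theorem dotv_grad (F : P3) (q v : Fin 3 → ℂ) :
    dotv (gradVec F q) v = MvPolynomial.eval q (dd v F) := by
  simp [dotv, gradVec, dd, mul_comm]

theorem euler {F : P3} {d : ℕ} (hF : F.IsHomogeneous d) (q : Fin 3 → ℂ) :
    MvPolynomial.eval q (dd q F) = d * MvPolynomial.eval q F := by
  have := congrArg (MvPolynomial.eval q) hF.sum_X_mul_pderiv
  simpa [dd] using this

/-- the bordered Hessian in the affine chart -/
def Bord (b O : Fin 3 → ℂ) (F : P3) : P3 :=
  (dd O F) ^ 2 * dd b (dd b F) - 2 * (dd b F * dd O F * dd b (dd O F)) +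
    (dd b F) ^ 2 * dd O (dd O F)

theorem Bord_hom {F : P3} {d : ℕ} (hF : F.IsHomogeneous d) (hd : 2 ≤ d) (b O : Fin 3 → ℂ) :
    (Bord b O F).IsHomogeneous (3 * d - 4) := by
  have h1 : ∀ u, (dd u F).IsHomogeneous (d - 1) := dd_hom hF
  have h2 : ∀ u v, (dd u (dd v F)).IsHomogeneous (d - 2) := fun u v => dd_hom (h1 v) u
  unfold Bord
  refine MvPolynomial.IsHomogeneous.add (MvPolynomial.IsHomogeneous.sub ?_ ?_) ?_
  · have := ((h1 O).pow 2).mul (h2 b b)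
    rwa [show (d - 1) * 2 + (d - 2) = 3 * d - 4 by omega] at this
  · have := (MvPolynomial.isHomogeneous_C (Fin 3) (2 : ℂ)).mul (((h1 b).mul (h1 O)).mul (h2 b O))
    rwa [show 0 + (d - 1 + (d - 1) + (d - 2)) = 3 * d - 4 by omega] at this
  · have := ((h1 b).pow 2).mul (h2 O O)
    rwa [show (d - 1) * 2 + (d - 2) = 3 * d - 4 by omega] at this

/-- affine point -/
def pt (a b O : Fin 3 → ℂ) (x y : A) : Fin 3 → A :=
  fun i => (algebraMap ℂ A (a i) + algebraMap ℂ A (b i) * x) + algebraMap ℂ A (O i) * y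

theorem chain_pt (D : Derivation ℂ A A) (a b O : Fin 3 → ℂ) (x y : A) (F : P3) :
    D (MvPolynomial.aeval (pt a b O x y) F) = MvPolynomial.aeval (pt a b O x y) (dd b F) * D x +
      MvPolynomial.aeval (pt a b O x y) (dd O F) * D y := by
  rw [chain_rule, aeval_dd, aeval_dd, Finset.sum_mul, Finset.sum_mul, ← Finset.sum_add_distrib]
  refine Finset.sum_congr rfl fun i _ => ?_
  simp [pt]; ring

theorem aeval_map_pt {A' : Type*} [CommRing A'] [Algebra ℂ A'] (φ : A →ₐ[ℂ] A')
    (a b O : Fin 3 → ℂ) (x y : A) (F : P3) :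
    φ (MvPolynomial.aeval (pt a b O x y) F) = MvPolynomial.aeval (pt a b O (φ x) (φ y)) F := by
  rw [MvPolynomial.comp_aeval_apply]
  congr 2
  ext i; simp [pt]

/-- bivariate polynomial -/
def biv (a b O : Fin 3 → ℂ) (F : P3) : Polynomial (Polynomial ℂ) :=
  MvPolynomial.aeval (pt a b O (Polynomial.C (Polynomial.X : Polynomial ℂ)) Polynomial.X) F

theorem biv_eq (a b O : Fin 3 → ℂ) (F : P3) : biv a b O F = MvPolynomial.aeval
    (fun i => Polynomial.C (Polynomial.C (a i) + Polynomial.C (b i) * Polynomial.X) +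
      Polynomial.C (Polynomial.C (O i)) * Polynomial.X) F := by
  unfold biv pt
  congr 2
  ext1 i
  simp [Polynomial.algebraMap_apply]

theorem biv_natDegree {F : P3} {d : ℕ} (hF : F.IsHomogeneous d) (a b O : Fin 3 → ℂ) :
    (biv a b O F).natDegree ≤ d := by
  rw [biv_eq]; exact natDegree_aeval_lin hF _ _

theorem aeval_C_vec (O : Fin 3 → ℂ) (F : P3) :
    MvPolynomial.aeval (fun i => algebraMap ℂ A (O i)) F =
      algebraMap ℂ A (MvPolynomial.eval O F) := by
  have := MvPolynomial.comp_aeval_apply (R := ℂ) (σ := Fin 3) O (Algebra.ofId ℂ A) F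
  rw [MvPolynomial.aeval_eq_eval] at this
  exact this.symm

theorem biv_coeff {F : P3} {d : ℕ} (hF : F.IsHomogeneous d) (a b O : Fin 3 → ℂ) :
    (biv a b O F).coeff d = Polynomial.C (MvPolynomial.eval O F) := by
  rw [biv_eq, coeff_aeval_lin hF]; exact aeval_C_vec O F

theorem lineRestrict_natDegree {F : P3} {d : ℕ} (hF : F.IsHomogeneous d) (a b : Fin 3 → ℂ) :
    (lineRestrict F a b).natDegree ≤ d := natDegree_aeval_lin hF _ _

theorem lineRestrict_coeff {F : P3} {d : ℕ} (hF : F.IsHomogeneous d) (a b : Fin 3 → ℂ) :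
    (lineRestrict F a b).coeff d = MvPolynomial.eval b F := by
  unfold lineRestrict; rw [coeff_aeval_lin hF, MvPolynomial.aeval_eq_eval]

theorem lineRestrict_eval (F : P3) (a b : Fin 3 → ℂ) (y : ℂ) :
    (lineRestrict F a b).eval y = MvPolynomial.eval (a + y • b) F := by
  have := MvPolynomial.comp_aeval_apply (R := ℂ) (σ := Fin 3)
    (fun i => Polynomial.C (a i) + Polynomial.C (b i) * Polynomial.X) (Polynomial.aeval y) F
  rw [← Polynomial.coe_aeval_eq_eval, lineRestrict]
  refine Eq.trans this ?_
  rw [MvPolynomial.aeval_eq_eval]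
  congr 2
  ext i; simp; ring

theorem lineRestrict_derivative (F : P3) (a b : Fin 3 → ℂ) :
    Polynomial.derivative (lineRestrict F a b) = lineRestrict (dd b F) a b := by
  have := chain_rule (Polynomial.derivative' (R := ℂ))
    (fun i => Polynomial.C (a i) + Polynomial.C (b i) * Polynomial.X) F
  unfold lineRestrict
  refine Eq.trans this ?_
  rw [aeval_dd]
  refine Finset.sum_congr rfl fun i _ => ?_
  simp [Polynomial.derivative'_apply]; ring

theorem biv_map_eval (F : P3) (a b O : Fin 3 → ℂ) (x : ℂ) :
    (biv a b O F).map (Polynomial.evalRingHom x) = lineRestrict F (a + x • b) O := by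
  have h := aeval_map_pt (Polynomial.mapAlgHom (Polynomial.aeval (R := ℂ) (A := ℂ) x)) a b O
    (Polynomial.C (Polynomial.X : Polynomial ℂ)) Polynomial.X F
  have h1 : (biv a b O F).map (Polynomial.evalRingHom x) =
    Polynomial.mapAlgHom (Polynomial.aeval (R := ℂ) (A := ℂ) x) (biv a b O F) := rfl
  rw [h1, biv, h, lineRestrict]
  congr 2
  funext i
  simp [pt, Polynomial.algebraMap_apply]
  ring

/-- determinant -/
def det3 (p q r : Fin 3 → ℂ) : ℂ :=
  p 0 * (q 1 * r 2 - q 2 * r 1) - p 1 * (q 0 * r 2 - q 2 * r 0) + p 2 * (q 0 * r 1 - q 1 * r 0)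

theorem cramer3 (a b c q : Fin 3 → ℂ) :
    det3 a b c • q = det3 q b c • a + det3 a q c • b + det3 a b q • c := by
  ext i; fin_cases i <;> simp [det3] <;> ring

end basics

section flex

theorem lineRestrict_aeval {A : Type*} [CommRing A] [Algebra ℂ A] (F : P3) (q v : Fin 3 → ℂ)
    (ξ : A) : Polynomial.aeval ξ (lineRestrict F q v) =
      MvPolynomial.aeval (fun i => algebraMap ℂ A (q i) + algebraMap ℂ A (v i) * ξ) F := by
  unfold lineRestrict
  rw [MvPolynomial.comp_aeval_apply]
  congr 2
  funext i
  simp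

theorem contact_dvd {F : P3} {d : ℕ} (hF : F.IsHomogeneous d) (q v : Fin 3 → ℂ) (α β : ℂ) (m : ℕ)
    (h : Polynomial.X ^ m ∣ lineRestrict F q v) :
    Polynomial.X ^ m ∣ lineRestrict F q (α • q + β • v) := by
  obtain ⟨r, hr⟩ := h
  set one : PowerSeries ℂ := 1 + PowerSeries.C α * PowerSeries.X with hone
  have hu : one * one⁻¹ = 1 := PowerSeries.mul_inv_cancel _ (by simp [hone])
  set ξ : PowerSeries ℂ := PowerSeries.C β * PowerSeries.X * one⁻¹ with hξ
  have h1 : (lineRestrict F q (α • q + β • v) : PowerSeries ℂ) =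
      one ^ d * Polynomial.aeval ξ (lineRestrict F q v) := by
    rw [lineRestrict_aeval, ← aeval_scale hF]
    have h2 : (lineRestrict F q (α • q + β • v) : PowerSeries ℂ) =
        Polynomial.aeval (PowerSeries.X : PowerSeries ℂ) (lineRestrict F q (α • q + β • v)) := by
      rw [Polynomial.aeval_def, Polynomial.eval₂_eq_sum_range]
      conv_lhs => rw [Polynomial.as_sum_range_C_mul_X_pow (lineRestrict F q (α • q + β • v))]
      rw [← Polynomial.coeToPowerSeries.ringHom_apply, map_sum]
      simp
    rw [h2, lineRestrict_aeval]
    congr 2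
    funext i
    have h3 : ∀ c : ℂ, algebraMap ℂ (PowerSeries ℂ) c = PowerSeries.C c := fun c => by simp
    simp only [h3, Pi.add_apply, Pi.smul_apply, smul_eq_mul, map_add, map_mul, hξ]
    linear_combination (-(PowerSeries.C (v i) * PowerSeries.C β * PowerSeries.X)) * hu
      + PowerSeries.C (q i) * (hone.symm)
  have h4 : (PowerSeries.X : PowerSeries ℂ) ^ m ∣ (lineRestrict F q (α • q + β • v) : PowerSeries ℂ) := by
    rw [h1, hr, map_mul, map_pow, Polynomial.aeval_X, hξ]
    refine Dvd.dvd.mul_left (Dvd.dvd.mul_right (pow_dvd_pow_of_dvd ?_ m) _) _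
    exact ⟨PowerSeries.C β * one⁻¹, by ring⟩
  rw [Polynomial.X_pow_dvd_iff]
  intro k hk
  have := PowerSeries.X_pow_dvd_iff.mp h4 k hk
  simpa using this

theorem contact_eq {F : P3} {d : ℕ} (hF : F.IsHomogeneous d) (q v : Fin 3 → ℂ) (α β : ℂ)
    (hβ : β ≠ 0) : contactAt F q (α • q + β • v) = contactAt F q v := by
  have back : v = (-(α / β)) • q + (β⁻¹) • (α • q + β • v) := by
    ext i; simp; field_simp; ring
  have key : ∀ m, Polynomial.X ^ m ∣ lineRestrict F q (α • q + β • v) ↔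
      Polynomial.X ^ m ∣ lineRestrict F q v := fun m =>
    ⟨fun h => by rw [back]; exact contact_dvd hF q _ _ _ m h, contact_dvd hF q v α β m⟩
  unfold contactAt
  by_cases h0 : lineRestrict F q v = 0
  · have : lineRestrict F q (α • q + β • v) = 0 := by
      by_contra hne
      have h2 := (key ((lineRestrict F q (α • q + β • v)).natDegree + 1)).mpr (by simp [h0])
      have := Polynomial.natDegree_le_of_dvd h2 hne
      simp at this
    rw [h0, this]
  · have h0' : lineRestrict F q (α • q + β • v) ≠ 0 := by
      intro hne
      have h2 := (key ((lineRestrict F q v).natDegree + 1)).mp (by simp [hne])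
      have := Polynomial.natDegree_le_of_dvd h2 h0
      simp at this
    apply le_antisymm
    · rw [Polynomial.le_rootMultiplicity_iff h0]
      have := Polynomial.pow_rootMultiplicity_dvd (lineRestrict F q (α • q + β • v)) 0
      simp only [Polynomial.C_0, sub_zero] at this ⊢
      exact (key _).mp this
    · rw [Polynomial.le_rootMultiplicity_iff h0']
      have := Polynomial.pow_rootMultiplicity_dvd (lineRestrict F q v) 0
      simp only [Polynomial.C_0, sub_zero] at this ⊢
      exact (key _).mpr this

theorem linInd_iff (p q : Fin 3 → ℂ) : LinearIndependent ℂ ![p, q] ↔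
    ∀ s t : ℂ, s • p + t • q = 0 → s = 0 ∧ t = 0 := LinearIndependent.pair_iff

theorem exists_det3 {p q : Fin 3 → ℂ} (h : LinearIndependent ℂ ![p, q]) :
    ∃ r, det3 p q r ≠ 0 := by
  rw [linInd_iff] at h
  by_contra! hc
  have e0 := hc ![1, 0, 0]
  have e1 := hc ![0, 1, 0]
  have e2 := hc ![0, 0, 1]
  simp [det3] at e0 e1 e2
  have hp : p ≠ 0 := by
    rintro rfl
    have := h 1 0 (by simp)
    simp at this
  have : ∃ i, p i ≠ 0 := by
    by_contra! h3; exact hp (funext h3)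
  obtain ⟨i, hi⟩ := this
  have := h (q i) (-(p i)) (by
    ext j
    fin_cases i <;> fin_cases j <;> simp <;> first | linear_combination e0 | linear_combination -e0 | linear_combination e1 | linear_combination -e1 | linear_combination e2 | linear_combination -e2 | ring)
  exact hi (by simpa using this.2)


theorem linInd_of_det3 {p q r : Fin 3 → ℂ} (h : det3 p q r ≠ 0) : LinearIndependent ℂ ![p, q] := by
  rw [linInd_iff]
  intro s t hst
  have e0 := congrFun hst 0
  have e1 := congrFun hst 1
  have e2 := congrFun hst 2
  simp at e0 e1 e2
  constructor
  · have : s * det3 p q r = 0 := by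
      unfold det3
      linear_combination (q 1 * r 2 - q 2 * r 1) * e0 - (q 0 * r 2 - q 2 * r 0) * e1 +
        (q 0 * r 1 - q 1 * r 0) * e2
    simpa [h] using this
  · have : t * det3 p q r = 0 := by
      unfold det3
      linear_combination (-(p 1 * r 2 - p 2 * r 1)) * e0 + (p 0 * r 2 - p 2 * r 0) * e1 -
        (p 0 * r 1 - p 1 * r 0) * e2
    simpa [h] using this

theorem dotv_add (g p q : Fin 3 → ℂ) : dotv g (p + q) = dotv g p + dotv g q := by
  simp [dotv, mul_add, Finset.sum_add_distrib]

theorem dotv_smul (g p : Fin 3 → ℂ) (c : ℂ) : dotv g (c • p) = c * dotv g p := by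
  simp only [dotv, Finset.mul_sum, Pi.smul_apply, smul_eq_mul]
  exact Finset.sum_congr rfl fun i _ => by ring

theorem eq_zero_of_basis {g p q r : Fin 3 → ℂ} (h : det3 p q r ≠ 0) (hp : dotv g p = 0)
    (hq : dotv g q = 0) (hr : dotv g r = 0) : g = 0 := by
  have key : ∀ x, dotv g x = 0 := by
    intro x
    have := congrArg (dotv g) (cramer3 p q r x)
    simp only [dotv_add, dotv_smul, hp, hq, hr, mul_zero, add_zero] at this
    simpa [h] using this
  funext i
  have := key (Pi.single i 1)
  simpa [dotv, Pi.single_apply] using this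

theorem ker_form {g q v v' : Fin 3 → ℂ} (hg : g ≠ 0) (hq : dotv g q = 0)
    (hv : dotv g v = 0) (hi : LinearIndependent ℂ ![q, v]) (hv' : dotv g v' = 0) :
    ∃ α β : ℂ, v' = α • q + β • v := by
  obtain ⟨r, hr⟩ := exists_det3 hi
  have hgr : dotv g r ≠ 0 := fun h => hg (eq_zero_of_basis hr hq hv h)
  have hc := cramer3 q v r v'
  have h1 := congrArg (dotv g) hc
  simp only [dotv_add, dotv_smul, hq, hv, hv', mul_zero, zero_add] at h1
  have h2 : det3 q v v' = 0 := by simpa [hgr] using h1.symm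
  rw [h2, zero_smul, add_zero] at hc
  refine ⟨(det3 q v r)⁻¹ * det3 v' v r, (det3 q v r)⁻¹ * det3 q v' r, ?_⟩
  rw [mul_smul, mul_smul, ← smul_add, ← hc, smul_smul, inv_mul_cancel₀ hr, one_smul]

theorem fw_eq {F : P3} {d : ℕ} (hF : F.IsHomogeneous d) {q v : Fin 3 → ℂ}
    (hq : MvPolynomial.eval q F = 0) (hg : gradVec F q ≠ 0) (hi : LinearIndependent ℂ ![q, v])
    (hv : dotv (gradVec F q) v = 0) : flexWeightAt F q = padm (contactAt F q v) := by
  have hgq : dotv (gradVec F q) q = 0 := by rw [dotv_grad, euler hF, hq, mul_zero]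
  have key : ∀ v', LinearIndependent ℂ ![q, v'] ∧ dotv (gradVec F q) v' = 0 →
      padm (contactAt F q v') = padm (contactAt F q v) := by
    rintro v' ⟨h1, h2⟩
    obtain ⟨α, β, rfl⟩ := ker_form hg hgq hv hi h2
    rw [contact_eq hF]
    rintro rfl
    rw [linInd_iff] at h1
    have := h1 α (-1) (by simp)
    simp at this
  have le : ∀ v', (⨆ _ : LinearIndependent ℂ ![q, v'] ∧ dotv (gradVec F q) v' = 0,
    padm (contactAt F q v')) ≤ padm (contactAt F q v) := by
    intro v'
    apply ciSup_le'
    intro h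
    exact (key v' h).le
  apply le_antisymm
  · exact ciSup_le' le
  · refine le_trans ?_ (le_ciSup (f := fun v' => (⨆ _ : LinearIndependent ℂ ![q, v'] ∧
      dotv (gradVec F q) v' = 0, padm (contactAt F q v'))) ⟨_, by rintro _ ⟨v', rfl⟩; exact le v'⟩ v)
    rw [ciSup_pos ⟨hi, hv⟩]

theorem lineRestrict_smul {F : P3} {d : ℕ} (hF : F.IsHomogeneous d) (u : ℂ) (q v : Fin 3 → ℂ) :
    lineRestrict F (u • q) (u • v) = Polynomial.C (u ^ d) * lineRestrict F q v := by
  unfold lineRestrict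
  rw [Polynomial.C_pow, ← aeval_scale hF]
  congr 2
  funext i; simp; ring

theorem contact_smul {F : P3} {d : ℕ} (hF : F.IsHomogeneous d) {u : ℂ} (hu : u ≠ 0)
    (q v : Fin 3 → ℂ) : contactAt F (u • q) (u • v) = contactAt F q v := by
  unfold contactAt
  rw [lineRestrict_smul hF]
  by_cases h0 : lineRestrict F q v = 0
  · simp [h0]
  have hu' : u ^ d ≠ 0 := pow_ne_zero _ hu
  rw [Polynomial.rootMultiplicity_mul (mul_ne_zero (Polynomial.C_ne_zero.mpr hu') h0),
    Polynomial.rootMultiplicity_C, zero_add]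

theorem gradVec_smul {F : P3} {d : ℕ} (hF : F.IsHomogeneous d) (u : ℂ) (q : Fin 3 → ℂ) :
    gradVec F (u • q) = u ^ (d - 1) • gradVec F q := by
  funext i
  simp [gradVec, eval_scale (hF.pderiv (i := i))]

theorem dotv_smul_left (g p : Fin 3 → ℂ) (c : ℂ) : dotv (c • g) p = c * dotv g p := by
  simp only [dotv, Finset.mul_sum, Pi.smul_apply, smul_eq_mul]
  exact Finset.sum_congr rfl fun i _ => by ring

theorem fw_smul {F : P3} {d : ℕ} (hF : F.IsHomogeneous d) {u : ℂ} (hu : u ≠ 0)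
    (q : Fin 3 → ℂ) : flexWeightAt F (u • q) = flexWeightAt F q := by
  unfold flexWeightAt
  have e : Function.Surjective (fun v : Fin 3 → ℂ => u • v) := fun v =>
    ⟨u⁻¹ • v, by simp [smul_smul, hu]⟩
  rw [← e.iSup_comp]
  congr 1
  funext v
  rw [contact_smul hF hu]
  have : (LinearIndependent ℂ ![u • q, u • v] ∧ dotv (gradVec F (u • q)) (u • v) = 0) ↔
      (LinearIndependent ℂ ![q, v] ∧ dotv (gradVec F q) v = 0) := by
    rw [linInd_iff, linInd_iff, gradVec_smul hF, dotv_smul, dotv_smul_left]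
    have h2 : ∀ s t : ℂ, s • u • q + t • u • v = u • (s • q + t • v) := by
      intro s t; rw [smul_add, smul_comm s, smul_comm t]
    simp only [h2, smul_eq_zero, hu, false_or, mul_eq_zero, pow_ne_zero (d - 1) hu]
  simp only [this]

theorem fw_zero {F : P3} {q : Fin 3 → ℂ} (h : flexWeightAt F q ≠ 0) :
    MvPolynomial.eval q F = 0 := by
  by_contra hc
  apply h
  have : ∀ v, padm (contactAt F q v) = 0 := by
    intro v
    unfold contactAt
    rw [Polynomial.rootMultiplicity_eq_zero]
    · rfl
    · rw [Polynomial.IsRoot, lineRestrict_eval]; simpa using hc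
  unfold flexWeightAt
  apply Nat.le_zero.mp
  apply ciSup_le'
  intro v
  apply ciSup_le'
  intro _
  rw [this]

theorem smooth_grad {F : P3} {d : ℕ} (hF : IsSmoothCurve F d) {q : Fin 3 → ℂ} (hq : q ≠ 0)
    (h : MvPolynomial.eval q F = 0) : gradVec F q ≠ 0 := by
  obtain ⟨i, hi⟩ := hF.2.2 q hq h
  exact fun h => hi (congrFun h i)

theorem linInd_ne {q v : Fin 3 → ℂ} (h : LinearIndependent ℂ ![q, v]) (s t : ℂ)
    (hst : s ≠ 0 ∨ t ≠ 0) : s • q + t • v ≠ 0 := by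
  intro h2
  obtain ⟨rfl, rfl⟩ := (linInd_iff _ _).mp h s t h2
  simp at hst

theorem no_line {F : P3} {d : ℕ} (hF : IsSmoothCurve F d) (hd : 2 ≤ d) {q v : Fin 3 → ℂ}
    (hi : LinearIndependent ℂ ![q, v]) : lineRestrict F q v ≠ 0 := by
  intro h0
  obtain ⟨r, hr⟩ := exists_det3 hi
  have hon : ∀ s t : ℂ, MvPolynomial.eval (s • q + t • v) F = 0 := by
    have h1 : ∀ t : ℂ, MvPolynomial.eval (q + t • v) F = 0 := by
      intro t; rw [← lineRestrict_eval, h0]; simp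
    intro s t
    by_cases hs : s = 0
    · subst hs
      rw [zero_smul, zero_add, eval_scale hF.1, ← lineRestrict_coeff hF.1 q v, h0]; simp
    · have : s • q + t • v = s • (q + (t / s) • v) := by
        rw [smul_add, smul_smul]; congr 2; field_simp
      rw [this, eval_scale hF.1, h1, mul_zero]
  have hdv : ∀ s t : ℂ, MvPolynomial.eval (s • q + t • v) (dd v F) = 0 := by
    intro s t
    have h1 : lineRestrict F (s • q + t • v) v = 0 := by
      apply Polynomial.funext
      intro y
      rw [lineRestrict_eval, add_assoc, ← add_smul, hon]; simp
    have h2 := lineRestrict_derivative F (s • q + t • v) v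
    rw [h1] at h2
    have := congrArg (Polynomial.eval 0) h2
    rw [lineRestrict_eval] at this
    simpa using this.symm
  have hdq : ∀ s t : ℂ, MvPolynomial.eval (s • q + t • v) (dd q F) = 0 := by
    intro s t
    have h1 : lineRestrict F (s • q + t • v) q = 0 := by
      apply Polynomial.funext
      intro y
      rw [lineRestrict_eval, show s • q + t • v + y • q = (s + y) • q + t • v by
        rw [add_smul]; abel, hon]; simp
    have h2 := lineRestrict_derivative F (s • q + t • v) q
    rw [h1] at h2
    have := congrArg (Polynomial.eval 0) h2
    rw [lineRestrict_eval] at this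
    simpa using this.symm
  have key : ∀ s t : ℂ, (s ≠ 0 ∨ t ≠ 0) → MvPolynomial.eval (s • q + t • v) (dd r F) ≠ 0 := by
    intro s t hst hc
    refine smooth_grad hF (linInd_ne hi s t hst) (hon s t) ?_
    refine eq_zero_of_basis hr ?_ ?_ ?_ <;> rw [dotv_grad]
    · exact hdq s t
    · exact hdv s t
    · exact hc
  have hdeg := lineRestrict_coeff (dd_hom hF.1 r) q v
  have h1 := key 0 1 (by simp)
  rw [zero_smul, one_smul, zero_add, ← hdeg] at h1
  have h2 : 0 < (lineRestrict (dd r F) q v).degree := by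
    rw [← Polynomial.natDegree_pos_iff_degree_pos]
    have := Polynomial.le_natDegree_of_ne_zero h1
    omega
  obtain ⟨t, ht⟩ := IsAlgClosed.exists_root _ h2.ne'
  rw [Polynomial.IsRoot, lineRestrict_eval] at ht
  exact key 1 t (by simp) (by rw [one_smul]; exact ht)

theorem coeff_two (F : P3) (q v : Fin 3 → ℂ) :
    2 * (lineRestrict F q v).coeff 2 = MvPolynomial.eval q (dd v (dd v F)) := by
  have h := lineRestrict_derivative (dd v F) q v
  rw [← lineRestrict_derivative] at h
  have := congrArg (fun p => Polynomial.coeff p 0) h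
  simp only [Polynomial.coeff_derivative] at this
  rw [Polynomial.coeff_zero_eq_eval_zero (lineRestrict _ _ _), lineRestrict_eval, zero_smul,
    add_zero] at this
  rw [← this]; norm_num; ring

theorem coeff_one (F : P3) (q v : Fin 3 → ℂ) :
    (lineRestrict F q v).coeff 1 = MvPolynomial.eval q (dd v F) := by
  have h := lineRestrict_derivative F q v
  have := congrArg (fun p => Polynomial.coeff p 0) h
  simp only [Polynomial.coeff_derivative] at this
  rw [Polynomial.coeff_zero_eq_eval_zero (lineRestrict _ _ _), lineRestrict_eval, zero_smul,
    add_zero] at this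
  rw [← this]; norm_num

theorem coeff_zero' (F : P3) (q v : Fin 3 → ℂ) :
    (lineRestrict F q v).coeff 0 = MvPolynomial.eval q F := by
  rw [Polynomial.coeff_zero_eq_eval_zero (lineRestrict _ _ _), lineRestrict_eval, zero_smul,
    add_zero]

theorem ddvv (F : P3) (b O : Fin 3 → ℂ) (s t : ℂ) : dd (s • b + t • O) (dd (s • b + t • O) F) =
    MvPolynomial.C (s ^ 2) * dd b (dd b F) + 2 * (MvPolynomial.C (s * t) * dd b (dd O F)) +
      MvPolynomial.C (t ^ 2) * dd O (dd O F) := by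
  simp only [dd_vec_add, dd_vec_smul, dd_add, dd_Cmul, dd_comm O b, MvPolynomial.C_mul,
    MvPolynomial.C_pow]
  ring

theorem det3_comb (a b O : Fin 3 → ℂ) (x y s t : ℂ) :
    ∀ (r : Fin 3 → ℂ), det3 (a + x • b + y • O) (s • b + t • O) r =
      s * det3 a b r + t * det3 a O r + (x * t - y * s) * det3 b O r := by
  intro r; simp [det3]; ring

theorem lin_ind_comb {a b O : Fin 3 → ℂ} (h : det3 a b O ≠ 0) (x y s t : ℂ)
    (hst : s ≠ 0 ∨ t ≠ 0) : LinearIndependent ℂ ![a + x • b + y • O, s • b + t • O] := by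
  by_cases hs : s = 0
  · have ht : t ≠ 0 := by simpa [hs] using hst
    apply linInd_of_det3 (r := b)
    rw [det3_comb]
    have e1 : det3 a b b = 0 := by unfold det3; ring
    have e2 : det3 b O b = 0 := by unfold det3; ring
    have e3 : det3 a O b = - det3 a b O := by unfold det3; ring
    rw [e1, e2, e3]; simpa [ht] using h
  · apply linInd_of_det3 (r := O)
    rw [det3_comb]
    have e1 : det3 a O O = 0 := by unfold det3; ring
    have e2 : det3 b O O = 0 := by unfold det3; ring
    rw [e1, e2]; simpa [hs] using h

/-- flexes are detected by the bordered Hessian -/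
theorem flex_iff {F : P3} {d : ℕ} (hF : IsSmoothCurve F d) (hd : 2 ≤ d) {a b O : Fin 3 → ℂ}
    (h : det3 a b O ≠ 0) (x y : ℂ) (hz : MvPolynomial.eval (a + x • b + y • O) F = 0) :
    flexWeightAt F (a + x • b + y • O) ≠ 0 ↔
      MvPolynomial.eval (a + x • b + y • O) (Bord b O F) = 0 := by
  set z := a + x • b + y • O with hzdef
  have hzne : z ≠ 0 := by
    have := linInd_ne (lin_ind_comb h x y 1 0 (by simp)) 1 0 (by simp)
    simpa using this
  set s := - MvPolynomial.eval z (dd O F) with hs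
  set t := MvPolynomial.eval z (dd b F) with ht
  have hg := smooth_grad hF hzne hz
  have hst : s ≠ 0 ∨ t ≠ 0 := by
    by_contra! hc
    have hb : dotv (gradVec F z) b = 0 := by rw [dotv_grad]; exact hc.2
    have hO : dotv (gradVec F z) O = 0 := by rw [dotv_grad]; simpa [hs] using hc.1
    have hzz : dotv (gradVec F z) z = 0 := by rw [dotv_grad, euler hF.1, hz, mul_zero]
    rw [hzdef, dotv_add, dotv_add, dotv_smul, dotv_smul, ← hzdef, hb, hO] at hzz
    exact hg (eq_zero_of_basis h (by simpa using hzz) hb hO)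
  have hi := lin_ind_comb h x y s t hst
  have hv : MvPolynomial.eval z (dd (s • b + t • O) F) = 0 := by
    rw [dd_vec_add, dd_vec_smul, dd_vec_smul]; simp only [map_add, map_mul, MvPolynomial.eval_C]
    rw [← ht, hs]; ring
  have hB : 2 * (lineRestrict F z (s • b + t • O)).coeff 2 = MvPolynomial.eval z (Bord b O F) := by
    rw [coeff_two, ddvv, Bord]
    simp only [map_add, map_sub, map_mul, map_pow, MvPolynomial.eval_C, map_ofNat]
    rw [← ht, hs]; ring
  rw [fw_eq hF.1 hz hg hi (by rw [dotv_grad]; exact hv)]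
  have hne := no_line hF hd hi
  have : padm (contactAt F z (s • b + t • O)) ≠ 0 ↔ 3 ≤ contactAt F z (s • b + t • O) := by
    unfold padm; omega
  rw [this, contactAt, Polynomial.le_rootMultiplicity_iff hne, ← hB]
  simp only [Polynomial.C_0, sub_zero]
  rw [Polynomial.X_pow_dvd_iff]
  constructor
  · intro h; rw [h 2 (by norm_num), mul_zero]
  · intro h k hk
    interval_cases k
    · rw [coeff_zero', hz]
    · rw [coeff_one, hv]
    · simpa using h

end flex

section pser

abbrev PS := PowerSeries ℂ

def ccA : PS →ₐ[ℂ] ℂ :=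
  { PowerSeries.constantCoeff (R := ℂ) with
    commutes' := fun r => by
      simp [PowerSeries.algebraMap_apply] }

theorem ccA_apply (y : PS) : ccA y = PowerSeries.constantCoeff y := rfl

def bps (a b O : Fin 3 → ℂ) (F : P3) : Polynomial PS :=
  MvPolynomial.aeval (pt a b O (Polynomial.C (PowerSeries.X : PS)) Polynomial.X) F

def ev (a b O : Fin 3 → ℂ) (F : P3) (y : PS) : PS :=
  MvPolynomial.aeval (pt a b O (PowerSeries.X : PS) y) F

theorem bps_eq (a b O : Fin 3 → ℂ) (F : P3) : bps a b O F = MvPolynomial.aeval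
    (fun i => Polynomial.C (algebraMap ℂ PS (a i) + algebraMap ℂ PS (b i) * PowerSeries.X) +
      Polynomial.C (algebraMap ℂ PS (O i)) * Polynomial.X) F := by
  unfold bps pt
  congr 2
  ext1 i
  simp only [Polynomial.C_add, Polynomial.C_mul, Polynomial.algebraMap_apply]

theorem bps_natDegree {F : P3} {d : ℕ} (hF : F.IsHomogeneous d) (a b O : Fin 3 → ℂ) :
    (bps a b O F).natDegree ≤ d := by
  rw [bps_eq]; exact natDegree_aeval_lin hF _ _

theorem bps_coeff {F : P3} {d : ℕ} (hF : F.IsHomogeneous d) (a b O : Fin 3 → ℂ) :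
    (bps a b O F).coeff d = algebraMap ℂ PS (MvPolynomial.eval O F) := by
  rw [bps_eq, coeff_aeval_lin hF]; exact aeval_C_vec O F

theorem bps_eval (a b O : Fin 3 → ℂ) (F : P3) (y : PS) :
    (bps a b O F).eval y = ev a b O F y := by
  have h := aeval_map_pt ((Polynomial.aeval (R := PS) y).restrictScalars ℂ) a b O
    (Polynomial.C (PowerSeries.X : PS)) Polynomial.X F
  have h1 : (bps a b O F).eval y =
    ((Polynomial.aeval (R := PS) y).restrictScalars ℂ) (bps a b O F) := by
    rw [AlgHom.restrictScalars_apply, Polynomial.coe_aeval_eq_eval]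
  rw [h1, bps, h, ev]
  simp

theorem bps_map_cc (a b O : Fin 3 → ℂ) (F : P3) :
    (bps a b O F).map (ccA : PS →+* ℂ) = lineRestrict F a O := by
  have h := aeval_map_pt (Polynomial.mapAlgHom ccA) a b O
    (Polynomial.C (PowerSeries.X : PS)) Polynomial.X F
  have h1 : (bps a b O F).map (ccA : PS →+* ℂ) = Polynomial.mapAlgHom ccA (bps a b O F) := rfl
  rw [h1, bps, h, lineRestrict]
  congr 2
  funext i
  simp [pt, Polynomial.algebraMap_apply, ccA_apply]

theorem ev_cc (a b O : Fin 3 → ℂ) (F : P3) (y : PS) :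
    ccA (ev a b O F y) = MvPolynomial.eval (a + ccA y • O) F := by
  rw [ev, aeval_map_pt, MvPolynomial.aeval_eq_eval]
  congr 2
  funext i
  simp [pt, ccA_apply]; ring

def phi (x0 : ℂ) : Polynomial ℂ →ₐ[ℂ] PS :=
  Polynomial.aeval (PowerSeries.X + algebraMap ℂ PS x0)

theorem biv_map_phi (a b O : Fin 3 → ℂ) (F : P3) (x0 : ℂ) :
    (biv a b O F).map (phi x0 : Polynomial ℂ →+* PS) = bps (a + x0 • b) b O F := by
  have h := aeval_map_pt (Polynomial.mapAlgHom (phi x0)) a b O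
    (Polynomial.C (Polynomial.X : Polynomial ℂ)) Polynomial.X F
  have h1 : (biv a b O F).map (phi x0 : Polynomial ℂ →+* PS) =
    Polynomial.mapAlgHom (phi x0) (biv a b O F) := rfl
  rw [h1, biv, h, bps]
  congr 2
  funext i
  simp [pt, Polynomial.algebraMap_apply, phi]
  ring

theorem phi_cc (x0 : ℂ) (p : Polynomial ℂ) : ccA (phi x0 p) = p.eval x0 := by
  rw [phi, ← Polynomial.aeval_algHom_apply, map_add, AlgHom.commutes, ccA_apply]
  simp

theorem order_phi (x0 : ℂ) {p : Polynomial ℂ} (hp : p ≠ 0) :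
    (phi x0 p).order = p.rootMultiplicity x0 := by
  obtain ⟨q, hq, hx⟩ := Polynomial.exists_eq_pow_rootMultiplicity_mul_and_not_dvd p hp x0
  conv_lhs => rw [hq]
  rw [map_mul, map_pow, PowerSeries.order_mul]
  have h1 : phi x0 (Polynomial.X - Polynomial.C x0) = PowerSeries.X := by
    simp [phi]
  have h2 : (phi x0 q).order = 0 := by
    rw [PowerSeries.order_zero_of_unit]
    rw [PowerSeries.isUnit_iff_constantCoeff, ← ccA_apply, phi_cc, isUnit_iff_ne_zero]
    intro h
    exact hx (Polynomial.dvd_iff_isRoot.mpr h)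
  rw [h1, h2, PowerSeries.order_X_pow, add_zero]

theorem unit_iff (y : PS) : IsUnit y ↔ ccA y ≠ 0 := by
  rw [PowerSeries.isUnit_iff_constantCoeff, ← ccA_apply, isUnit_iff_ne_zero]

/-- the derivation -/
abbrev DX : Derivation ℂ PS PS := PowerSeries.derivative ℂ

theorem ev_deriv (a b O : Fin 3 → ℂ) (F : P3) (y : PS) :
    DX (ev a b O F y) = ev a b O (dd b F) y + ev a b O (dd O F) y * DX y := by
  unfold ev
  rw [chain_pt]
  simp [DX]

theorem branch_ident (a b O : Fin 3 → ℂ) (F : P3) (y : PS) (h : ev a b O F y = 0) :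
    DX (DX y) * (ev a b O (dd O F) y) ^ 3 = - ev a b O (Bord b O F) y := by
  have h1 := ev_deriv a b O F y
  rw [h, map_zero] at h1
  have h2 := congrArg DX h1
  rw [map_zero, map_add, Derivation.leibniz, ev_deriv, ev_deriv] at h2
  have hB : ev a b O (Bord b O F) y = (ev a b O (dd O F) y) ^ 2 * ev a b O (dd b (dd b F)) y -
      2 * (ev a b O (dd b F) y * ev a b O (dd O F) y * ev a b O (dd b (dd O F)) y) +
      (ev a b O (dd b F) y) ^ 2 * ev a b O (dd O (dd O F)) y := by
    simp [ev, Bord]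
  rw [hB]
  rw [dd_comm O b] at h2
  simp only [smul_eq_mul] at h2
  have h3 : ev a b O (dd b F) y = - (ev a b O (dd O F) y * DX y) := by
    linear_combination -h1
  rw [h3]
  linear_combination -(ev a b O (dd O F) y) ^ 2 * h2

theorem hensel_branch {F : P3} {d : ℕ} (hF : F.IsHomogeneous d) (a b O : Fin 3 → ℂ)
    (hO : MvPolynomial.eval O F ≠ 0) (y0 : ℂ) (h0 : MvPolynomial.eval (a + y0 • O) F = 0)
    (h1 : MvPolynomial.eval (a + y0 • O) (dd O F) ≠ 0) :
    ∃ y : PS, ev a b O F y = 0 ∧ ccA y = y0 := by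
  set c : PS := algebraMap ℂ PS (MvPolynomial.eval O F)⁻¹ with hc
  have hmon : (Polynomial.C c * bps a b O F).Monic := by
    apply Polynomial.monic_of_natDegree_le_of_coeff_eq_one d
    · exact (Polynomial.natDegree_C_mul_le _ _).trans (bps_natDegree hF a b O)
    · rw [Polynomial.coeff_C_mul, bps_coeff hF, hc, ← map_mul, inv_mul_cancel₀ hO, map_one]
  have hcu : ccA c = (MvPolynomial.eval O F)⁻¹ := by rw [hc, AlgHom.commutes]; rfl
  have hy0 : ccA (algebraMap ℂ PS y0) = y0 := by rw [AlgHom.commutes]; rfl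
  have memI : ∀ y : PS, y ∈ Ideal.span {(PowerSeries.X : PS)} ↔ ccA y = 0 := by
    intro y; rw [Ideal.mem_span_singleton, PowerSeries.X_dvd_iff, ccA_apply]
  obtain ⟨y, hy, hyI⟩ := HenselianRing.is_henselian (I := Ideal.span {(PowerSeries.X : PS)})
    (Polynomial.C c * bps a b O F) hmon
    (algebraMap ℂ PS y0)
    (by rw [memI, Polynomial.eval_mul, map_mul, bps_eval, ev_cc, hy0, h0, mul_zero])
    (by
      apply IsUnit.map
      rw [unit_iff, Polynomial.derivative_C_mul, Polynomial.eval_mul, Polynomial.eval_C, map_mul,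
        hcu]
      refine mul_ne_zero (inv_ne_zero hO) ?_
      have : ccA (Polynomial.eval (algebraMap ℂ PS y0) (Polynomial.derivative (bps a b O F))) =
          (Polynomial.derivative ((bps a b O F).map (ccA : PS →+* ℂ))).eval y0 := by
        rw [Polynomial.derivative_map, ← hy0, hy0, Polynomial.eval_map]
        have := Polynomial.hom_eval₂ (Polynomial.derivative (bps a b O F)) (RingHom.id PS)
          (ccA : PS →+* ℂ) (algebraMap ℂ PS y0)
        rw [RingHom.comp_id] at this
        conv_rhs => rw [← hy0]
        exact this
      rw [this, bps_map_cc, lineRestrict_derivative, lineRestrict_eval]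
      exact h1)
  refine ⟨y, ?_, ?_⟩
  · rw [Polynomial.IsRoot, Polynomial.eval_mul, Polynomial.eval_C, bps_eval] at hy
    have : c ≠ 0 := by
      intro h; rw [h, map_zero] at hcu; exact inv_ne_zero hO hcu.symm
    simpa [this] using hy
  · rw [memI, map_sub, hy0, sub_eq_zero] at hyI
    exact hyI

end pser

section pserb

theorem cc_eval (p : Polynomial PS) (y : PS) :
    ccA (p.eval y) = (p.map (ccA : PS →+* ℂ)).eval (ccA y) := by
  rw [Polynomial.eval_map]
  have := Polynomial.hom_eval₂ p (RingHom.id PS) (ccA : PS →+* ℂ) y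
  rw [RingHom.comp_id] at this
  exact this

theorem order_dd (g : PS) (h0 : PowerSeries.coeff 0 g = 0) (h1 : PowerSeries.coeff 1 g = 0) (m : ℕ)
    (h : (DX (DX g)).order = m) : g.order = (m + 2 : ℕ) := by
  rw [PowerSeries.order_eq_nat] at h ⊢
  have hc : ∀ k, PowerSeries.coeff k (DX (DX g)) = PowerSeries.coeff (k + 2) g * (k + 2) * (k + 1) := by
    intro k
    rw [PowerSeries.coeff_derivative, PowerSeries.coeff_derivative]; push_cast; ring
  have hne : ∀ k : ℕ, (k : ℂ) + 2 ≠ 0 ∧ (k : ℂ) + 1 ≠ 0 := by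
    intro k; constructor <;> norm_cast
  constructor
  · intro h2
    apply h.1
    rw [hc, h2]; simp
  · intro i hi
    match i, hi with
    | 0, _ => exact h0
    | 1, _ => exact h1
    | k + 2, hk =>
      have := h.2 k (by omega)
      rw [hc] at this
      simpa [hne k] using this

theorem order_branch {F : P3} {d : ℕ} (hF : F.IsHomogeneous d) {a b O : Fin 3 → ℂ}
    (hD : det3 a b O ≠ 0) {y1 : PS} (hy : ev a b O F y1 = 0)
    (hfy : MvPolynomial.eval (a + ccA y1 • O) (dd O F) ≠ 0)
    (hB : ev a b O (Bord b O F) y1 ≠ 0) :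
    (ev a b O (Bord b O F) y1).order = flexWeightAt F (a + ccA y1 • O) := by
  set y0 := ccA y1 with hy0
  set z0 := a + y0 • O with hz0
  have hz : MvPolynomial.eval z0 F = 0 := by
    rw [hz0, hy0, ← ev_cc a b O F y1, hy, map_zero]
  obtain ⟨f', hf'⟩ : Polynomial.X - Polynomial.C y1 ∣ bps a b O F := by
    rw [Polynomial.dvd_iff_isRoot, Polynomial.IsRoot, bps_eval, hy]
  have hev : ∀ y, ev a b O F y = (y - y1) * f'.eval y := by
    intro y; rw [← bps_eval, hf']; simp
  have hlr : lineRestrict F a O = (Polynomial.X - Polynomial.C y0) * f'.map (ccA : PS →+* ℂ) := by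
    rw [← bps_map_cc a b O F, hf']; simp [hy0]
  have hunit : ∀ y, ccA y = y0 → IsUnit (f'.eval y) := by
    intro y hyy
    rw [unit_iff, cc_eval, hyy]
    have h1 := lineRestrict_derivative F a O
    rw [hlr] at h1
    have := congrArg (Polynomial.eval y0) h1
    rw [lineRestrict_eval] at this
    simp [Polynomial.derivative_mul] at this
    rw [this]; exact hfy
  set c := ccA (DX y1) with hc
  have hfx : MvPolynomial.eval z0 (dd b F) + MvPolynomial.eval z0 (dd O F) * c = 0 := by
    have h1 := congrArg ccA (ev_deriv a b O F y1)
    rw [hy, map_zero, map_zero, map_add, map_mul, ev_cc, ev_cc] at h1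
    exact h1.symm
  have hi : LinearIndependent ℂ ![z0, b + c • O] := by
    have := lin_ind_comb hD 0 y0 1 c (by simp)
    simpa [hz0] using this
  have hg : gradVec F z0 ≠ 0 := by
    intro h
    apply hfy
    rw [← dotv_grad, h]; simp [dotv]
  have hv : dotv (gradVec F z0) (b + c • O) = 0 := by
    rw [dotv_grad, dd_vec_add, dd_vec_smul]
    simp only [map_add, map_mul, MvPolynomial.eval_C]
    linear_combination hfx
  rw [fw_eq hF hz hg hi hv]
  set yl : PS := algebraMap ℂ PS y0 + algebraMap ℂ PS c * PowerSeries.X with hyl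
  have hyl0 : ccA yl = y0 := by
    rw [hyl, map_add, map_mul, AlgHom.commutes, ccA_apply PowerSeries.X]
    simp
  have hL : phi 0 (lineRestrict F z0 (b + c • O)) = ev a b O F yl := by
    rw [ev, lineRestrict, MvPolynomial.comp_aeval_apply]
    congr 2
    funext i
    simp only [phi, pt, hyl, hz0, map_add, map_mul, Polynomial.aeval_C, Polynomial.aeval_X,
      Pi.add_apply, Pi.smul_apply, smul_eq_mul, map_zero, add_zero]
    ring
  set g := yl - y1 with hgdef
  have hDy : DX (DX yl) = 0 := by
    rw [hyl]; simp [DX]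
  have hDg : DX (DX g) = - DX (DX y1) := by
    rw [hgdef, map_sub, map_sub, hDy, zero_sub]
  have hbi := branch_ident a b O F y1 hy
  have hfyu : IsUnit (ev a b O (dd O F) y1 ^ 3) := by
    apply IsUnit.pow
    rw [unit_iff, ev_cc]; exact hfy
  have hord : (ev a b O (Bord b O F) y1).order = (DX (DX g)).order := by
    have h1 : (DX (DX g)) * (ev a b O (dd O F) y1) ^ 3 = ev a b O (Bord b O F) y1 := by
      rw [hDg, neg_mul, hbi, neg_neg]
    rw [← h1, PowerSeries.order_mul, PowerSeries.order_zero_of_unit hfyu, add_zero]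
  have hne : DX (DX g) ≠ 0 := by
    rw [← PowerSeries.order_finite_iff_ne_zero, ← hord, PowerSeries.order_finite_iff_ne_zero]
    exact hB
  obtain ⟨m, hm⟩ : ∃ m : ℕ, (DX (DX g)).order = m :=
    ⟨_, (PowerSeries.coe_toNat_order hne).symm⟩
  have hgo := order_dd g (by
      rw [PowerSeries.coeff_zero_eq_constantCoeff_apply, ← ccA_apply, hgdef, map_sub, hyl0, hy0,
        sub_self]) (by
      have : PowerSeries.coeff 1 g = ccA (DX g) := by
        rw [ccA_apply, ← PowerSeries.coeff_zero_eq_constantCoeff_apply,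
          PowerSeries.coeff_derivative]; simp
      rw [this, hgdef, map_sub, map_sub, ← hc]
      have : DX yl = algebraMap ℂ PS c := by
        rw [hyl]; simp [DX]
      rw [this, AlgHom.commutes]; simp) m hm
  have h3 : (phi 0 (lineRestrict F z0 (b + c • O))).order = (m + 2 : ℕ) := by
    rw [hL, hev, PowerSeries.order_mul, PowerSeries.order_zero_of_unit (hunit _ hyl0), add_zero, hgo]
  have hLne : lineRestrict F z0 (b + c • O) ≠ 0 := by
    intro h
    rw [h, map_zero, PowerSeries.order_zero] at h3
    exact absurd h3.symm (ENat.natCast_ne_top _)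
  rw [order_phi 0 hLne] at h3
  have h4 : contactAt F z0 (b + c • O) = m + 2 := by
    unfold contactAt; exact_mod_cast h3
  rw [hord, hm, h4]; rfl

/-- the resultant of curve and bordered Hessian -/
def Nres (a b O : Fin 3 → ℂ) (F : P3) (d : ℕ) : Polynomial ℂ :=
  Polynomial.resultant (biv a b O F) (biv a b O (Bord b O F)) d (3 * d - 4)

theorem phi_Nres (a b O : Fin 3 → ℂ) (F : P3) (d : ℕ) (x0 : ℂ) : phi x0 (Nres a b O F d) =
    Polynomial.resultant (bps (a + x0 • b) b O F) (bps (a + x0 • b) b O (Bord b O F)) d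
      (3 * d - 4) := by
  rw [← biv_map_phi, ← biv_map_phi, Polynomial.resultant_map_map]; rfl

theorem eval_Nres (a b O : Fin 3 → ℂ) (F : P3) (d : ℕ) (x0 : ℂ) : (Nres a b O F d).eval x0 =
    Polynomial.resultant (lineRestrict F (a + x0 • b) O)
      (lineRestrict (Bord b O F) (a + x0 • b) O) d (3 * d - 4) := by
  rw [← biv_map_eval, ← biv_map_eval, Polynomial.resultant_map_map]; rfl

theorem res_split {R : Type*} [CommRing R] [IsDomain R] (y : R) (f' g : Polynomial R) (d n : ℕ)
    (hd : ((Polynomial.X - Polynomial.C y) * f').natDegree = d) (hf : f' ≠ 0)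
    (hg : g.natDegree ≤ n) :
    Polynomial.resultant ((Polynomial.X - Polynomial.C y) * f') g d n =
      g.eval y * Polynomial.resultant f' g (d - 1) n := by
  have h1 : d = (Polynomial.X - Polynomial.C y).natDegree + f'.natDegree := by
    rw [← hd, Polynomial.natDegree_mul (Polynomial.X_sub_C_ne_zero y) hf]
  have h2 : d - 1 = f'.natDegree := by
    rw [h1, Polynomial.natDegree_X_sub_C]; omega
  rw [h2]
  conv_lhs => rw [h1]
  rw [Polynomial.resultant_mul_left _ _ _ _ hg, Polynomial.natDegree_X_sub_C,
    Polynomial.resultant_X_sub_C_left _ _ _ hg]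

theorem det3_shift (a b O : Fin 3 → ℂ) (x : ℂ) : det3 (a + x • b) b O = det3 a b O := by
  simp [det3]; ring

theorem bps_natDegree_eq {F : P3} {d : ℕ} (hF : F.IsHomogeneous d) (a b O : Fin 3 → ℂ)
    (hO : MvPolynomial.eval O F ≠ 0) : (bps a b O F).natDegree = d := by
  apply le_antisymm (bps_natDegree hF a b O)
  apply Polynomial.le_natDegree_of_ne_zero
  rw [bps_coeff hF]
  exact (map_ne_zero_iff _ (algebraMap ℂ PS).injective).mpr hO

theorem lr_natDegree_eq {F : P3} {d : ℕ} (hF : F.IsHomogeneous d) (a O : Fin 3 → ℂ)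
    (hO : MvPolynomial.eval O F ≠ 0) : (lineRestrict F a O).natDegree = d := by
  apply le_antisymm (lineRestrict_natDegree hF a O)
  apply Polynomial.le_natDegree_of_ne_zero
  rwa [lineRestrict_coeff hF]

theorem ord_lemma {F : P3} {d : ℕ} (hF : F.IsHomogeneous d) (hd : 2 ≤ d) {a b O : Fin 3 → ℂ}
    (hD : det3 a b O ≠ 0) (hO : MvPolynomial.eval O F ≠ 0) (hN : Nres a b O F d ≠ 0) (x0 y0 : ℂ)
    (hz : MvPolynomial.eval (a + x0 • b + y0 • O) F = 0)
    (hfy : MvPolynomial.eval (a + x0 • b + y0 • O) (dd O F) ≠ 0)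
    (huniq : ∀ y, MvPolynomial.eval (a + x0 • b + y • O) F = 0 →
      MvPolynomial.eval (a + x0 • b + y • O) (Bord b O F) = 0 → y = y0) :
    (Nres a b O F d).rootMultiplicity x0 = flexWeightAt F (a + x0 • b + y0 • O) := by
  set a' := a + x0 • b with ha'
  have hD' : det3 a' b O ≠ 0 := by rw [ha', det3_shift]; exact hD
  obtain ⟨y1, hy1, hy0⟩ := hensel_branch hF a' b O hO y0 hz hfy
  obtain ⟨f', hf'⟩ : Polynomial.X - Polynomial.C y1 ∣ bps a' b O F := by
    rw [Polynomial.dvd_iff_isRoot, Polynomial.IsRoot, bps_eval, hy1]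
  have hnd := bps_natDegree_eq hF a' b O hO
  have hlnd := lr_natDegree_eq hF a' O hO
  have hf0 : f' ≠ 0 := by
    rintro rfl
    rw [hf'] at hnd; simp at hnd; omega
  have hlr : lineRestrict F a' O = (Polynomial.X - Polynomial.C y0) * f'.map (ccA : PS →+* ℂ) := by
    rw [← bps_map_cc a' b O F, hf']; simp [hy0]
  have hf'y : (f'.map (ccA : PS →+* ℂ)).eval y0 ≠ 0 := by
    have h1 := lineRestrict_derivative F a' O
    rw [hlr] at h1
    have := congrArg (Polynomial.eval y0) h1
    rw [lineRestrict_eval] at this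
    simp [Polynomial.derivative_mul] at this
    rw [this]; exact hfy
  have hB := bps_natDegree (Bord_hom hF hd b O) a' b O
  have hphi := phi_Nres a b O F d x0
  rw [← ha', hf', res_split y1 f' _ d _ (by rw [← hf']; exact hnd) hf0 hB, bps_eval] at hphi
  have hphine : phi x0 (Nres a b O F d) ≠ 0 := by
    rw [← PowerSeries.order_finite_iff_ne_zero, order_phi x0 hN]
    exact ENat.natCast_lt_top _
  have hBne : ev a' b O (Bord b O F) y1 ≠ 0 := by
    intro h; rw [hphi, h, zero_mul] at hphine; exact hphine rfl
  have hun : IsUnit (Polynomial.resultant f' (bps a' b O (Bord b O F)) (d - 1) (3 * d - 4)) := by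
    rw [unit_iff]
    have h1 := Polynomial.resultant_map_map f' (bps a' b O (Bord b O F)) (d - 1) (3 * d - 4)
      (ccA : PS →+* ℂ)
    rw [bps_map_cc] at h1
    refine fun h => ?_
    rw [show (ccA : PS →+* ℂ) _ = _ from h] at h1
    set f0 := f'.map (ccA : PS →+* ℂ) with hf0def
    have hf0ne : f0 ≠ 0 := by
      intro h; rw [h] at hf'y; simp at hf'y
    have hf0d : f0.natDegree = d - 1 := by
      rw [hlr, Polynomial.natDegree_mul (Polynomial.X_sub_C_ne_zero y0) hf0ne,
        Polynomial.natDegree_X_sub_C] at hlnd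
      omega
    rw [← hf0d, Polynomial.resultant_eq_prod_eval _ _ _
      (lineRestrict_natDegree (Bord_hom hF hd b O) a' O) (IsAlgClosed.splits f0)] at h1
    have h2 : (f0.roots.map (Polynomial.eval · (lineRestrict (Bord b O F) a' O))).prod = 0 := by
      rcases mul_eq_zero.mp h1 with h2 | h2
      · exact absurd h2 (pow_ne_zero _ (Polynomial.leadingCoeff_ne_zero.mpr hf0ne))
      · exact h2
    rw [Multiset.prod_eq_zero_iff, Multiset.mem_map] at h2
    obtain ⟨r, hr, hr2⟩ := h2
    rw [lineRestrict_eval] at hr2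
    rw [Polynomial.mem_roots hf0ne] at hr
    have hr3 : MvPolynomial.eval (a' + r • O) F = 0 := by
      rw [← lineRestrict_eval, hlr, Polynomial.eval_mul, hr.eq_zero, mul_zero]
    have := huniq r hr3 hr2
    subst this
    exact hf'y hr
  have h5 : (phi x0 (Nres a b O F d)).order = flexWeightAt F (a' + y0 • O) := by
    rw [hphi, PowerSeries.order_mul, PowerSeries.order_zero_of_unit hun, add_zero]
    subst hy0
    exact order_branch hF hD' hy1 hfy hBne
  rw [order_phi x0 hN] at h5
  exact_mod_cast h5

end pserb

section fin

theorem phi_zero_inj {p : Polynomial ℂ} (x0 : ℂ) (h : phi x0 p = 0) : p = 0 := by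
  by_contra hp
  have := order_phi x0 hp
  rw [h, PowerSeries.order_zero] at this
  exact absurd this.symm (ENat.natCast_ne_top _)

theorem lin_of_DD (y : PS) (h : DX (DX y) = 0) :
    y = algebraMap ℂ PS (ccA y) + algebraMap ℂ PS (ccA (DX y)) * PowerSeries.X := by
  have hc : ∀ k, PowerSeries.coeff k (DX (DX y)) = PowerSeries.coeff (k + 2) y * (k + 2) * (k + 1) := by
    intro k
    rw [PowerSeries.coeff_derivative, PowerSeries.coeff_derivative]; push_cast; ring
  have hne : ∀ k : ℕ, (k : ℂ) + 2 ≠ 0 ∧ (k : ℂ) + 1 ≠ 0 := by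
    intro k; constructor <;> norm_cast
  have h1 : ccA (DX y) = PowerSeries.coeff 1 y := by
    rw [ccA_apply, ← PowerSeries.coeff_zero_eq_constantCoeff_apply,
          PowerSeries.coeff_derivative]; simp
  ext k
  match k with
  | 0 => simp [ccA_apply, PowerSeries.algebraMap_apply]
  | 1 => rw [h1]; simp [PowerSeries.algebraMap_apply, PowerSeries.coeff_C]
  | k + 2 =>
    have := hc k
    rw [h] at this
    have h2 : PowerSeries.coeff (k + 2) y = 0 := by simpa [hne k] using this.symm
    rw [h2]
    simp [PowerSeries.algebraMap_apply, PowerSeries.coeff_C, PowerSeries.coeff_X]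

theorem Nres_ne_of_split {F : P3} {d : ℕ} (hF : IsSmoothCurve F d) (hd : 2 ≤ d)
    {a b O : Fin 3 → ℂ} (hD : det3 a b O ≠ 0) (hO : MvPolynomial.eval O F ≠ 0) (S : Finset ℂ)
    (hcard : S.card = d) (hS : ∀ y ∈ S, MvPolynomial.eval (a + y • O) F = 0) :
    Nres a b O F d ≠ 0 := by
  intro hN
  have hnd := bps_natDegree_eq hF.1 a b O hO
  have hlnd := lr_natDegree_eq hF.1 a O hO
  have hlne : lineRestrict F a O ≠ 0 := by
    intro h; rw [h] at hlnd; simp at hlnd; omega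
  have hfne : bps a b O F ≠ 0 := by
    intro h; rw [h] at hnd; simp at hnd; omega
  have hroots : (lineRestrict F a O).roots = S.val := by
    symm
    apply Multiset.eq_of_le_of_card_le
    · rw [Multiset.le_iff_subset S.nodup]
      intro y hy
      rw [Polynomial.mem_roots hlne, Polynomial.IsRoot, lineRestrict_eval]
      exact hS y hy
    · rw [Finset.card_val, hcard, ← hlnd]; exact Polynomial.card_roots' _
  have hsimple : ∀ y : ℂ, MvPolynomial.eval (a + y • O) F = 0 →
      MvPolynomial.eval (a + y • O) (dd O F) ≠ 0 := by
    intro y hy hy2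
    have h1 : 1 < (lineRestrict F a O).rootMultiplicity y := by
      rw [Polynomial.one_lt_rootMultiplicity_iff_isRoot hlne, Polynomial.IsRoot, Polynomial.IsRoot,
        lineRestrict_derivative, lineRestrict_eval, lineRestrict_eval]
      exact ⟨hy, hy2⟩
    rw [← Polynomial.count_roots, hroots] at h1
    have := Multiset.nodup_iff_count_le_one.mp S.nodup y
    omega
  choose br hbr1 hbr2 using fun y : S => hensel_branch hF.1 a b O hO y.1 (hS y.1 y.2)
    (hsimple y.1 (hS y.1 y.2))
  have hinj : Function.Injective br := by
    intro y y' h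
    apply Subtype.ext
    rw [← hbr2 y, ← hbr2 y', h]
  have hsplit : (bps a b O F).Splits := by
    rw [Polynomial.splits_iff_card_roots]
    apply le_antisymm (Polynomial.card_roots' _)
    rw [hnd, ← hcard]
    have h1 : (Finset.univ.map ⟨br, hinj⟩).val ≤ (bps a b O F).roots := by
      rw [Multiset.le_iff_subset (Finset.nodup _)]
      intro y hy
      obtain ⟨z, -, rfl⟩ := Finset.mem_map.mp (Finset.mem_def.mpr hy)
      rw [Polynomial.mem_roots hfne, Polynomial.IsRoot, bps_eval]
      exact hbr1 z
    have h2 := Multiset.card_le_card h1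
    rw [Finset.card_val, Finset.card_map, Finset.card_univ, Fintype.card_coe] at h2
    exact h2
  have hphi := phi_Nres a b O F d 0
  rw [hN, map_zero, zero_smul, add_zero] at hphi
  have hres := Polynomial.resultant_eq_prod_eval (bps a b O F) (bps a b O (Bord b O F)) (3 * d - 4)
    (bps_natDegree (Bord_hom hF.1 hd b O) a b O) hsplit
  rw [hnd, ← hphi] at hres
  have h2 : ((bps a b O F).roots.map (Polynomial.eval · (bps a b O (Bord b O F)))).prod = 0 := by
    rcases mul_eq_zero.mp hres.symm with h2 | h2
    · exact absurd h2 (pow_ne_zero _ (Polynomial.leadingCoeff_ne_zero.mpr hfne))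
    · exact h2
  rw [Multiset.prod_eq_zero_iff, Multiset.mem_map] at h2
  obtain ⟨y, hy, hyB⟩ := h2
  rw [Polynomial.mem_roots hfne, Polynomial.IsRoot, bps_eval] at hy
  rw [bps_eval] at hyB
  have hz : MvPolynomial.eval (a + ccA y • O) F = 0 := by rw [← ev_cc a b O F y, hy, map_zero]
  have hbi := branch_ident a b O F y hy
  rw [hyB, neg_zero] at hbi
  have hfy : ev a b O (dd O F) y ≠ 0 := by
    intro h
    apply hsimple _ hz
    rw [← ev_cc a b O _ y, h, map_zero]
  have hDD : DX (DX y) = 0 := by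
    rcases mul_eq_zero.mp hbi with h | h
    · exact h
    · exact absurd h (pow_ne_zero _ hfy)
  have hlin := lin_of_DD y hDD
  have hi := lin_ind_comb hD 0 (ccA y) 1 (ccA (DX y)) (by simp)
  refine no_line hF hd hi (phi_zero_inj 0 ?_)
  rw [← hy, ev, lineRestrict, MvPolynomial.comp_aeval_apply]
  congr 2
  funext i
  conv_rhs => rw [hlin]
  simp only [phi, pt, map_add, map_mul, Polynomial.aeval_C, Polynomial.aeval_X,
      Pi.add_apply, Pi.smul_apply, smul_eq_mul, map_zero, add_zero, zero_mul, map_one, one_mul]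
  ring

theorem coords {a b O : Fin 3 → ℂ} (hD : det3 a b O ≠ 0) (q : Fin 3 → ℂ) :
    q = (det3 q b O / det3 a b O) • a + (det3 a q O / det3 a b O) • b +
      (det3 a b q / det3 a b O) • O := by
  have := congrArg (fun v => (det3 a b O)⁻¹ • v) (cramer3 a b O q)
  simp only [smul_add, smul_smul, inv_mul_cancel₀ hD, one_smul] at this
  simp only [div_eq_inv_mul]
  exact this

theorem finite_flex {F : P3} {d : ℕ} (hF : IsSmoothCurve F d) (hd : 2 ≤ d)
    {a b O : Fin 3 → ℂ} (hD : det3 a b O ≠ 0) (hO : MvPolynomial.eval O F ≠ 0)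
    (hN : Nres a b O F d ≠ 0) :
    ∃ T : Finset (Fin 3 → ℂ), ∀ q, q ≠ 0 → flexWeightAt F q ≠ 0 → ∃ z ∈ T, propor q z := by
  classical
  have hlne : ∀ a' : Fin 3 → ℂ, lineRestrict F a' O ≠ 0 := by
    intro a' h
    have hlnd := lr_natDegree_eq hF.1 a' O hO
    rw [h] at hlnd; simp at hlnd; omega
  refine ⟨((Nres a b O F d).roots.toFinset.biUnion fun x =>
    (lineRestrict F (a + x • b) O).roots.toFinset.image fun y => a + x • b + y • O) ∪
    ((lineRestrict F b O).roots.toFinset.image fun y => b + y • O), ?_⟩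
  intro q hq hw
  have hqF := fw_zero hw
  have hc := coords hD q
  set α := det3 q b O / det3 a b O
  set β := det3 a q O / det3 a b O
  set γ := det3 a b q / det3 a b O
  by_cases hα : α = 0
  · rw [hα, zero_smul, zero_add] at hc
    by_cases hβ : β = 0
    · rw [hβ, zero_smul, zero_add] at hc
      rw [hc, eval_scale hF.1] at hqF
      have hγ : γ ≠ 0 := by
        rintro h; rw [h, zero_smul] at hc; exact hq hc
      simp [hO, hγ] at hqF
    · refine ⟨b + (γ / β) • O, ?_, β, hβ, ?_⟩
      · apply Finset.mem_union_right
        rw [Finset.mem_image]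
        refine ⟨γ / β, ?_, rfl⟩
        rw [Multiset.mem_toFinset, Polynomial.mem_roots (hlne _), Polynomial.IsRoot,
          lineRestrict_eval]
        have : q = β • (b + (γ / β) • O) := by
          rw [hc, smul_add, smul_smul]; congr 2; field_simp
        rw [this, eval_scale hF.1] at hqF
        simpa [hβ] using hqF
      · rw [hc, smul_add, smul_smul]; congr 2; field_simp
  · have hqz : q = α • (a + (β / α) • b + (γ / α) • O) := by
      rw [hc, smul_add, smul_add, smul_smul, smul_smul]
      congr 2
      · congr 1; field_simp
      · field_simp
    refine ⟨a + (β / α) • b + (γ / α) • O, ?_, α, hα, hqz⟩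
    rw [hqz, fw_smul hF.1 hα] at hw
    rw [hqz, eval_scale hF.1] at hqF
    have hzF : MvPolynomial.eval (a + (β / α) • b + (γ / α) • O) F = 0 := by
      simpa [hα] using hqF
    have hB := (flex_iff hF hd hD _ _ hzF).mp hw
    apply Finset.mem_union_left
    rw [Finset.mem_biUnion]
    have hy : γ / α ∈ (lineRestrict F (a + (β / α) • b) O).roots := by
      rw [Polynomial.mem_roots (hlne _), Polynomial.IsRoot, lineRestrict_eval]
      exact hzF
    refine ⟨β / α, ?_, ?_⟩
    · rw [Multiset.mem_toFinset, Polynomial.mem_roots hN, Polynomial.IsRoot, eval_Nres]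
      have := Polynomial.resultant_eq_prod_eval (lineRestrict F (a + (β / α) • b) O)
        (lineRestrict (Bord b O F) (a + (β / α) • b) O) (3 * d - 4)
        (lineRestrict_natDegree (Bord_hom hF.1 hd b O) _ O) (IsAlgClosed.splits _)
      rw [lr_natDegree_eq hF.1 _ O hO] at this
      rw [this, Multiset.prod_eq_zero, mul_zero]
      rw [Multiset.mem_map]
      exact ⟨_, hy, by rw [lineRestrict_eval]; exact hB⟩
    · rw [Finset.mem_image]
      exact ⟨γ / α, Multiset.mem_toFinset.mpr hy, rfl⟩

end fin

section enum

theorem propor_symm {p q : Fin 3 → ℂ} (h : propor p q) : propor q p := by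
  obtain ⟨c, hc, rfl⟩ := h
  exact ⟨c⁻¹, inv_ne_zero hc, by rw [smul_smul, inv_mul_cancel₀ hc, one_smul]⟩

theorem propor_trans {p q r : Fin 3 → ℂ} (h : propor p q) (h' : propor q r) : propor p r := by
  obtain ⟨c, hc, rfl⟩ := h
  obtain ⟨c', hc', rfl⟩ := h'
  exact ⟨c * c', mul_ne_zero hc hc', by rw [smul_smul]⟩

theorem propor_refl (p : Fin 3 → ℂ) : propor p p := ⟨1, one_ne_zero, (one_smul _ _).symm⟩

theorem propor_iff_mk {p q : Fin 3 → ℂ} (hp : p ≠ 0) (hq : q ≠ 0) :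
    propor p q ↔ Projectivization.mk ℂ p hp = Projectivization.mk ℂ q hq := by
  rw [Projectivization.mk_eq_mk_iff]
  constructor
  · rintro ⟨c, hc, h⟩
    exact ⟨Units.mk0 c hc, h.symm⟩
  · rintro ⟨c, h⟩
    exact ⟨c, c.ne_zero, h.symm⟩

theorem projNear_propor {ε : ℝ} {p q r : Fin 3 → ℂ} (h : propor p q) :
    projNear ε p r ↔ projNear ε q r := by
  have key : ∀ {p q : Fin 3 → ℂ}, propor p q → projNear ε p r → projNear ε q r := by
    rintro p q ⟨c, -, rfl⟩ ⟨s, hs⟩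
    exact ⟨s * c, by rwa [mul_smul]⟩
  exact ⟨key h, key (propor_symm h)⟩

/-- list of flexes with multiplicity -/
def Enum (F : P3) (k : ℕ) (q : Fin k → Fin 3 → ℂ) : Prop :=
  (∀ j, ‖q j‖ = 1) ∧
    ∀ x : Fin 3 → ℂ, x ≠ 0 → flexWeightAt F x = {j | propor (q j) x}.ncard

theorem fw_propor {F : P3} {d : ℕ} (hF : F.IsHomogeneous d) {p q : Fin 3 → ℂ} (h : propor p q) :
    flexWeightAt F p = flexWeightAt F q := by
  obtain ⟨c, hc, rfl⟩ := h
  exact fw_smul hF hc q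

theorem exists_enum {F : P3} {d : ℕ} (hF : F.IsHomogeneous d) (T : Finset (Fin 3 → ℂ))
    (hT : ∀ q, q ≠ 0 → flexWeightAt F q ≠ 0 → ∃ z ∈ T, propor q z) :
    ∃ k q, Enum F k q := by
  classical
  set Φ : Set (Projectivization ℂ (Fin 3 → ℂ)) := {x | flexWeightAt F x.rep ≠ 0} with hΦ
  have hfin : Φ.Finite := by
    refine Set.Finite.subset (T.finite_toSet.image fun z => if h : z ≠ 0 then
      Projectivization.mk ℂ z h else Projectivization.mk ℂ (fun _ => 1) (by
        intro h; exact one_ne_zero (congrFun h 0))) ?_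
    intro x hx
    obtain ⟨z, hz, hp⟩ := hT x.rep x.rep_nonzero hx
    refine ⟨z, hz, ?_⟩
    have hz0 : z ≠ 0 := by
      rintro rfl
      obtain ⟨c, -, h⟩ := hp
      exact x.rep_nonzero (by rw [h, smul_zero])
    simp only [dif_pos hz0]
    rw [← (propor_iff_mk x.rep_nonzero hz0).mp hp, Projectivization.mk_rep]
  have := hfin.fintype
  let J := Σ x : Φ, Fin (flexWeightAt F x.1.rep)
  let e := Fintype.equivFin J
  let nv : J → Fin 3 → ℂ := fun j => ((‖j.1.1.rep‖⁻¹ : ℝ) : ℂ) • j.1.1.rep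
  have hnv : ∀ j : J, propor (nv j) j.1.1.rep := fun j =>
    ⟨_, by simpa using j.1.1.rep_nonzero, rfl⟩
  refine ⟨Fintype.card J, fun j => nv (e.symm j), fun j => ?_, fun x hx => ?_⟩
  · simp only [nv]
    rw [norm_smul, Complex.norm_real, norm_inv, norm_norm, inv_mul_cancel₀]
    simpa using (e.symm j).1.1.rep_nonzero
  · set X := Projectivization.mk ℂ x hx with hX
    have h1 : {j | propor (nv (e.symm j)) x} = e.symm ⁻¹' {j : J | j.1.1 = X} := by
      ext j
      simp only [Set.mem_ofPred_eq, Set.mem_preimage]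
      have : propor (nv (e.symm j)) x ↔ propor (e.symm j).1.1.rep x :=
        ⟨fun h => propor_trans (propor_symm (hnv _)) h, fun h => propor_trans (hnv _) h⟩
      rw [this, propor_iff_mk (Projectivization.rep_nonzero _) hx, Projectivization.mk_rep]
    have hXx : propor X.rep x := by
      rw [propor_iff_mk X.rep_nonzero hx, Projectivization.mk_rep]
    rw [h1, Set.ncard_preimage_of_injective_subset_range e.symm.injective (by simp)]
    rw [← fw_propor hF hXx]
    by_cases hw : flexWeightAt F X.rep = 0
    · rw [hw]
      symm
      rw [Set.ncard_eq_zero]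
      ext j
      simp only [Set.mem_ofPred_eq, Set.mem_empty_iff_false, iff_false]
      intro h
      have hj : flexWeightAt F j.1.1.rep ≠ 0 := j.1.2
      rw [h] at hj
      exact hj hw
    · have h2 : {j : J | j.1.1 = X} = Set.range (fun i : Fin (flexWeightAt F X.rep) =>
          (⟨⟨X, hw⟩, i⟩ : J)) := by
        ext j
        simp only [Set.mem_ofPred_eq, Set.mem_range]
        constructor
        · rintro h
          obtain ⟨⟨y, hy⟩, i⟩ := j
          simp only at h
          subst h
          exact ⟨i, rfl⟩
        · rintro ⟨i, rfl⟩; rfl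
      rw [h2, ← Set.image_univ, Set.ncard_image_of_injective]
      · simp
      · intro i i' h
        exact eq_of_heq (Sigma.mk.inj_iff.mp h).2

theorem enum_fw {F : P3} {k : ℕ} {q : Fin k → Fin 3 → ℂ} (h : Enum F k q) (j : Fin k) :
    q j ≠ 0 ∧ flexWeightAt F (q j) ≠ 0 := by
  have hne : q j ≠ 0 := by
    intro h0; have := h.1 j; rw [h0, norm_zero] at this; exact zero_ne_one this
  refine ⟨hne, ?_⟩
  rw [h.2 _ hne]
  intro h0
  rw [Set.ncard_eq_zero] at h0
  have : j ∈ {j' | propor (q j') (q j)} := propor_refl _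
  rw [h0] at this
  exact this

theorem flexNear_enum {F : P3} {k : ℕ} {q : Fin k → Fin 3 → ℂ}
    (h : Enum F k q) (p₀ : Fin 3 → ℂ) (ε : ℝ) :
    flexNear F p₀ ε = {j | projNear ε (q j) p₀}.ncard := by
  classical
  let mkq : Fin k → Projectivization ℂ (Fin 3 → ℂ) := fun j =>
    Projectivization.mk ℂ (q j) (enum_fw h j).1
  have hw : ∀ x : Projectivization ℂ (Fin 3 → ℂ),
      flexWeightAt F x.rep = (Finset.univ.filter fun j => mkq j = x).card := by
    intro x
    rw [h.2 _ x.rep_nonzero, ← Set.ncard_coe_finset]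
    congr 1
    ext j
    simp only [Set.mem_ofPred_eq, Finset.coe_filter, Finset.mem_univ, true_and, mkq]
    rw [propor_iff_mk (enum_fw h j).1 x.rep_nonzero, Projectivization.mk_rep]
  have hnear : ∀ j, projNear ε (mkq j).rep p₀ ↔ projNear ε (q j) p₀ := by
    intro j
    apply projNear_propor
    rw [propor_iff_mk (Projectivization.rep_nonzero _) (enum_fw h j).1, Projectivization.mk_rep]
  unfold flexNear
  rw [finsum_eq_sum_of_support_subset (s := Finset.univ.image mkq)]
  · have h1 : {j | projNear ε (q j) p₀} =
        ((Finset.univ.filter fun j => projNear ε (q j) p₀ : Finset (Fin k)) : Set (Fin k)) := by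
      ext j; simp
    rw [h1, Set.ncard_coe_finset, Finset.card_eq_sum_card_image mkq
      (Finset.univ.filter fun j => projNear ε (q j) p₀)]
    symm
    apply Finset.sum_subset_zero_on_sdiff
    · exact Finset.image_subset_image (Finset.filter_subset _ _)
    · intro x hx
      simp only [Finset.mem_sdiff, Finset.mem_image, Finset.mem_univ, true_and, Finset.mem_filter,
        not_exists, not_and] at hx
      obtain ⟨⟨j, rfl⟩, hx2⟩ := hx
      rw [if_neg]
      intro hn
      exact hx2 j ((hnear j).mp hn) rfl
    · intro x hx
      obtain ⟨j, hj, rfl⟩ := Finset.mem_image.mp hx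
      have hj' := (Finset.mem_filter.mp hj).2
      rw [if_pos ((hnear j).mpr hj'), hw]
      congr 1
      ext i
      simp only [Finset.mem_filter, Finset.mem_univ, true_and]
      constructor
      · exact fun h => h.2
      · intro hi
        refine ⟨?_, hi⟩
        rw [← hnear i, hi, hnear j]; exact hj'
  · intro x hx
    rw [Function.mem_support] at hx
    have : flexWeightAt F x.rep ≠ 0 := by
      intro h0; apply hx; simp [h0]
    rw [hw] at this
    obtain ⟨j, hj⟩ := Finset.card_ne_zero.mp this
    simp only [Finset.coe_image, Set.mem_image]
    exact ⟨j, by simp, (Finset.mem_filter.mp hj).2⟩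

end enum

section nfac

theorem Nres_root {F : P3} {d : ℕ} (hF : IsSmoothCurve F d) (hd : 2 ≤ d)
    {a b O : Fin 3 → ℂ} (hD : det3 a b O ≠ 0) (hO : MvPolynomial.eval O F ≠ 0) (x : ℂ)
    (h : (Nres a b O F d).eval x = 0) : ∃ y : ℂ, MvPolynomial.eval (a + x • b + y • O) F = 0 ∧
      flexWeightAt F (a + x • b + y • O) ≠ 0 := by
  rw [eval_Nres] at h
  have hlnd := lr_natDegree_eq hF.1 (a + x • b) O hO
  have hlne : lineRestrict F (a + x • b) O ≠ 0 := by
    intro h0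
    rw [h0] at hlnd; simp at hlnd; omega
  have h1 := Polynomial.resultant_eq_prod_eval (lineRestrict F (a + x • b) O)
    (lineRestrict (Bord b O F) (a + x • b) O) (3 * d - 4)
    (lineRestrict_natDegree (Bord_hom hF.1 hd b O) _ O) (IsAlgClosed.splits _)
  rw [hlnd, h] at h1
  have h2 : ((lineRestrict F (a + x • b) O).roots.map
      (Polynomial.eval · (lineRestrict (Bord b O F) (a + x • b) O))).prod = 0 := by
    rcases mul_eq_zero.mp h1.symm with h2 | h2
    · exact absurd h2 (pow_ne_zero _ (Polynomial.leadingCoeff_ne_zero.mpr hlne))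
    · exact h2
  rw [Multiset.prod_eq_zero_iff, Multiset.mem_map] at h2
  obtain ⟨y, hy, hyB⟩ := h2
  rw [Polynomial.mem_roots hlne, Polynomial.IsRoot, lineRestrict_eval] at hy
  rw [lineRestrict_eval] at hyB
  exact ⟨y, hy, (flex_iff hF hd hD x y hy).mpr hyB⟩

theorem Nfac {F : P3} {d : ℕ} (hF : IsSmoothCurve F d) (hd : 2 ≤ d)
    {a b O : Fin 3 → ℂ} (hD : det3 a b O ≠ 0) (hO : MvPolynomial.eval O F ≠ 0)
    {k : ℕ} {q : Fin k → Fin 3 → ℂ} (hE : Enum F k q)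
    (hα : ∀ j, det3 (q j) b O ≠ 0)
    (hdist : ∀ j j', ¬ propor (q j) (q j') → det3 (q j) (q j') O ≠ 0)
    (hfy : ∀ j, MvPolynomial.eval (q j) (dd O F) ≠ 0) :
    ∃ κ : ℂ, κ ≠ 0 ∧ Nres a b O F d = Polynomial.C κ *
      ∏ j, (Polynomial.C (det3 a (q j) O) - Polynomial.C (det3 (q j) b O) * Polynomial.X) := by
  classical
  set xx : Fin k → ℂ := fun j => det3 a (q j) O / det3 (q j) b O with hxx
  set yy : Fin k → ℂ := fun j => det3 a b (q j) / det3 (q j) b O with hyy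
  have hz : ∀ j, propor (q j) (a + xx j • b + yy j • O) := by
    intro j
    refine ⟨det3 (q j) b O / det3 a b O, div_ne_zero (hα j) hD, ?_⟩
    conv_lhs => rw [coords hD (q j)]
    rw [smul_add, smul_add, smul_smul, smul_smul]
    have := hα j
    congr 2
    · congr 1; simp only [hxx]; field_simp
    · simp only [hyy]; field_simp
  have hxz : ∀ (j : Fin k) (x y : ℂ), propor (q j) (a + x • b + y • O) → x = xx j := by
    rintro j x y ⟨c, hc, h⟩
    have h1 : det3 a (q j) O = c * x * det3 a b O := by rw [h]; simp [det3]; ring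
    have h2 : det3 (q j) b O = c * det3 a b O := by rw [h]; simp [det3]; ring
    simp only [hxx]
    rw [h1, h2]; field_simp
  have hyz : ∀ x y y' : ℂ, propor (a + x • b + y • O) (a + x • b + y' • O) → y = y' := by
    rintro x y y' ⟨c, hc, h⟩
    have h1 := congrArg (fun v => det3 v b O) h
    have h2 := congrArg (fun v => det3 a b v) h
    have e1 : det3 (a + x • b + y • O) b O = det3 a b O := by simp [det3]; ring
    have e2 : det3 (c • (a + x • b + y' • O)) b O = c * det3 a b O := by simp [det3]; ring
    have e3 : det3 a b (a + x • b + y • O) = y * det3 a b O := by simp [det3]; ring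
    have e4 : det3 a b (c • (a + x • b + y' • O)) = c * y' * det3 a b O := by simp [det3]; ring
    rw [e1, e2] at h1
    rw [e3, e4] at h2
    have hc1 : c = 1 := by
      have : (c - 1) * det3 a b O = 0 := by linear_combination -h1
      rcases mul_eq_zero.mp this with h | h
      · exact sub_eq_zero.mp h
      · exact absurd h hD
    rw [hc1, one_mul] at h2
    exact mul_right_cancel₀ hD h2
  have hsame : ∀ j j', xx j = xx j' → propor (q j) (q j') := by
    intro j j' h
    by_contra hn
    apply hdist j j' hn
    obtain ⟨c, hc, e⟩ := hz j
    obtain ⟨c', hc', e'⟩ := hz j'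
    rw [e, e', h]
    simp [det3]; ring
  have hsurj : ∀ x y : ℂ, flexWeightAt F (a + x • b + y • O) ≠ 0 →
      ∃ j, propor (q j) (a + x • b + y • O) := by
    intro x y h
    have hne : a + x • b + y • O ≠ 0 := by
      have := linInd_ne (lin_ind_comb hD x y 1 0 (by simp)) 1 0 (by simp)
      simpa using this
    rw [hE.2 _ hne] at h
    obtain ⟨j, hj⟩ := Set.nonempty_of_ncard_ne_zero h
    exact ⟨j, hj⟩
  have hroot : ∀ x, (Nres a b O F d).eval x = 0 → ∃ j, x = xx j := by
    intro x hx
    obtain ⟨y, -, hw⟩ := Nres_root hF hd hD hO x hx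
    obtain ⟨j, hj⟩ := hsurj x y hw
    exact ⟨j, hxz j x y hj⟩
  have hN : Nres a b O F d ≠ 0 := by
    intro h
    obtain ⟨x, hx⟩ := Infinite.exists_notMem_finset (Finset.univ.image xx)
    obtain ⟨j, hj⟩ := hroot x (by rw [h]; simp)
    exact hx (Finset.mem_image.mpr ⟨j, Finset.mem_univ _, hj.symm⟩)
  have hroots : (Nres a b O F d).roots = (Finset.univ.val.map xx) := by
    ext x0
    rw [Polynomial.count_roots, Multiset.count_map]
    by_cases hx : ∃ j, x0 = xx j
    · obtain ⟨j0, rfl⟩ := hx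
      have hzne : a + xx j0 • b + yy j0 • O ≠ 0 := by
        have := linInd_ne (lin_ind_comb hD (xx j0) (yy j0) 1 0 (by simp)) 1 0 (by simp)
        simpa using this
      have hfw0 := (enum_fw hE j0).2
      obtain ⟨c0, hc0, e0⟩ := hz j0
      rw [ord_lemma hF.1 hd hD hO hN (xx j0) (yy j0)]
      · rw [hE.2 _ hzne]
        have h3 : {j | propor (q j) (a + xx j0 • b + yy j0 • O)} =
            ((Finset.univ.filter fun j => xx j0 = xx j : Finset (Fin k)) : Set (Fin k)) := by
          ext j
          simp only [Set.mem_ofPred_eq, Finset.coe_filter, Finset.mem_univ, true_and]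
          constructor
          · exact fun h => hxz j _ _ h
          · intro h
            exact propor_trans (hsame j j0 h.symm) (hz j0)
        rw [h3, Set.ncard_coe_finset]; rfl
      · have := fw_zero hfw0
        rw [e0, eval_scale hF.1] at this
        simpa [hc0] using this
      · have := hfy j0
        rw [e0, eval_scale (dd_hom hF.1 O)] at this
        exact right_ne_zero_of_mul this
      · intro y hy hyB
        obtain ⟨j, hj⟩ := hsurj _ _ ((flex_iff hF hd hD _ y hy).mpr hyB)
        have h4 := hsame j j0 (hxz j _ _ hj).symm
        exact hyz (xx j0) _ _ (propor_trans (propor_symm hj) (propor_trans h4 (hz j0)))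
    · rw [Polynomial.rootMultiplicity_eq_zero]
      · symm
        rw [Multiset.card_eq_zero, Multiset.filter_eq_nil]
        intro j _ h
        exact hx ⟨j, h⟩
      · intro h
        exact hx (hroot x0 h)
  have hsp := (IsAlgClosed.splits (Nres a b O F d)).eq_prod_roots
  rw [hroots, Multiset.map_map] at hsp
  refine ⟨(Nres a b O F d).leadingCoeff * ∏ j, (-(det3 (q j) b O))⁻¹, ?_, ?_⟩
  · refine mul_ne_zero (Polynomial.leadingCoeff_ne_zero.mpr hN) ?_
    rw [Finset.prod_ne_zero_iff]
    intro j _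
    exact inv_ne_zero (neg_ne_zero.mpr (hα j))
  · conv_lhs => rw [hsp]
    rw [Polynomial.C_mul, mul_assoc, map_prod, ← Finset.prod_mul_distrib]
    congr 1
    change ∏ j, _ = _
    refine Finset.prod_congr rfl fun j _ => ?_
    simp only [Function.comp]
    have hj := hα j
    have : xx j = (-(det3 (q j) b O))⁻¹ * (-(det3 a (q j) O)) := by
      simp only [hxx]; field_simp
    rw [this, mul_sub, ← mul_assoc, ← Polynomial.C_mul, ← Polynomial.C_mul]
    have h2 : (-(det3 (q j) b O))⁻¹ * det3 (q j) b O = -1 := by field_simp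
    rw [h2]
    simp only [Polynomial.C_mul, Polynomial.C_neg, map_one]
    ring

end nfac

section degbound

def CD (f : Polynomial (Polynomial ℂ)) (d : ℕ) : Prop := ∀ i, (f.coeff i).natDegree ≤ d

theorem CD_mul {f g : Polynomial (Polynomial ℂ)} {m n : ℕ} (hf : CD f m) (hg : CD g n) :
    CD (f * g) (m + n) := by
  intro i
  rw [Polynomial.coeff_mul]
  refine Polynomial.natDegree_sum_le_of_forall_le _ _ fun x _ => ?_
  exact Polynomial.natDegree_mul_le_of_le (hf _) (hg _)

theorem CD_one : CD 1 0 := by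
  intro i
  rw [Polynomial.coeff_one]
  split_ifs <;> simp

theorem CD_pow {f : Polynomial (Polynomial ℂ)} (hf : CD f 1) (n : ℕ) : CD (f ^ n) n := by
  induction n with
  | zero => simpa using CD_one
  | succ n ih => rw [pow_succ]; exact CD_mul ih hf

theorem CD_biv {F : P3} {d : ℕ} (hF : F.IsHomogeneous d) (a b O : Fin 3 → ℂ) :
    CD (biv a b O F) d := by
  rw [biv_eq]
  simp only [MvPolynomial.aeval_def, MvPolynomial.eval₂_eq]
  intro j
  rw [Polynomial.finsetSum_coeff]
  refine Polynomial.natDegree_sum_le_of_forall_le _ _ fun m hm => ?_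
  have h := hF (MvPolynomial.mem_support_iff.mp hm)
  have h2 : ∑ i ∈ m.support, m i = d := by
    rw [← h]; simp [Finsupp.weight_apply, Finsupp.sum]
  have h1 : ∀ i, CD (Polynomial.C (Polynomial.C (a i) + Polynomial.C (b i) * Polynomial.X) +
      Polynomial.C (Polynomial.C (O i)) * Polynomial.X) 1 := by
    intro i l
    rw [Polynomial.coeff_add, Polynomial.coeff_C, Polynomial.coeff_C_mul, Polynomial.coeff_X]
    split_ifs <;> compute_degree <;> norm_num
  have key : ∀ s : Finset (Fin 3), CD (∏ i ∈ s, (Polynomial.C (Polynomial.C (a i) +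
      Polynomial.C (b i) * Polynomial.X) +
      Polynomial.C (Polynomial.C (O i)) * Polynomial.X) ^ m i) (∑ i ∈ s, m i) := by
    intro s
    induction s using Finset.induction_on with
    | empty => simpa using CD_one
    | insert i s hi ih =>
      rw [Finset.prod_insert hi, Finset.sum_insert hi]
      exact CD_mul (CD_pow (h1 i) _) ih
  have h3 := key m.support j
  rw [h2] at h3
  rw [Polynomial.algebraMap_apply, Polynomial.algebraMap_apply, Polynomial.coeff_C_mul]
  exact (Polynomial.natDegree_C_mul_le _ _).trans h3

theorem Nres_natDegree {F : P3} {d : ℕ} (hF : F.IsHomogeneous d) (hd : 2 ≤ d)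
    (a b O : Fin 3 → ℂ) :
    (Nres a b O F d).natDegree ≤ (d + (3 * d - 4)) * (d + (3 * d - 4)) := by
  unfold Nres Polynomial.resultant
  rw [Matrix.det_apply]
  refine Polynomial.natDegree_sum_le_of_forall_le _ _ fun σ _ => ?_
  refine (Polynomial.natDegree_smul_le _ _).trans ?_
  refine (Polynomial.natDegree_prod_le _ _).trans ?_
  refine (Finset.sum_le_card_nsmul _ _ (d + (3 * d - 4)) fun i _ => ?_).trans (by simp)
  have h1 := CD_biv hF a b O
  have h2 := CD_biv (Bord_hom hF hd b O) a b O
  unfold Polynomial.sylvester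
  simp only [Matrix.of_apply]
  induction i using Fin.addCases with
  | left j =>
    rw [Fin.addCases_left]
    split_ifs
    · exact (h2 _).trans (by omega)
    · simp
  | right j =>
    rw [Fin.addCases_right]
    split_ifs
    · exact (h1 _).trans (by omega)
    · simp

theorem Nfac_card {F : P3} {d : ℕ} (hF : F.IsHomogeneous d) (hd : 2 ≤ d) (a b O : Fin 3 → ℂ)
    {k : ℕ} {q : Fin k → Fin 3 → ℂ} (hα : ∀ j, det3 (q j) b O ≠ 0) {κ : ℂ} (hκ : κ ≠ 0)
    (h : Nres a b O F d = Polynomial.C κ *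
      ∏ j, (Polynomial.C (det3 a (q j) O) - Polynomial.C (det3 (q j) b O) * Polynomial.X)) :
    k ≤ (d + (3 * d - 4)) * (d + (3 * d - 4)) := by
  have h1 := Nres_natDegree hF hd a b O
  have h2 : ∀ j, (Polynomial.C (det3 a (q j) O) -
      Polynomial.C (det3 (q j) b O) * Polynomial.X).natDegree = 1 := by
    intro j
    rw [show Polynomial.C (det3 a (q j) O) - Polynomial.C (det3 (q j) b O) * Polynomial.X =
      Polynomial.C (-(det3 (q j) b O)) * Polynomial.X + Polynomial.C (det3 a (q j) O) by
        rw [Polynomial.C_neg]; ring]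
    exact Polynomial.natDegree_linear (neg_ne_zero.mpr (hα j))
  rw [h, Polynomial.natDegree_C_mul hκ, Polynomial.natDegree_prod] at h1
  · simpa [h2] using h1
  · intro j _ h0
    have := h2 j
    rw [h0] at this; simp at this

theorem tendsto_resultant {f g : ℕ → Polynomial ℂ} {f' g' : Polynomial ℂ} (m n : ℕ)
    (hf : ∀ i, Tendsto (fun k => (f k).coeff i) atTop (nhds (f'.coeff i)))
    (hg : ∀ i, Tendsto (fun k => (g k).coeff i) atTop (nhds (g'.coeff i))) :
    Tendsto (fun k => Polynomial.resultant (f k) (g k) m n) atTop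
      (nhds (Polynomial.resultant f' g' m n)) := by
  unfold Polynomial.resultant
  have hM : Tendsto (fun k => Polynomial.sylvester (f k) (g k) m n) atTop
      (nhds (Polynomial.sylvester f' g' m n)) := by
    refine tendsto_pi_nhds.mpr fun i => tendsto_pi_nhds.mpr fun j => ?_
    unfold Polynomial.sylvester
    simp only [Matrix.of_apply]
    induction j using Fin.addCases with
    | left j =>
      simp only [Fin.addCases_left]
      split_ifs
      · exact hg _
      · exact tendsto_const_nhds
    | right j =>
      simp only [Fin.addCases_right]
      split_ifs
      · exact hf _
      · exact tendsto_const_nhds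
  exact ((continuous_id.matrix_det).tendsto _).comp hM

end degbound

section family

def fam (P : ℕ → P3) (N : ℕ) (t : ℂ) : P3 := ∑ k ∈ Finset.range N, MvPolynomial.C (t ^ k) * P k

theorem fam_succ (P : ℕ → P3) (N : ℕ) (t : ℂ) :
    fam P (N + 1) t = P 0 + MvPolynomial.C t * fam (fun k => P (k + 1)) N t := by
  unfold fam
  rw [Finset.sum_range_succ', add_comm, Finset.mul_sum]
  congr 1
  · simp
  · refine Finset.sum_congr rfl fun k _ => ?_
    rw [pow_succ, MvPolynomial.C_mul]; ring

theorem dd_fam (u : Fin 3 → ℂ) (P : ℕ → P3) (N : ℕ) (t : ℂ) :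
    dd u (fam P N t) = fam (fun k => dd u (P k)) N t := by
  unfold fam
  rw [dd_sum]
  simp only [dd_Cmul]

theorem eval_fam_tendsto (P : ℕ → P3) (N : ℕ) {t : ℕ → ℂ} (ht : Tendsto t atTop (nhds 0))
    {z : ℕ → Fin 3 → ℂ} {z0 : Fin 3 → ℂ} (hz : Tendsto z atTop (nhds z0)) :
    Tendsto (fun n => MvPolynomial.eval (z n) (fam P (N + 1) (t n))) atTop
      (nhds (MvPolynomial.eval z0 (P 0))) := by
  have h1 : ∀ F : P3, Tendsto (fun n => MvPolynomial.eval (z n) F) atTop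
      (nhds (MvPolynomial.eval z0 F)) := fun F =>
    ((MvPolynomial.continuous_eval F).tendsto z0).comp hz
  have h2 : ∀ n, MvPolynomial.eval (z n) (fam P (N + 1) (t n)) = MvPolynomial.eval (z n) (P 0) +
      t n * ∑ k ∈ Finset.range N, (t n) ^ k * MvPolynomial.eval (z n) (P (k + 1)) := by
    intro n
    rw [fam_succ]; simp [fam]
  simp only [h2]
  have h3 : Tendsto (fun n => ∑ k ∈ Finset.range N, (t n) ^ k *
      MvPolynomial.eval (z n) (P (k + 1))) atTop (nhds (∑ k ∈ Finset.range N, (0 : ℂ) ^ k *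
      MvPolynomial.eval z0 (P (k + 1)))) :=
    tendsto_finsetSum _ fun k _ => (ht.pow k).mul (h1 _)
  have := (h1 (P 0)).add (ht.mul h3)
  simpa using this

def CT (f : ℕ → Polynomial ℂ) (f' : Polynomial ℂ) : Prop :=
  ∀ i, Tendsto (fun k => (f k).coeff i) atTop (nhds (f'.coeff i))

theorem CT_mul {f g : ℕ → Polynomial ℂ} {f' g' : Polynomial ℂ} (hf : CT f f') (hg : CT g g') :
    CT (fun n => f n * g n) (f' * g') := by
  intro i
  simp only [Polynomial.coeff_mul]
  exact tendsto_finsetSum _ fun x _ => (hf _).mul (hg _)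

theorem CT_add {f g : ℕ → Polynomial ℂ} {f' g' : Polynomial ℂ} (hf : CT f f') (hg : CT g g') :
    CT (fun n => f n + g n) (f' + g') := by
  intro i
  simp only [Polynomial.coeff_add]
  exact (hf _).add (hg _)

theorem CT_sub {f g : ℕ → Polynomial ℂ} {f' g' : Polynomial ℂ} (hf : CT f f') (hg : CT g g') :
    CT (fun n => f n - g n) (f' - g') := by
  intro i
  simp only [Polynomial.coeff_sub]
  exact (hf _).sub (hg _)

theorem CT_const (f : Polynomial ℂ) : CT (fun _ => f) f := fun _ => tendsto_const_nhds

theorem CT_fam (P : ℕ → P3) (N : ℕ) {t : ℕ → ℂ} (ht : Tendsto t atTop (nhds 0))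
    (a b : Fin 3 → ℂ) :
    CT (fun n => lineRestrict (fam P (N + 1) (t n)) a b) (lineRestrict (P 0) a b) := by
  intro i
  have h2 : ∀ n, (lineRestrict (fam P (N + 1) (t n)) a b).coeff i =
      (lineRestrict (P 0) a b).coeff i +
      t n * ∑ k ∈ Finset.range N, (t n) ^ k * (lineRestrict (P (k + 1)) a b).coeff i := by
    intro n
    rw [fam_succ]
    simp only [fam, lineRestrict, map_add, map_mul, map_sum, MvPolynomial.algHom_C,
      Polynomial.algebraMap_apply, Algebra.algebraMap_self, RingHom.id_apply, Polynomial.coeff_add,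
      Polynomial.coeff_C_mul, Polynomial.finsetSum_coeff]
  simp only [h2]
  have h3 : Tendsto (fun n => ∑ k ∈ Finset.range N, (t n) ^ k *
      (lineRestrict (P (k + 1)) a b).coeff i) atTop (nhds (∑ k ∈ Finset.range N, (0 : ℂ) ^ k *
      (lineRestrict (P (k + 1)) a b).coeff i)) :=
    tendsto_finsetSum _ fun k _ => (ht.pow k).mul tendsto_const_nhds
  have := (tendsto_const_nhds (x := (lineRestrict (P 0) a b).coeff i)).add (ht.mul h3)
  simpa using this

theorem lineRestrict_Bord (F : P3) (b O a v : Fin 3 → ℂ) : lineRestrict (Bord b O F) a v =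
    lineRestrict (dd O F) a v * lineRestrict (dd O F) a v * lineRestrict (dd b (dd b F)) a v -
      Polynomial.C 2 * (lineRestrict (dd b F) a v * lineRestrict (dd O F) a v *
        lineRestrict (dd b (dd O F)) a v) +
      lineRestrict (dd b F) a v * lineRestrict (dd b F) a v * lineRestrict (dd O (dd O F)) a v := by
  unfold Bord lineRestrict
  simp only [map_add, map_sub, map_mul, map_pow, map_ofNat]
  ring

theorem CT_Bord (P : ℕ → P3) (N : ℕ) {t : ℕ → ℂ} (ht : Tendsto t atTop (nhds 0))
    (b O a v : Fin 3 → ℂ) :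
    CT (fun n => lineRestrict (Bord b O (fam P (N + 1) (t n))) a v)
      (lineRestrict (Bord b O (P 0)) a v) := by
  simp only [lineRestrict_Bord, dd_fam]
  have h : ∀ P : ℕ → P3, CT (fun n => lineRestrict (fam P (N + 1) (t n)) a v)
      (lineRestrict (P 0) a v) := fun P => CT_fam P N ht a v
  exact CT_add (CT_sub (CT_mul (CT_mul (h _) (h _)) (h _))
    (CT_mul (CT_const _) (CT_mul (CT_mul (h _) (h _)) (h _))))
    (CT_mul (CT_mul (h _) (h _)) (h _))

theorem eval_linForm (w z : Fin 3 → ℂ) : MvPolynomial.eval z (linForm w) = dotv w z := by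
  simp [linForm, dotv]

theorem dd_linForm (w u : Fin 3 → ℂ) : dd u (linForm w) = MvPolynomial.C (dotv w u) := by
  simp only [dd, linForm, dotv, Fin.sum_univ_three, map_add, MvPolynomial.pderiv_C_mul,
    MvPolynomial.pderiv_X]
  simp
  ring

/-- first order expansion -/
theorem first_order (P : ℕ → P3) (N : ℕ) {t y : ℕ → ℂ} (ht : Tendsto t atTop (nhds 0))
    (ht0 : ∀ n, t n ≠ 0) {w O z0 : Fin 3 → ℂ} {G' : P3} (hP : P 0 = linForm w * G')
    (hz : dotv w z0 = 0) {η : ℂ} (hy : Tendsto (fun n => y n / t n) atTop (nhds η)) :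
    Tendsto (fun n => MvPolynomial.eval (z0 + y n • O) (fam P (N + 2) (t n)) / t n) atTop
      (nhds (η * dotv w O * MvPolynomial.eval z0 G' + MvPolynomial.eval z0 (P 1))) := by
  have hy0 : Tendsto y atTop (nhds 0) := by
    have := hy.mul ht
    simp only [mul_zero] at this
    refine this.congr fun n => ?_
    rw [div_mul_cancel₀ _ (ht0 n)]
  have hz' : Tendsto (fun n => z0 + y n • O) atTop (nhds z0) := by
    have := (tendsto_const_nhds (x := z0)).add (hy0.smul (tendsto_const_nhds (x := O)))
    simpa using this
  have h1 := eval_fam_tendsto (fun k => P (k + 1)) N ht hz'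
  have h2 : Tendsto (fun n => MvPolynomial.eval (z0 + y n • O) G') atTop
      (nhds (MvPolynomial.eval z0 G')) :=
    ((MvPolynomial.continuous_eval G').tendsto z0).comp hz'
  refine (((hy.mul_const (dotv w O)).mul h2).add h1).congr fun n => ?_
  rw [fam_succ P (N + 1), hP]
  simp only [map_add, map_mul, eval_linForm, dotv_add, dotv_smul, hz, MvPolynomial.eval_C]
  have := ht0 n
  field_simp
  ring

theorem small_root (p : Polynomial ℂ) {d : ℕ} (hp : p.natDegree = d) (hd : d ≠ 0) :
    ∃ y, p.eval y = 0 ∧ ‖p.leadingCoeff‖ * ‖y‖ ^ d ≤ ‖p.eval 0‖ := by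
  have hp0 : p ≠ 0 := by rintro rfl; simp at hp; exact hd hp.symm
  have hcard : p.roots.card = d := by
    rw [← hp]; exact (Polynomial.splits_iff_card_roots.mp (IsAlgClosed.splits p))
  have hne : p.roots ≠ 0 := by
    intro h; rw [h] at hcard; simp at hcard; exact hd hcard.symm
  obtain ⟨y, hy, hmin⟩ := p.roots.toFinset.exists_min_image (fun y => ‖y‖) (by
    obtain ⟨y, hy⟩ := Multiset.exists_mem_of_ne_zero hne
    exact ⟨y, Multiset.mem_toFinset.mpr hy⟩)
  rw [Multiset.mem_toFinset] at hy
  refine ⟨y, (Polynomial.mem_roots hp0).mp hy, ?_⟩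
  have h := congrArg (Polynomial.eval 0) (IsAlgClosed.splits p).eq_prod_roots
  rw [Polynomial.eval_mul, Polynomial.eval_C, Polynomial.eval_multiset_prod, Multiset.map_map] at h
  rw [h, norm_mul]
  refine mul_le_mul_of_nonneg_left ?_ (norm_nonneg _)
  have hnorm : ∀ m : Multiset ℂ, ‖m.prod‖ = (m.map fun x => ‖x‖).prod := fun m =>
    map_multiset_prod (normHom : ℂ →*₀ ℝ) m
  rw [← hcard, ← Multiset.prod_replicate, ← Multiset.map_const', hnorm, Multiset.map_map]
  refine Multiset.prod_map_le_prod_map₀ _ _ (fun _ _ => norm_nonneg _) fun r hr => ?_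
  have := hmin r (Multiset.mem_toFinset.mpr hr)
  simpa using this

end family

section limit

/-- the sextic on the line -/
def sig (G H : P3) (b z : Fin 3 → ℂ) : ℂ :=
  MvPolynomial.eval z G ^ 2 * MvPolynomial.eval z (dd b (dd b H)) -
    2 * MvPolynomial.eval z G * MvPolynomial.eval z (dd b G) * MvPolynomial.eval z (dd b H) +
    (2 * MvPolynomial.eval z (dd b G) ^ 2 -
      MvPolynomial.eval z G * MvPolynomial.eval z (dd b (dd b G))) * MvPolynomial.eval z H

theorem dd_LG (w u : Fin 3 → ℂ) (G : P3) :
    dd u (linForm w * G) = MvPolynomial.C (dotv w u) * G + linForm w * dd u G := by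
  rw [dd_mul, dd_linForm]

theorem dd_LG0 {w u : Fin 3 → ℂ} (hu : dotv w u = 0) (G : P3) :
    dd u (linForm w * G) = linForm w * dd u G := by
  rw [dd_LG, hu]; simp

theorem eval_Bord_LG {w b O z : Fin 3 → ℂ} (hb : dotv w b = 0) (G : P3)
    (hz : MvPolynomial.eval z G = 0) : MvPolynomial.eval z (Bord b O (linForm w * G)) =
    dotv w z ^ 3 * MvPolynomial.eval z (Bord b O G) := by
  unfold Bord
  simp only [dd_LG0 hb, dd_LG w O, dd_add, dd_Cmul, map_add, map_sub, map_mul, map_pow,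
    map_ofNat, MvPolynomial.eval_C, eval_linForm, hz]
  ring

theorem lineRestrict_LG {w z0 O : Fin 3 → ℂ} (hz : dotv w z0 = 0) (G : P3) :
    lineRestrict (linForm w * G) z0 O =
      Polynomial.X * (Polynomial.C (dotv w O) * lineRestrict G z0 O) := by
  have h : lineRestrict (linForm w) z0 O = Polynomial.C (dotv w O) * Polynomial.X := by
    have : lineRestrict (linForm w) z0 O = Polynomial.C (dotv w z0) +
        Polynomial.C (dotv w O) * Polynomial.X := by
      simp only [lineRestrict, linForm, dotv, Fin.sum_univ_three, map_add, map_mul,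
        MvPolynomial.aeval_X, MvPolynomial.algHom_C, Polynomial.algebraMap_apply,
        Algebra.algebraMap_self, RingHom.id_apply]
      ring
    rw [this, hz]; simp
  have h2 : lineRestrict (linForm w * G) z0 O = lineRestrict (linForm w) z0 O *
    lineRestrict G z0 O := by simp [lineRestrict]
  rw [h2, h]; ring

theorem res_central {G : P3} (hG : G.IsHomogeneous 3) {w z0 b O : Fin 3 → ℂ}
    (hz : dotv w z0 = 0) (hb : dotv w b = 0) (hw : dotv w O ≠ 0) (hO : MvPolynomial.eval O G ≠ 0) :
    Polynomial.resultant (Polynomial.C (dotv w O) * lineRestrict G z0 O)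
      (lineRestrict (Bord b O (linForm w * G)) z0 O) 3 8 =
    -(dotv w O) ^ 17 * MvPolynomial.eval z0 G ^ 3 *
      Polynomial.resultant (lineRestrict G z0 O) (lineRestrict (Bord b O G) z0 O) 3 5 := by
  set γ := dotv w O with hγ
  set g := lineRestrict G z0 O with hg
  have hLG : (linForm w * G).IsHomogeneous 4 := by
    have h1 : (linForm w).IsHomogeneous 1 := by
      refine MvPolynomial.IsHomogeneous.sum _ _ _ fun i _ => ?_
      have := (MvPolynomial.isHomogeneous_C (Fin 3) (w i)).mul (MvPolynomial.isHomogeneous_X ℂ i)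
      simpa using this
    exact h1.mul hG
  have hnd : g.natDegree = 3 := lr_natDegree_eq hG z0 O hO
  have hnd' : (Polynomial.C γ * g).natDegree = 3 := by rw [Polynomial.natDegree_C_mul hw, hnd]
  have hcard : g.roots.card = 3 := by
    rw [← hnd]; exact (Polynomial.splits_iff_card_roots.mp (IsAlgClosed.splits g))
  obtain ⟨r1, r2, r3, hr⟩ := Multiset.card_eq_three.mp hcard
  have h1 := Polynomial.resultant_eq_prod_eval (Polynomial.C γ * g)
    (lineRestrict (Bord b O (linForm w * G)) z0 O) 8
    (lineRestrict_natDegree (Bord_hom hLG (by norm_num) b O) _ O) (IsAlgClosed.splits _)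
  have h2 := Polynomial.resultant_eq_prod_eval g
    (lineRestrict (Bord b O G) z0 O) 5
    (lineRestrict_natDegree (Bord_hom hG (by norm_num) b O) _ O) (IsAlgClosed.splits _)
  rw [hnd'] at h1
  rw [hnd] at h2
  rw [h1, h2, Polynomial.roots_C_mul _ hw, Polynomial.leadingCoeff_mul, Polynomial.leadingCoeff_C,
    hr]
  have h3 := (IsAlgClosed.splits g).eq_prod_roots
  have hg0 : MvPolynomial.eval z0 G = g.eval 0 := by rw [hg, lineRestrict_eval]; simp
  rw [hr] at h3
  have h4 := congrArg (Polynomial.eval 0) h3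
  simp only [Multiset.insert_eq_cons, Multiset.map_cons, Multiset.map_singleton,
    Multiset.prod_cons, Multiset.prod_singleton, Polynomial.eval_mul, Polynomial.eval_C,
    Polynomial.eval_sub, Polynomial.eval_X] at h4 ⊢
  have hroot : ∀ r ∈ g.roots, (lineRestrict (Bord b O (linForm w * G)) z0 O).eval r =
      (r * γ) ^ 3 * (lineRestrict (Bord b O G) z0 O).eval r := by
    intro r hr
    have hg1 : g.eval r = 0 := Polynomial.isRoot_of_mem_roots hr
    rw [hg, lineRestrict_eval] at hg1
    rw [lineRestrict_eval, lineRestrict_eval, eval_Bord_LG hb G hg1, dotv_add, dotv_smul, hz,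
      zero_add]
  rw [hroot r1 (by rw [hr]; simp), hroot r2 (by rw [hr]; simp), hroot r3 (by rw [hr]; simp),
    hg0, h4]
  ring

theorem Nlim {G : P3} (hG : G.IsHomogeneous 3) {w a b O : Fin 3 → ℂ}
    (ha : dotv w a = 0) (hb : dotv w b = 0) (hw : dotv w O ≠ 0) (hO : MvPolynomial.eval O G ≠ 0)
    (P : ℕ → P3) (N : ℕ) (hP : P 0 = linForm w * G) {t : ℕ → ℂ}
    (ht : Tendsto t atTop (nhds 0)) (ht0 : ∀ n, t n ≠ 0)
    (hhom : ∀ n, (fam P (N + 2) (t n)).IsHomogeneous 4) (x : ℂ)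
    (hx : MvPolynomial.eval (a + x • b) G ≠ 0) :
    Tendsto (fun n => (Nres a b O (fam P (N + 2) (t n)) 4).eval x / t n) atTop
      (nhds (-(dotv w O) ^ 19 * (sig G (P 1) b (a + x • b) * MvPolynomial.eval (a + x • b) G ^ 3 *
        (Nres a b O G 3).eval x))) := by
  set z0 := a + x • b with hz0
  set γ := dotv w O with hγ
  have hwz : dotv w z0 = 0 := by rw [hz0, dotv_add, dotv_smul, ha, hb]; ring
  have hFO : Tendsto (fun n => MvPolynomial.eval O (fam P (N + 2) (t n))) atTop
      (nhds (γ * MvPolynomial.eval O G)) := by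
    have := eval_fam_tendsto P (N + 1) ht (tendsto_const_nhds (x := O))
    rwa [hP, map_mul, eval_linForm] at this
  have hFz : Tendsto (fun n => MvPolynomial.eval z0 (fam P (N + 2) (t n))) atTop (nhds 0) := by
    have := eval_fam_tendsto P (N + 1) ht (tendsto_const_nhds (x := z0))
    rwa [hP, map_mul, eval_linForm, hwz, zero_mul] at this
  have hne : ∀ᶠ n in atTop, MvPolynomial.eval O (fam P (N + 2) (t n)) ≠ 0 :=
    hFO.eventually_ne (mul_ne_zero hw hO)
  have hex : ∀ n, ∃ y : ℂ, MvPolynomial.eval O (fam P (N + 2) (t n)) ≠ 0 →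
      MvPolynomial.eval (z0 + y • O) (fam P (N + 2) (t n)) = 0 ∧
      ‖MvPolynomial.eval O (fam P (N + 2) (t n))‖ * ‖y‖ ^ 4 ≤
        ‖MvPolynomial.eval z0 (fam P (N + 2) (t n))‖ := by
    intro n
    by_cases h : MvPolynomial.eval O (fam P (N + 2) (t n)) = 0
    · exact ⟨0, fun h' => absurd h h'⟩
    · have hnd := lr_natDegree_eq (hhom n) z0 O h
      obtain ⟨y, hy1, hy2⟩ := small_root _ hnd (by norm_num)
      refine ⟨y, fun _ => ?_⟩
      rw [lineRestrict_eval] at hy1 hy2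
      rw [Polynomial.leadingCoeff, hnd, lineRestrict_coeff (hhom n)] at hy2
      rw [zero_smul, add_zero] at hy2
      exact ⟨hy1, hy2⟩
  choose y hy using hex
  have hy0 : Tendsto y atTop (nhds 0) := by
    have h4 : Tendsto (fun n => ‖y n‖ ^ 4) atTop (nhds 0) := by
      have hb' : Tendsto (fun n => ‖MvPolynomial.eval z0 (fam P (N + 2) (t n))‖ /
          ‖MvPolynomial.eval O (fam P (N + 2) (t n))‖) atTop (nhds 0) := by
        have := hFz.norm.div hFO.norm (norm_ne_zero_iff.mpr (mul_ne_zero hw hO))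
        rw [norm_zero, zero_div] at this
        exact this
      refine squeeze_zero' (Eventually.of_forall fun n => by positivity) ?_ hb'
      filter_upwards [hne] with n hn
      rw [le_div_iff₀ (norm_pos_iff.mpr hn), mul_comm]
      exact (hy n hn).2
    rw [tendsto_zero_iff_norm_tendsto_zero, Metric.tendsto_atTop]
    intro ε hε
    obtain ⟨M, hM⟩ := Metric.tendsto_atTop.mp h4 (ε ^ 4) (by positivity)
    refine ⟨M, fun n hn => ?_⟩
    have := hM n hn
    rw [Real.dist_eq, sub_zero, abs_of_nonneg (by positivity)] at this ⊢
    exact lt_of_pow_lt_pow_left₀ 4 hε.le this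
  have hz' : Tendsto (fun n => z0 + y n • O) atTop (nhds z0) := by
    have := (tendsto_const_nhds (x := z0)).add (hy0.smul (tendsto_const_nhds (x := O)))
    simpa using this
  have hevG : ∀ F : P3, Tendsto (fun n => MvPolynomial.eval (z0 + y n • O) F) atTop
      (nhds (MvPolynomial.eval z0 F)) := fun F =>
    ((MvPolynomial.continuous_eval F).tendsto z0).comp hz'
  set g := MvPolynomial.eval z0 G with hg
  set h := MvPolynomial.eval z0 (P 1) with hh
  have hη : Tendsto (fun n => y n / t n) atTop (nhds (-h / (γ * g))) := by
    have h1 := eval_fam_tendsto (fun k => P (k + 1)) N ht hz'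
    have h2 := h1.neg.div ((tendsto_const_nhds (x := γ)).mul (hevG G)) (mul_ne_zero hw hx)
    refine h2.congr' ?_
    filter_upwards [hne, (hevG G).eventually_ne hx] with n hn hn2
    have h3 := (hy n hn).1
    rw [fam_succ P (N + 1), hP] at h3
    simp only [map_add, map_mul, eval_linForm, dotv_add, dotv_smul, hwz, MvPolynomial.eval_C] at h3
    have h4 := ht0 n
    simp only [Pi.div_apply]
    rw [div_eq_div_iff (mul_ne_zero hw hn2) h4]
    linear_combination -h3
  set η := -h / (γ * g) with hηd
  -- derivative limits
  have hb1 := first_order (fun k => dd b (P k)) N (O := O) ht ht0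
    (by rw [hP, dd_LG0 hb]) hwz hη
  have hbb1 := first_order (fun k => dd b (dd b (P k))) N (O := O) ht ht0
    (by rw [hP, dd_LG0 hb, dd_LG0 hb]) hwz hη
  have hb0 := eval_fam_tendsto (fun k => dd b (P k)) (N + 1) ht hz'
  have hO0 := eval_fam_tendsto (fun k => dd O (P k)) (N + 1) ht hz'
  have hbO0 := eval_fam_tendsto (fun k => dd b (dd O (P k))) (N + 1) ht hz'
  have hOO0 := eval_fam_tendsto (fun k => dd O (dd O (P k))) (N + 1) ht hz'
  have hB : Tendsto (fun n => MvPolynomial.eval (z0 + y n • O)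
      (Bord b O (fam P (N + 2) (t n))) / t n) atTop (nhds (γ ^ 2 * sig G (P 1) b z0)) := by
    have hlim := (((hO0.pow 2).mul hbb1).sub (((hb1.mul hO0).mul hbO0).const_mul 2)).add
      ((hb1.mul hb0).mul hOO0)
    have hval : γ ^ 2 * sig G (P 1) b z0 = (MvPolynomial.eval z0 (dd O (P 0))) ^ 2 *
        (η * dotv w O * MvPolynomial.eval z0 (dd b (dd b G)) +
          MvPolynomial.eval z0 (dd b (dd b (P 1)))) -
        2 * ((η * dotv w O * MvPolynomial.eval z0 (dd b G) + MvPolynomial.eval z0 (dd b (P 1))) *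
          MvPolynomial.eval z0 (dd O (P 0)) * MvPolynomial.eval z0 (dd b (dd O (P 0)))) +
        ((η * dotv w O * MvPolynomial.eval z0 (dd b G) + MvPolynomial.eval z0 (dd b (P 1))) *
          MvPolynomial.eval z0 (dd b (P 0))) * MvPolynomial.eval z0 (dd O (dd O (P 0))) := by
      rw [hP]
      simp only [dd_LG0 hb, dd_LG w O, dd_add, dd_Cmul, map_add, map_mul,
        MvPolynomial.eval_C, eval_linForm, hwz]
      rw [sig, hηd, ← hγ, ← hg, ← hh]
      have hg' : g ≠ 0 := hx
      field_simp
      ring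
    rw [hval]
    refine hlim.congr fun n => ?_
    simp only [Bord, dd_fam, map_add, map_sub, map_mul, map_pow, map_ofNat]
    have := ht0 n
    field_simp
  -- quotient
  set ft : ℕ → Polynomial ℂ := fun n => lineRestrict (fam P (N + 2) (t n)) z0 O /ₘ
    (Polynomial.X - Polynomial.C (y n)) with hft
  have hCT := CT_fam P (N + 1) ht z0 O
  have hres : Tendsto (fun n => Polynomial.resultant (ft n)
      (lineRestrict (Bord b O (fam P (N + 2) (t n))) z0 O) 3 8) atTop
      (nhds (Polynomial.resultant (Polynomial.C γ * lineRestrict G z0 O)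
        (lineRestrict (Bord b O (linForm w * G)) z0 O) 3 8)) := by
    apply tendsto_resultant
    · intro i
      have hlim : Tendsto (fun n => ∑ j ∈ Finset.Icc (i + 1) 4, (y n) ^ (j - (i + 1)) *
          (lineRestrict (fam P (N + 2) (t n)) z0 O).coeff j) atTop
          (nhds (∑ j ∈ Finset.Icc (i + 1) 4, (0 : ℂ) ^ (j - (i + 1)) *
            (lineRestrict (P 0) z0 O).coeff j)) :=
        tendsto_finsetSum _ fun j _ => (hy0.pow _).mul (hCT j)
      have hval : ∑ j ∈ Finset.Icc (i + 1) 4, (0 : ℂ) ^ (j - (i + 1)) *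
            (lineRestrict (P 0) z0 O).coeff j = (Polynomial.C γ * lineRestrict G z0 O).coeff i := by
        rw [hP, lineRestrict_LG hwz]
        by_cases hi : i + 1 ≤ 4
        · rw [Finset.sum_eq_single (i + 1)]
          · rw [Polynomial.coeff_X_mul, hγ]; simp
          · intro j hj hji
            rw [Finset.mem_Icc] at hj
            rw [zero_pow (by omega), zero_mul]
          · intro hn
            exact absurd (Finset.mem_Icc.mpr ⟨le_refl _, hi⟩) hn
        · rw [Finset.Icc_eq_empty hi, Finset.sum_empty, Polynomial.coeff_C_mul,
            Polynomial.coeff_eq_zero_of_natDegree_lt, mul_zero]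
          exact (lineRestrict_natDegree hG z0 O).trans_lt (by omega)
      rw [← hval]
      refine hlim.congr' ?_
      filter_upwards [hne] with n hn
      rw [hft, Polynomial.coeff_divByMonic_X_sub_C, lr_natDegree_eq (hhom n) z0 O hn]
    · have := CT_Bord P (N + 1) ht b O z0 O
      rw [hP] at this
      exact this
  rw [res_central hG hwz hb hw hO] at hres
  have hfin := hB.mul hres
  have hval : γ ^ 2 * sig G (P 1) b z0 * (-γ ^ 17 * g ^ 3 *
      Polynomial.resultant (lineRestrict G z0 O) (lineRestrict (Bord b O G) z0 O) 3 5) =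
      -γ ^ 19 * (sig G (P 1) b z0 * g ^ 3 * (Nres a b O G 3).eval x) := by
    rw [eval_Nres]; ring
  rw [← hval]
  refine hfin.congr' ?_
  filter_upwards [hne] with n hn
  have hnd := lr_natDegree_eq (hhom n) z0 O hn
  have hfac : (Polynomial.X - Polynomial.C (y n)) * ft n =
      lineRestrict (fam P (N + 2) (t n)) z0 O := by
    rw [hft, Polynomial.mul_divByMonic_eq_iff_isRoot, Polynomial.IsRoot, lineRestrict_eval]
    exact (hy n hn).1
  have hft0 : ft n ≠ 0 := by
    intro h0
    rw [h0, mul_zero] at hfac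
    rw [← hfac] at hnd; simp at hnd
  have hsp := res_split (y n) (ft n) (lineRestrict (Bord b O (fam P (N + 2) (t n))) z0 O) 4 8
    (by rw [hfac, hnd]) hft0 (lineRestrict_natDegree (Bord_hom (hhom n) (by norm_num) b O) _ O)
  rw [hfac] at hsp
  have e1 : (Nres a b O (fam P (N + 2) (t n)) 4).eval x =
      Polynomial.resultant (lineRestrict (fam P (N + 2) (t n)) z0 O)
        (lineRestrict (Bord b O (fam P (N + 2) (t n))) z0 O) 4 8 := by
    rw [eval_Nres]
  rw [e1, hsp, lineRestrict_eval]
  ring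

end limit

section famQ

def Psi (Q : MvPolynomial (Fin 4) ℂ) : Polynomial P3 :=
  MvPolynomial.aeval (fun i : Fin 4 => if h : (i : ℕ) < 3 then
    Polynomial.C (MvPolynomial.X ⟨i, h⟩ : P3) else Polynomial.X) Q

theorem eval_Psi (Q : MvPolynomial (Fin 4) ℂ) (t : ℂ) :
    (Psi Q).eval (MvPolynomial.C t) = fiberAt Q t := by
  have := MvPolynomial.comp_aeval_apply (R := ℂ) (σ := Fin 4)
    (fun i : Fin 4 => if h : (i : ℕ) < 3 then
      Polynomial.C (MvPolynomial.X ⟨i, h⟩ : P3) else Polynomial.X)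
    ((Polynomial.aeval (R := P3) (A := P3) (MvPolynomial.C t : P3)).restrictScalars ℂ) Q
  refine Eq.trans this ?_
  unfold fiberAt
  congr 2
  funext i
  by_cases h : (i : ℕ) < 3
  · simp [h]
  · simp [h]

theorem Psi_deriv (Q : MvPolynomial (Fin 4) ℂ) :
    Polynomial.derivative (Psi Q) = Psi (MvPolynomial.pderiv 3 Q) := by
  have := chain_rule ((Polynomial.derivative' (R := P3)).restrictScalars ℂ)
    (fun i : Fin 4 => if h : (i : ℕ) < 3 then
      Polynomial.C (MvPolynomial.X ⟨i, h⟩ : P3) else Polynomial.X) Q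
  refine Eq.trans this ?_
  rw [Fin.sum_univ_four]
  simp [Psi, Polynomial.derivative'_apply]

theorem eval_fiberAt (Q : MvPolynomial (Fin 4) ℂ) (t : ℂ) (z : Fin 3 → ℂ) :
    MvPolynomial.eval z (fiberAt Q t) = evalFam Q z t := by
  have := MvPolynomial.comp_aeval_apply (R := ℂ) (σ := Fin 4)
    (fun i : Fin 4 => if h : (i : ℕ) < 3 then (MvPolynomial.X ⟨i, h⟩ : P3) else MvPolynomial.C t)
    (MvPolynomial.aeval (R := ℂ) z) Q
  rw [MvPolynomial.aeval_eq_eval] at this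
  refine Eq.trans this ?_
  rw [MvPolynomial.aeval_eq_eval]
  unfold evalFam
  congr 2
  funext i
  by_cases h : (i : ℕ) < 3
  · simp [h]
  · simp [h]

theorem pderiv_fiberAt (Q : MvPolynomial (Fin 4) ℂ) (t : ℂ) (i : Fin 3) :
    MvPolynomial.pderiv i (fiberAt Q t) = fiberAt (MvPolynomial.pderiv i.castSucc Q) t := by
  have := chain_rule (MvPolynomial.pderiv (R := ℂ) i)
    (fun i : Fin 4 => if h : (i : ℕ) < 3 then (MvPolynomial.X ⟨i, h⟩ : P3) else MvPolynomial.C t) Q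
  refine Eq.trans this ?_
  rw [Fin.sum_univ_four]
  fin_cases i <;> simp [fiberAt, MvPolynomial.pderiv_X]

theorem exists_fam (Q : MvPolynomial (Fin 4) ℂ) (h : ∀ t, (fiberAt Q t).IsHomogeneous 4) :
    ∃ (N : ℕ) (P : ℕ → P3), (∀ t, fiberAt Q t = fam P (N + 2) t) ∧ P 0 = fiberAt Q 0 ∧
      (P 1).IsHomogeneous 4 ∧
      ∀ z, MvPolynomial.eval z (P 1) = evalFam (MvPolynomial.pderiv 3 Q) z 0 := by
  have hfam : ∀ t, fiberAt Q t = fam (fun k => (Psi Q).coeff k) ((Psi Q).natDegree + 2) t := by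
    intro t
    rw [← eval_Psi, Polynomial.eval_eq_sum_range' (n := (Psi Q).natDegree + 2) (by omega), fam]
    refine Finset.sum_congr rfl fun k _ => ?_
    rw [MvPolynomial.C_pow]; ring
  have h0 : ∀ R, (Psi R).coeff 0 = fiberAt R 0 := by
    intro R
    rw [← eval_Psi, MvPolynomial.C_0, Polynomial.coeff_zero_eq_eval_zero]
  refine ⟨(Psi Q).natDegree, fun k => (Psi Q).coeff k, hfam, h0 Q, ?_, ?_⟩
  · intro m hm
    by_contra hne
    apply hm
    set N := (Psi Q).natDegree
    set r : Polynomial ℂ := ∑ k ∈ Finset.range (N + 2),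
      Polynomial.C (MvPolynomial.coeff m ((Psi Q).coeff k)) * Polynomial.X ^ k with hr
    have hr0 : r = 0 := by
      apply Polynomial.funext
      intro t
      have h1 : MvPolynomial.coeff m (fiberAt Q t) = 0 := by
        by_contra h2
        exact hne (h t h2)
      rw [hfam, fam, MvPolynomial.coeff_sum] at h1
      rw [hr, Polynomial.eval_finsetSum, Polynomial.eval_zero, ← h1]
      refine Finset.sum_congr rfl fun k _ => ?_
      rw [MvPolynomial.coeff_C_mul, Polynomial.eval_mul, Polynomial.eval_C, Polynomial.eval_pow,
        Polynomial.eval_X]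
      ring
    have h3 := congrArg (fun p => Polynomial.coeff p 1) hr0
    simp only [hr, Polynomial.finsetSum_coeff, Polynomial.coeff_C_mul, Polynomial.coeff_X_pow,
      Polynomial.coeff_zero] at h3
    simpa using h3
  · intro z
    rw [← eval_fiberAt, ← h0, ← Psi_deriv, Polynomial.coeff_derivative]
    simp

theorem node_ne {G : P3} {w p : Fin 3 → ℂ} {Q : MvPolynomial (Fin 4) ℂ}
    (hQ : fiberAt Q 0 = linForm w * G) (hG : MvPolynomial.eval p G = 0) (hw : dotv w p = 0)
    (hreg : TotalSpaceSmoothAt Q p) : evalFam (MvPolynomial.pderiv 3 Q) p 0 ≠ 0 := by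
  intro h
  apply hreg
  refine ⟨?_, fun i => ?_⟩
  · rw [← eval_fiberAt, hQ, map_mul, hG, mul_zero]
  · induction i using Fin.lastCases with
    | last => exact h
    | cast i =>
      rw [← eval_fiberAt, ← pderiv_fiberAt, hQ, MvPolynomial.pderiv_mul, map_add, map_mul, map_mul,
        hG, eval_linForm, hw]
      simp

end famQ

section zcoord

theorem binform {F : P3} {d : ℕ} (hF : F.IsHomogeneous d) (u v : Fin 3 → ℂ) :
    ∃ c : ℕ → ℂ, ∀ X Y : ℂ, MvPolynomial.eval (X • u + Y • v) F =
      ∑ i ∈ Finset.range (d + 1), c i * X ^ (d - i) * Y ^ i := by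
  refine ⟨fun i => (lineRestrict F u v).coeff i, fun X Y => ?_⟩
  by_cases hX : X = 0
  · subst hX
    rw [zero_smul, zero_add, eval_scale hF, Finset.sum_eq_single d]
    · simp only [lineRestrict_coeff hF]; simp; ring
    · intro i hi hid
      have := Finset.mem_range.mp hi
      rw [zero_pow (by omega)]; ring
    · intro h; exact absurd (Finset.mem_range.mpr (by omega)) h
  · have h1 : X • u + Y • v = X • (u + (Y / X) • v) := by
      rw [smul_add, smul_smul, mul_div_cancel₀ _ hX]
    rw [h1, eval_scale hF, ← lineRestrict_eval, Polynomial.eval_eq_sum_range' (n := d + 1)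
      (Nat.lt_succ_of_le (lineRestrict_natDegree hF u v)), Finset.mul_sum]
    refine Finset.sum_congr rfl fun i hi => ?_
    have hi' : i ≤ d := by have := Finset.mem_range.mp hi; omega
    have : X ^ d = X ^ (d - i) * X ^ i := by rw [← pow_add]; congr 1; omega
    rw [this, div_pow]
    field_simp

theorem lr_deriv {F : P3} {a b : Fin 3 → ℂ} {f : Polynomial ℂ}
    (h : ∀ x : ℂ, MvPolynomial.eval (a + x • b) F = f.eval x) (x : ℂ) :
    MvPolynomial.eval (a + x • b) (dd b F) = (Polynomial.derivative f).eval x := by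
  have h1 : lineRestrict F a b = f := Polynomial.funext fun y => by rw [lineRestrict_eval, h]
  rw [← lineRestrict_eval, ← lineRestrict_derivative, h1]

def sx (g1 g2 h0 h1 h2 h3 h4 X Y : ℂ) : ℂ :=
  2 * g1 ^ 2 * h0 * X ^ 6 + 6 * g1 * g2 * h0 * X ^ 5 * Y + 6 * g2 ^ 2 * h0 * X ^ 4 * Y ^ 2 +
    (2 * g2 ^ 2 * h1 - 2 * g1 * g2 * h2 + 2 * g1 ^ 2 * h3) * X ^ 3 * Y ^ 3 +
    6 * g1 ^ 2 * h4 * X ^ 2 * Y ^ 4 + 6 * g1 * g2 * h4 * X * Y ^ 5 + 2 * g2 ^ 2 * h4 * Y ^ 6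

theorem sx_fac (g1 g2 h0 h1 h2 h3 h4 : ℂ) (hg : g1 ≠ 0) (hh : h0 ≠ 0) :
    ∃ T : Fin 6 → ℂ, (∀ j, sx g1 g2 h0 h1 h2 h3 h4 (T j) 1 = 0) ∧
      ∀ X Y, sx g1 g2 h0 h1 h2 h3 h4 X Y = 2 * g1 ^ 2 * h0 * ∏ j, (X - T j * Y) := by
  set f : Polynomial ℂ := Polynomial.C (2 * g1 ^ 2 * h0) * Polynomial.X ^ 6 +
    Polynomial.C (6 * g1 * g2 * h0) * Polynomial.X ^ 5 +
    Polynomial.C (6 * g2 ^ 2 * h0) * Polynomial.X ^ 4 +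
    Polynomial.C (2 * g2 ^ 2 * h1 - 2 * g1 * g2 * h2 + 2 * g1 ^ 2 * h3) * Polynomial.X ^ 3 +
    Polynomial.C (6 * g1 ^ 2 * h4) * Polynomial.X ^ 2 +
    Polynomial.C (6 * g1 * g2 * h4) * Polynomial.X + Polynomial.C (2 * g2 ^ 2 * h4) with hf
  have hlc : 2 * g1 ^ 2 * h0 ≠ 0 := by
    exact mul_ne_zero (mul_ne_zero two_ne_zero (pow_ne_zero _ hg)) hh
  have hnd : f.natDegree = 6 := by
    rw [hf]
    compute_degree!
  have hco : f.leadingCoeff = 2 * g1 ^ 2 * h0 := by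
    rw [Polynomial.leadingCoeff, hnd, hf]
    compute_degree!
  have hev : ∀ X, f.eval X = sx g1 g2 h0 h1 h2 h3 h4 X 1 := by
    intro X; rw [hf, sx]; simp
  have hcard : f.roots.card = 6 := by
    rw [← hnd]; exact (Polynomial.splits_iff_card_roots.mp (IsAlgClosed.splits f))
  have hf0 : f ≠ 0 := by intro h; rw [h] at hnd; simp at hnd
  obtain ⟨l, hl⟩ := Quot.exists_rep f.roots
  have hl' : (l : Multiset ℂ) = f.roots := hl
  have hlen : l.length = 6 := by rw [← hcard, ← hl']; simp
  refine ⟨fun j => l.get (j.cast hlen.symm), ?_, ?_⟩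
  · intro j
    rw [← hev]
    have : l.get (j.cast hlen.symm) ∈ f.roots := by
      rw [← hl']; exact Multiset.mem_coe.mpr (List.get_mem _ _)
    exact Polynomial.isRoot_of_mem_roots this
  · have hX1 : ∀ X, sx g1 g2 h0 h1 h2 h3 h4 X 1 = 2 * g1 ^ 2 * h0 *
        ∏ j : Fin 6, (X - l.get (j.cast hlen.symm)) := by
      intro X
      have h := congrArg (Polynomial.eval X) (IsAlgClosed.splits f).eq_prod_roots
      rw [hev, hco, ← hl', Polynomial.eval_mul, Polynomial.eval_C, Polynomial.eval_multiset_prod,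
        Multiset.map_map, Multiset.map_coe, Multiset.prod_coe] at h
      rw [h]
      congr 1
      rw [← Fin.prod_univ_fun_getElem]
      rw [← Fintype.prod_equiv (finCongr hlen.symm) _ _ (fun _ => rfl)]
      refine Finset.prod_congr rfl fun j _ => ?_
      simp
    intro X Y
    by_cases hY : Y = 0
    · subst hY; simp [sx]
    · have hXY : sx g1 g2 h0 h1 h2 h3 h4 X Y = Y ^ 6 * sx g1 g2 h0 h1 h2 h3 h4 (X / Y) 1 := by
        unfold sx; field_simp
      rw [hXY, hX1]
      have hpr : ∏ j : Fin 6, (X - l.get (j.cast hlen.symm) * Y) =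
          Y ^ 6 * ∏ j : Fin 6, (X / Y - l.get (j.cast hlen.symm)) := by
        have : Y ^ 6 = ∏ _j : Fin 6, Y := by simp
        rw [this, ← Finset.prod_mul_distrib]
        refine Finset.prod_congr rfl fun j _ => ?_
        field_simp
      rw [hpr]; ring

theorem zline {w u v q : Fin 3 → ℂ} (hw : w ≠ 0) (hu : dotv w u = 0) (hv : dotv w v = 0)
    (hq : dotv w q = 0) (hu0 : u ≠ 0) (hv0 : v ≠ 0) (huv : ¬ propor u v) :
    ∃ X Y : ℂ, q = X • u + Y • v := by
  have hli : LinearIndependent ℂ ![u, v] := by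
    rw [LinearIndependent.pair_iff]
    intro s t h
    by_cases hs : s = 0
    · subst hs
      rw [zero_smul, zero_add] at h
      exact ⟨rfl, (smul_eq_zero.mp h).resolve_right hv0⟩
    · exfalso
      have h1 : u = (-t / s) • v := by
        have h2 : s • u = (-t) • v := by rw [neg_smul]; exact eq_neg_of_add_eq_zero_left h
        rw [div_eq_inv_mul, mul_smul, ← h2, smul_smul, inv_mul_cancel₀ hs, one_smul]
      by_cases ht : t = 0
      · rw [ht] at h1; simp at h1; exact hu0 h1
      · exact huv ⟨-t / s, div_ne_zero (neg_ne_zero.mpr ht) hs, h1⟩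
  obtain ⟨O, hO⟩ := exists_det3 hli
  have hwO : dotv w O ≠ 0 := by
    intro h
    apply hw
    have hall : ∀ z, dotv w z = 0 := by
      intro z
      rw [coords hO z, dotv_add, dotv_add, dotv_smul, dotv_smul, dotv_smul, hu, hv, h]; ring
    funext i
    have := hall (Pi.single i 1)
    simpa [dotv, Pi.single_apply] using this
  have h1 := coords hO q
  have h2 : dotv w q = det3 u v q / det3 u v O * dotv w O := by
    conv_lhs => rw [h1]
    rw [dotv_add, dotv_add, dotv_smul, dotv_smul, dotv_smul, hu, hv]; ring
  rw [hq] at h2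
  have h3 := (mul_eq_zero.mp h2.symm).resolve_right hwO
  rw [h3, zero_smul, add_zero] at h1
  exact ⟨_, _, h1⟩

theorem zcoord {G H : P3} (hG : G.IsHomogeneous 3) (hH : H.IsHomogeneous 4) {w : Fin 3 → ℂ}
    (hw : w ≠ 0) {p : Fin 3 → Fin 3 → ℂ} (hpne : ∀ i, p i ≠ 0)
    (hponY : ∀ i, MvPolynomial.eval (p i) G = 0) (hponZ : ∀ i, dotv w (p i) = 0)
    (hdist : ∀ i j, i ≠ j → ¬ propor (p i) (p j))
    (hYZ : ∀ q : Fin 3 → ℂ, q ≠ 0 → dotv w q = 0 → MvPolynomial.eval q G = 0 →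
      ∃ i, propor q (p i))
    (hHp : ∀ i, MvPolynomial.eval (p i) H ≠ 0) :
    ∃ s : Fin 6 → Fin 3 → ℂ,
      (∀ j, s j ≠ 0 ∧ dotv w (s j) = 0 ∧ MvPolynomial.eval (s j) G ≠ 0) ∧
      ∀ (l : ℂ) (b O : Fin 3 → ℂ), b = p 1 + l • p 0 → det3 (p 0) (p 1) O ≠ 0 →
        ∃ κ : ℂ, κ ≠ 0 ∧ ∀ x : ℂ, sig G H b (p 0 + x • b) *
          MvPolynomial.eval (p 0 + x • b) G ^ 3 =
          κ * (∏ j, (det3 (p 0) (s j) O - det3 (s j) b O * x)) *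
            (∏ i, (det3 (p 0) (p i) O - det3 (p i) b O * x)) ^ 3 := by
  set u := p 0 with hu
  set v := p 1 with hv
  obtain ⟨X3, Y3, h3⟩ := zline hw (hponZ 0) (hponZ 1) (hponZ 2) (hpne 0) (hpne 1)
    (hdist 0 1 (by decide))
  rw [← hu, ← hv] at h3
  have hX3 : X3 ≠ 0 := by
    rintro rfl
    rw [zero_smul, zero_add] at h3
    refine hdist 2 1 (by decide) ⟨Y3, ?_, h3⟩
    rintro rfl
    rw [zero_smul] at h3; exact hpne 2 h3
  have hY3 : Y3 ≠ 0 := by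
    rintro rfl
    rw [zero_smul, add_zero] at h3
    exact hdist 2 0 (by decide) ⟨X3, hX3, h3⟩
  obtain ⟨c, hc⟩ := binform hG u v
  obtain ⟨k, hk⟩ := binform hH u v
  simp only [Finset.sum_range_succ, Finset.sum_range_zero] at hc hk
  norm_num at hc hk
  have hc0 : c 0 = 0 := by
    have := hc 1 0
    rw [one_smul, zero_smul, add_zero, hu, hponY 0] at this
    simpa using this.symm
  have hc3 : c 3 = 0 := by
    have := hc 0 1
    rw [one_smul, zero_smul, zero_add, hv, hponY 1] at this
    simpa using this.symm
  have hk0 : k 0 ≠ 0 := by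
    intro h
    have := hk 1 0
    rw [one_smul, zero_smul, add_zero, h] at this
    exact hHp 0 (by simpa using this)
  have hk4 : k 4 ≠ 0 := by
    intro h
    have := hk 0 1
    rw [one_smul, zero_smul, zero_add, h] at this
    exact hHp 1 (by simpa using this)
  have hrel : c 1 * X3 + c 2 * Y3 = 0 := by
    have := hc X3 Y3
    rw [← h3, hponY 2, hc0, hc3] at this
    have h5 : X3 * Y3 * (c 1 * X3 + c 2 * Y3) = 0 := by linear_combination -this
    exact (mul_eq_zero.mp h5).resolve_left (mul_ne_zero hX3 hY3)
  have hzne : ∀ X Y : ℂ, X ≠ 0 ∨ Y ≠ 0 → X • u + Y • v ≠ 0 := by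
    intro X Y hXY h
    by_cases hX : X = 0
    · subst hX
      rw [zero_smul, zero_add] at h
      rcases hXY with h' | h'
      · exact h' rfl
      · exact hpne 1 ((smul_eq_zero.mp h).resolve_left h')
    · have h1 : u = (-Y / X) • v := by
        have h2 : X • u = (-Y) • v := by rw [neg_smul]; exact eq_neg_of_add_eq_zero_left h
        rw [div_eq_inv_mul, mul_smul, ← h2, smul_smul, inv_mul_cancel₀ hX, one_smul]
      by_cases hY : Y = 0
      · rw [hY] at h1; simp at h1; exact hpne 0 h1
      · exact hdist 0 1 (by decide) ⟨-Y / X, div_ne_zero (neg_ne_zero.mpr hY) hX, h1⟩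
  have huniq : ∀ X Y X' Y' : ℂ, X • u + Y • v = X' • u + Y' • v → X = X' ∧ Y = Y' := by
    intro X Y X' Y' h
    by_contra hn
    refine hzne (X - X') (Y - Y') ?_ ?_
    · by_contra h'
      push Not at h'
      exact hn ⟨sub_eq_zero.mp h'.1, sub_eq_zero.mp h'.2⟩
    · rw [sub_smul, sub_smul]
      calc X • u - X' • u + (Y • v - Y' • v) = (X • u + Y • v) - (X' • u + Y' • v) := by abel
        _ = 0 := by rw [h, sub_self]
  have hc1 : c 1 ≠ 0 := by
    intro h1
    have h2 : c 2 = 0 := by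
      rw [h1, zero_mul, zero_add] at hrel
      exact (mul_eq_zero.mp hrel).resolve_right hY3
    obtain ⟨T, hT⟩ := Infinite.exists_notMem_finset ({0, Y3 / X3} : Finset ℂ)
    simp only [Finset.mem_insert, Finset.mem_singleton, not_or] at hT
    obtain ⟨i, m, hm, hi⟩ := hYZ ((1 : ℂ) • u + T • v) (hzne _ _ (Or.inl one_ne_zero))
      (by rw [dotv_add, dotv_smul, dotv_smul, hu, hv, hponZ, hponZ]; ring)
      (by rw [hc, hc0, hc3, h1, h2]; ring)
    fin_cases i
    · have h5 := huniq 1 T m 0 (by rw [hi]; simp [hu])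
      exact hT.1 h5.2
    · have h5 := huniq 1 T 0 m (by rw [hi]; simp [hv])
      exact one_ne_zero h5.1
    · have h5 := huniq 1 T (m * X3) (m * Y3) (by
        rw [hi]; simp only [Fin.reduceFinMk]; rw [h3, smul_add, smul_smul, smul_smul])
      apply hT.2
      rw [h5.2]
      field_simp
      linear_combination -h5.1
  have hc2 : c 2 ≠ 0 := by
    intro h
    rw [h, zero_mul, add_zero] at hrel
    exact mul_ne_zero hc1 hX3 hrel
  have hH3 : k 0 * X3 ^ 4 + k 1 * X3 ^ 3 * Y3 + k 2 * X3 ^ 2 * Y3 ^ 2 + k 3 * X3 * Y3 ^ 3 +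
      k 4 * Y3 ^ 4 ≠ 0 := by
    rw [← hk, ← h3]; exact hHp 2
  obtain ⟨T, hT0, hT⟩ := sx_fac (c 1) (c 2) (k 0) (k 1) (k 2) (k 3) (k 4) hc1 hk0
  refine ⟨fun j => T j • u + (1 : ℂ) • v, fun j => ⟨hzne _ _ (Or.inr one_ne_zero), ?_, ?_⟩, ?_⟩
  · rw [dotv_add, dotv_smul, dotv_smul, hu, hv, hponZ, hponZ]; ring
  · intro h
    rw [hc, hc0, hc3] at h
    have h5 : T j * (c 1 * T j + c 2) = 0 := by linear_combination h
    have h6 := hT0 j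
    rcases mul_eq_zero.mp h5 with h7 | h7
    · rw [h7] at h6
      simp [sx, hc2, hk4] at h6
    · have hTX : T j * Y3 = X3 := by
        have : c 1 * (T j * Y3 - X3) = 0 := by linear_combination Y3 * h7 - hrel
        exact sub_eq_zero.mp ((mul_eq_zero.mp this).resolve_left hc1)
      have hc2' : c 2 = - c 1 * T j := by linear_combination h7
      have h8 : 2 * c 1 ^ 2 * c 2 ^ 2 * (k 0 * X3 ^ 4 + k 1 * X3 ^ 3 * Y3 +
          k 2 * X3 ^ 2 * Y3 ^ 2 + k 3 * X3 * Y3 ^ 3 + k 4 * Y3 ^ 4) =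
          c 1 ^ 2 * Y3 ^ 4 * sx (c 1) (c 2) (k 0) (k 1) (k 2) (k 3) (k 4) (T j) 1 := by
        rw [← hTX, hc2', sx]; ring
      rw [h6, mul_zero] at h8
      exact mul_ne_zero (mul_ne_zero (mul_ne_zero two_ne_zero (pow_ne_zero _ hc1))
        (pow_ne_zero _ hc2)) hH3 h8
  · intro l b O hb hD
    set D := det3 u v O with hDd
    have hz : ∀ x : ℂ, u + x • b = (1 + l * x) • u + x • v := by
      intro x; rw [hb]; ext i; simp; ring
    have hg : ∀ x : ℂ, MvPolynomial.eval (u + x • b) G = Polynomial.eval x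
        (Polynomial.C (c 1) * (1 + Polynomial.C l * Polynomial.X) ^ 2 * Polynomial.X +
          Polynomial.C (c 2) * (1 + Polynomial.C l * Polynomial.X) * Polynomial.X ^ 2) := by
      intro x; rw [hz, hc, hc0, hc3]; simp
    have hh : ∀ x : ℂ, MvPolynomial.eval (u + x • b) H = Polynomial.eval x
        (Polynomial.C (k 0) * (1 + Polynomial.C l * Polynomial.X) ^ 4 +
          Polynomial.C (k 1) * (1 + Polynomial.C l * Polynomial.X) ^ 3 * Polynomial.X +
          Polynomial.C (k 2) * (1 + Polynomial.C l * Polynomial.X) ^ 2 * Polynomial.X ^ 2 +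
          Polynomial.C (k 3) * (1 + Polynomial.C l * Polynomial.X) * Polynomial.X ^ 3 +
          Polynomial.C (k 4) * Polynomial.X ^ 4) := by
      intro x; rw [hz, hk]; simp
    have hsig : ∀ x : ℂ, sig G H b (u + x • b) =
        sx (c 1) (c 2) (k 0) (k 1) (k 2) (k 3) (k 4) (1 + l * x) x := by
      intro x
      have hg1 := lr_deriv hg
      have hg2 := lr_deriv hg1
      have hh1 := lr_deriv hh
      have hh2 := lr_deriv hh1
      rw [sig, hg2, hh2, hg1, hh1, hg, hh, sx]
      simp only [Polynomial.derivative_add, Polynomial.derivative_mul, Polynomial.derivative_C,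
        Polynomial.derivative_X, Polynomial.derivative_X_pow, Polynomial.derivative_pow,
        Polynomial.derivative_one, Polynomial.eval_add, Polynomial.eval_mul, Polynomial.eval_C,
        Polynomial.eval_X, Polynomial.eval_pow, Polynomial.eval_one, Polynomial.eval_zero,
        Polynomial.derivative_zero]
      norm_num
      ring
    have hlin : ∀ X Y x : ℂ, det3 u (X • u + Y • v) O - det3 (X • u + Y • v) b O * x =
        D * (Y * (1 + l * x) - X * x) := by
      intro X Y x
      rw [hDd, hb]; simp [det3]; ring
    have e0 : p 0 = (1 : ℂ) • u + (0 : ℂ) • v := by simp [hu]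
    have e1 : p 1 = (0 : ℂ) • u + (1 : ℂ) • v := by simp [hv]
    refine ⟨2 * c 1 ^ 2 * k 0 * D⁻¹ ^ 6 * (- (c 1 / Y3) * D⁻¹ ^ 3) ^ 3, ?_, ?_⟩
    · have := inv_ne_zero hD
      have h6 : -(c 1 / Y3) ≠ 0 := neg_ne_zero.mpr (div_ne_zero hc1 hY3)
      simp [hc1, hk0, hD, hY3]
    · intro x
      rw [hsig, hg, hT, Fin.prod_univ_three, e0, e1, h3]
      simp only [hlin, Finset.prod_mul_distrib, Finset.prod_const, Finset.card_univ,
        Fintype.card_fin, one_mul, Polynomial.eval_add, Polynomial.eval_mul, Polynomial.eval_C,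
        Polynomial.eval_X, Polynomial.eval_pow, Polynomial.eval_one]
      have hc2' : c 2 = - c 1 * X3 / Y3 := by field_simp; linear_combination hrel
      rw [hc2']
      generalize (∏ j, (1 + l * x - T j * x)) = pr
      field_simp
      ring

end zcoord

section generic

theorem li_of_not_propor {u v : Fin 3 → ℂ} (hu0 : u ≠ 0) (hv0 : v ≠ 0) (huv : ¬ propor u v) :
    LinearIndependent ℂ ![u, v] := by
  rw [LinearIndependent.pair_iff]
  intro s t h
  by_cases hs : s = 0
  · subst hs
    rw [zero_smul, zero_add] at h
    exact ⟨rfl, (smul_eq_zero.mp h).resolve_right hv0⟩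
  · exfalso
    have h1 : u = (-(t / s)) • v := by
      have h2 : s • u = -(t • v) := eq_neg_of_add_eq_zero_left h
      have h3 := congrArg (fun z => s⁻¹ • z) h2
      simp only [smul_smul, inv_mul_cancel₀ hs, one_smul, smul_neg] at h3
      rw [h3, neg_smul, div_eq_inv_mul]
    by_cases ht : t = 0
    · subst ht
      rw [zero_div, neg_zero, zero_smul] at h1
      exact hu0 h1
    · exact huv ⟨_, neg_ne_zero.mpr (div_ne_zero ht hs), h1⟩

def crossv (p q : Fin 3 → ℂ) : Fin 3 → ℂ :=
  ![p 1 * q 2 - p 2 * q 1, p 2 * q 0 - p 0 * q 2, p 0 * q 1 - p 1 * q 0]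

theorem dotv_crossv (p q r : Fin 3 → ℂ) : dotv (crossv p q) r = det3 p q r := by
  simp [dotv, crossv, det3, Fin.sum_univ_three]; ring

theorem crossv_ne {u v : Fin 3 → ℂ} (hu0 : u ≠ 0) (hv0 : v ≠ 0) (huv : ¬ propor u v) :
    crossv u v ≠ 0 := by
  obtain ⟨r, hr⟩ := exists_det3 (li_of_not_propor hu0 hv0 huv)
  intro h
  rw [← dotv_crossv, h] at hr
  simp [dotv] at hr

theorem avoid (S : Set (Fin 3 → ℂ)) (hS : S.Countable) (h0 : ∀ g ∈ S, g ≠ 0) {z A B : Fin 3 → ℂ}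
    (hD : det3 z A B ≠ 0) (G : P3) (hG : MvPolynomial.eval z G ≠ 0) :
    ∃ O, (∀ g ∈ S, dotv g O ≠ 0) ∧ MvPolynomial.eval O G ≠ 0 := by
  set PG : Polynomial ℂ := MvPolynomial.aeval (fun i => Polynomial.C (z i) +
    Polynomial.C (A i) * Polynomial.X + Polynomial.C (B i) * Polynomial.X ^ 2) G with hPG
  have ePG : ∀ τ : ℂ, PG.eval τ = MvPolynomial.eval (z + τ • A + τ ^ 2 • B) G := by
    intro τ
    have h1 : PG.eval τ = (Polynomial.aeval τ).toRingHom PG := by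
      simp [Polynomial.coe_aeval_eq_eval]
    rw [h1, hPG]
    change (Polynomial.aeval τ) _ = _
    rw [← AlgHom.comp_apply, MvPolynomial.comp_aeval, MvPolynomial.aeval_eq_eval]
    congr 2
    funext i
    simp [Polynomial.coe_aeval_eq_eval]
    ring
  have hPG0 : PG ≠ 0 := by
    intro h
    have := ePG 0
    rw [h] at this
    simp at this
    exact hG this.symm
  set pg : (Fin 3 → ℂ) → Polynomial ℂ := fun g => Polynomial.C (dotv g z) +
    Polynomial.C (dotv g A) * Polynomial.X + Polynomial.C (dotv g B) * Polynomial.X ^ 2 with hpg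
  have hpg0 : ∀ g ∈ S, pg g ≠ 0 := by
    intro g hg h
    have c0 := congrArg (fun f => Polynomial.coeff f 0) h
    have c1 := congrArg (fun f => Polynomial.coeff f 1) h
    have c2 := congrArg (fun f => Polynomial.coeff f 2) h
    simp [hpg, Polynomial.coeff_X, Polynomial.coeff_C, Polynomial.coeff_X_pow] at c0 c1 c2
    exact h0 g hg (eq_zero_of_basis hD c0 c1 c2)
  have hc : ((⋃ g ∈ S, {τ | (pg g).IsRoot τ}) ∪ {τ | PG.IsRoot τ}).Countable := by
    refine Set.Countable.union (hS.biUnion fun g hg => ?_) ?_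
    · exact (Polynomial.finite_setOfPred_isRoot (hpg0 g hg)).countable
    · exact (Polynomial.finite_setOfPred_isRoot hPG0).countable
  have : ∃ τ, τ ∉ ((⋃ g ∈ S, {τ | (pg g).IsRoot τ}) ∪ {τ | PG.IsRoot τ}) := by
    by_contra h
    push Not at h
    exact not_countable_complex (hc.mono fun τ _ => h τ)
  obtain ⟨τ, hτ⟩ := this
  rw [Set.mem_union, not_or] at hτ
  refine ⟨z + τ • A + τ ^ 2 • B, ?_, ?_⟩
  · intro g hg h
    apply hτ.1
    refine Set.mem_biUnion hg ?_
    rw [Set.mem_ofPred_eq, Polynomial.IsRoot.def, ← h, hpg]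
    simp [dotv_add, dotv_smul]
    ring
  · rw [← ePG]
    exact hτ.2

theorem generic_choice {p0 p1 z : Fin 3 → ℂ} (hp0 : p0 ≠ 0) (hp1 : p1 ≠ 0)
    (hp : ¬ propor p0 p1) (hz : z ≠ 0) (hz0 : ¬ propor z p0) (G : P3)
    (hG : MvPolynomial.eval z G ≠ 0)
    (Qs : Set (Fin 3 → ℂ)) (hQ : Qs.Countable) (hQ0 : ∀ q ∈ Qs, q ≠ 0)
    (S : Set (Fin 3 → ℂ)) (hS : S.Countable) (h0 : ∀ g ∈ S, g ≠ 0) :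
    ∃ (l : ℂ) (O : Fin 3 → ℂ), det3 p0 p1 O ≠ 0 ∧ MvPolynomial.eval O G ≠ 0 ∧
      (∀ q ∈ Qs, det3 q (p1 + l • p0) O ≠ 0) ∧
      (∀ q ∈ Qs, ∀ q' ∈ Qs, ¬ propor q q' → det3 q q' O ≠ 0) ∧
      (∀ g ∈ S, dotv g O ≠ 0) := by
  have hli := (linInd_iff _ _).mp (li_of_not_propor hp0 hp1 hp)
  have hb0 : ∀ l : ℂ, p1 + l • p0 ≠ 0 := by
    intro l h
    have := hli l 1 (by rw [one_smul, add_comm]; exact h)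
    exact one_ne_zero this.2
  have hc : (⋃ q ∈ Qs, {l : ℂ | propor q (p1 + l • p0)}).Countable := by
    refine hQ.biUnion fun q hq => Set.Subsingleton.countable ?_
    rintro l ⟨c, hc, e⟩ l' ⟨c', hc', e'⟩
    have h1 : (c * l - c' * l') • p0 + (c - c') • p1 = 0 := by
      have := e.symm.trans e'
      rw [smul_add, smul_add, smul_smul, smul_smul] at this
      rw [sub_smul, sub_smul]
      linear_combination (exp := 1) this
    obtain ⟨h2, h3⟩ := hli _ _ h1
    have h4 : c = c' := sub_eq_zero.mp h3
    subst h4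
    exact mul_left_cancel₀ hc (sub_eq_zero.mp h2)
  have : ∃ l, l ∉ (⋃ q ∈ Qs, {l : ℂ | propor q (p1 + l • p0)}) := by
    by_contra h
    push Not at h
    exact not_countable_complex (hc.mono fun τ _ => h τ)
  obtain ⟨l, hl⟩ := this
  have hl' : ∀ q ∈ Qs, ¬ propor q (p1 + l • p0) := by
    intro q hq h
    exact hl (Set.mem_biUnion hq h)
  obtain ⟨B, hB⟩ := exists_det3 (li_of_not_propor hz hp0 hz0)
  have hcS : (S ∪ {crossv p0 p1} ∪ (fun q => crossv q (p1 + l • p0)) '' Qs ∪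
      {g | ∃ x ∈ Qs ×ˢ Qs, ¬ propor x.1 x.2 ∧ crossv x.1 x.2 = g}).Countable := by
    refine ((hS.union (Set.countable_singleton _)).union (hQ.image _)).union ?_
    refine ((hQ.prod hQ).image fun x => crossv x.1 x.2).mono ?_
    rintro g ⟨x, hx, -, rfl⟩
    exact ⟨x, hx, rfl⟩
  obtain ⟨O, hO1, hO2⟩ := avoid _ hcS (by
    rintro g (((hg | hg) | ⟨q, hq, rfl⟩) | ⟨x, hx, hx2, rfl⟩)
    · exact h0 g hg
    · rw [Set.mem_singleton_iff] at hg
      rw [hg]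
      exact crossv_ne hp0 hp1 hp
    · exact crossv_ne (hQ0 q hq) (hb0 l) (hl' q hq)
    · exact crossv_ne (hQ0 _ hx.1) (hQ0 _ hx.2) hx2) hB G hG
  refine ⟨l, O, ?_, hO2, ?_, ?_, ?_⟩
  · rw [← dotv_crossv]
    exact hO1 _ (Or.inl (Or.inl (Or.inr rfl)))
  · intro q hq
    rw [← dotv_crossv]
    exact hO1 _ (Or.inl (Or.inr ⟨q, hq, rfl⟩))
  · intro q hq q' hq' hne
    rw [← dotv_crossv]
    exact hO1 _ (Or.inr ⟨(q, q'), ⟨hq, hq'⟩, hne, rfl⟩)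
  · intro g hg
    exact hO1 _ (Or.inl (Or.inl (Or.inl hg)))

theorem cubic_enum {G : P3} (hG : IsSmoothCurve G 3) {w : Fin 3 → ℂ}
    (hw : w ≠ 0) {p : Fin 3 → Fin 3 → ℂ} (hpne : ∀ i, p i ≠ 0)
    (hponY : ∀ i, MvPolynomial.eval (p i) G = 0) (hponZ : ∀ i, dotv w (p i) = 0)
    (hdist : ∀ i j, i ≠ j → ¬ propor (p i) (p j)) {s : Fin 3 → ℂ} (hs : s ≠ 0)
    (hsZ : dotv w s = 0) (hsG : MvPolynomial.eval s G ≠ 0) :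
    ∃ m r, Enum G m r := by
  classical
  have hps : ¬ propor (p 0) s := by
    rintro ⟨c, hc, e⟩
    have := hponY 0
    rw [e, eval_scale hG.1] at this
    exact mul_ne_zero (pow_ne_zero _ hc) hsG this
  have h1 : ∀ i, ∃ X Y : ℂ, p i = X • p 0 + Y • s := fun i =>
    zline hw (hponZ 0) hsZ (hponZ i) (hpne 0) hs hps
  choose X Y hXY using h1
  have hX : ∀ i, X i ≠ 0 := by
    intro i h
    have e := hXY i
    rw [h, zero_smul, zero_add] at e
    have h2 := hponY i
    rw [e, eval_scale hG.1] at h2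
    have h3 : Y i = 0 := by
      rcases mul_eq_zero.mp h2 with h | h
      · exact pow_eq_zero_iff (by norm_num) |>.mp h
      · exact absurd h hsG
    rw [h3, zero_smul] at e
    exact hpne i e
  have hp' : ∀ i, p i = X i • (p 0 + (Y i / X i) • s) := by
    intro i
    rw [smul_add, smul_smul, mul_div_cancel₀ _ (hX i)]
    exact hXY i
  have hinj : Function.Injective (fun i => Y i / X i) := by
    intro i j hij
    by_contra hne
    apply hdist i j hne
    refine ⟨X i / X j, div_ne_zero (hX i) (hX j), ?_⟩
    conv_lhs => rw [hp' i]
    conv_rhs => rw [hp' j]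
    dsimp only at hij
    rw [hij, smul_smul, div_mul_cancel₀ _ (hX j)]
  obtain ⟨b, hb⟩ := exists_det3 (li_of_not_propor (hpne 0) hs hps)
  have hD : det3 (p 0) b s ≠ 0 := by
    have : det3 (p 0) b s = - det3 (p 0) s b := by simp [det3]; ring
    rw [this]
    exact neg_ne_zero.mpr hb
  have hN : Nres (p 0) b s G 3 ≠ 0 := by
    refine Nres_ne_of_split hG (by norm_num) hD hsG (Finset.univ.image fun i => Y i / X i) ?_ ?_
    · rw [Finset.card_image_of_injective _ hinj]; simp
    · intro y hy
      obtain ⟨i, -, rfl⟩ := Finset.mem_image.mp hy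
      have h2 := hponY i
      rw [hp' i, eval_scale hG.1] at h2
      exact (mul_eq_zero.mp h2).resolve_left (pow_ne_zero _ (hX i))
  obtain ⟨T, hT⟩ := finite_flex hG (by norm_num) hD hsG hN
  exact exists_enum hG.1 T hT

end generic

section compare

theorem rm_prod {ι : Type*} [Fintype ι] (α β : ι → ℂ) (hα : ∀ j, α j ≠ 0) {κ : ℂ} (hκ : κ ≠ 0)
    (y : ℂ) : (Polynomial.C κ * ∏ j, (Polynomial.C (β j) -
      Polynomial.C (α j) * Polynomial.X)).rootMultiplicity y = {j | β j = α j * y}.ncard := by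
  classical
  have hl : ∀ j, Polynomial.C (β j) - Polynomial.C (α j) * Polynomial.X =
      Polynomial.C (-(α j)) * (Polynomial.X - Polynomial.C (β j / α j)) := by
    intro j
    have : β j = α j * (β j / α j) := by rw [mul_div_cancel₀ _ (hα j)]
    conv_lhs => rw [this]
    rw [Polynomial.C_mul, Polynomial.C_neg]
    ring
  have hp : Polynomial.C κ * ∏ j, (Polynomial.C (β j) - Polynomial.C (α j) * Polynomial.X) =
      Polynomial.C (κ * ∏ j, (-(α j))) *
        ((Finset.univ : Finset ι).val.map fun j => Polynomial.X - Polynomial.C (β j / α j)).prod := by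
    simp_rw [hl]
    rw [Finset.prod_mul_distrib, Polynomial.C_mul, map_prod, mul_assoc]
    rfl
  have hc : κ * ∏ j, (-(α j)) ≠ 0 :=
    mul_ne_zero hκ (Finset.prod_ne_zero_iff.mpr fun j _ => neg_ne_zero.mpr (hα j))
  rw [hp, ← Polynomial.count_roots, Polynomial.roots_C_mul _ hc]
  have h3 : ((Finset.univ : Finset ι).val.map fun j => Polynomial.X - Polynomial.C (β j / α j)) =
      (((Finset.univ : Finset ι).val.map fun j => β j / α j).map
        fun a => Polynomial.X - Polynomial.C a) := by
    rw [Multiset.map_map]; rfl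
  rw [h3, Polynomial.roots_multiset_prod_X_sub_C, Multiset.count_map]
  have h4 : {j | β j = α j * y} = ((Finset.univ.filter fun j => y = β j / α j : Finset ι) : Set ι) := by
    ext j
    simp only [Set.mem_ofPred_eq, Finset.coe_filter, Finset.mem_univ, true_and]
    rw [eq_div_iff (hα j), eq_comm, mul_comm]
  rw [h4, Set.ncard_coe_finset]
  rfl

theorem eval_lin_prod {ι : Type*} [Fintype ι] (α β : ι → ℂ) (κ x : ℂ) :
    (Polynomial.C κ * ∏ j, (Polynomial.C (β j) - Polynomial.C (α j) * Polynomial.X)).eval x =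
      κ * ∏ j, (β j - α j * x) := by
  rw [Polynomial.eval_mul, Polynomial.eval_C, Polynomial.eval_prod]
  simp

theorem lin_prod_ne {ι : Type*} [Fintype ι] (α β : ι → ℂ) (hα : ∀ j, α j ≠ 0) {κ : ℂ}
    (hκ : κ ≠ 0) : Polynomial.C κ * ∏ j, (Polynomial.C (β j) -
      Polynomial.C (α j) * Polynomial.X) ≠ 0 := by
  refine mul_ne_zero (Polynomial.C_ne_zero.mpr hκ) (Finset.prod_ne_zero_iff.mpr fun j _ h => ?_)
  have := congrArg (fun f => Polynomial.coeff f 1) h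
  simp [Polynomial.coeff_C] at this
  exact hα j this

theorem limit_fac {ι ι' : Type*} [Fintype ι] [Fintype ι'] {α β : ℕ → ι → ℂ} {α0 β0 : ι → ℂ}
    {α' β' : ι' → ℂ} (hα : ∀ j, Tendsto (fun n => α n j) atTop (nhds (α0 j)))
    (hβ : ∀ j, Tendsto (fun n => β n j) atTop (nhds (β0 j))) (hα0 : ∀ j, α0 j ≠ 0)
    (hα' : ∀ i, α' i ≠ 0) {κ' : ℂ} (hκ' : κ' ≠ 0) (κ t : ℕ → ℂ) (f : ℕ → ℂ → ℂ)
    (hf : ∀ᶠ n in atTop, ∀ x, f n x = κ n * ∏ j, (β n j - α n j * x))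
    (hlim : ∀ x, κ' * ∏ i, (β' i - α' i * x) ≠ 0 →
      Tendsto (fun n => f n x / t n) atTop (nhds (κ' * ∏ i, (β' i - α' i * x)))) (y : ℂ) :
    {j | β0 j = α0 j * y}.ncard = {i | β' i = α' i * y}.ncard := by
  classical
  set P := Polynomial.C κ' * ∏ j, (Polynomial.C (β' j) - Polynomial.C (α' j) * Polynomial.X) with hP
  set R := Polynomial.C 1 * ∏ j, (Polynomial.C (β0 j) - Polynomial.C (α0 j) * Polynomial.X) with hR
  have hP0 : P ≠ 0 := lin_prod_ne _ _ hα' hκ'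
  have hR0 : R ≠ 0 := lin_prod_ne _ _ hα0 one_ne_zero
  have hPR : P * R ≠ 0 := mul_ne_zero hP0 hR0
  have hfinP : {x | P.IsRoot x}.Finite := Polynomial.finite_setOfPred_isRoot hP0
  obtain ⟨x0, hx0⟩ := (Polynomial.finite_setOfPred_isRoot hPR).infinite_compl.nonempty
  have hx0' : P.eval x0 ≠ 0 ∧ R.eval x0 ≠ 0 := by
    have : (P * R).eval x0 ≠ 0 := hx0
    rw [Polynomial.eval_mul] at this
    exact ⟨left_ne_zero_of_mul this, right_ne_zero_of_mul this⟩
  have hl : ∀ x, P.eval x ≠ 0 → Tendsto (fun n => f n x / t n) atTop (nhds (P.eval x)) := by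
    intro x hx
    rw [hP, eval_lin_prod] at hx ⊢
    exact hlim x hx
  have hprod : ∀ x, Tendsto (fun n => ∏ j, (β n j - α n j * x)) atTop (nhds (R.eval x)) := by
    intro x
    rw [hR, eval_lin_prod, one_mul]
    exact tendsto_finsetProd _ fun j _ => (hβ j).sub ((hα j).mul_const x)
  set K := P.eval x0 / R.eval x0 with hK
  have hK0 : K ≠ 0 := div_ne_zero hx0'.1 hx0'.2
  have hkt : Tendsto (fun n => κ n / t n) atTop (nhds K) := by
    refine Tendsto.congr' ?_ ((hl x0 hx0'.1).div (hprod x0) hx0'.2)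
    filter_upwards [hf, (hprod x0).eventually_ne hx0'.2] with n h1 h2
    rw [Pi.div_apply, h1 x0, div_div, mul_comm (t n), ← div_div, mul_div_assoc, div_self h2, mul_one]
  have heq : ∀ x, P.eval x ≠ 0 → P.eval x = (Polynomial.C K * R).eval x := by
    intro x hx
    have hKR : (Polynomial.C K * R).eval x = K * R.eval x := by
      rw [Polynomial.eval_mul (p := Polynomial.C K) (q := R), Polynomial.eval_C]
    rw [hKR]
    refine tendsto_nhds_unique (hl x hx) (Tendsto.congr' ?_ (hkt.mul (hprod x)))
    filter_upwards [hf] with n h1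
    rw [h1 x, div_mul_eq_mul_div]
  have hPK : P = Polynomial.C K * R := by
    refine Polynomial.eq_of_infinite_eval_eq _ _ (hfinP.infinite_compl.mono ?_)
    intro x hx
    exact heq x hx
  have hPK' : P = Polynomial.C K * ∏ j, (Polynomial.C (β0 j) -
      Polynomial.C (α0 j) * Polynomial.X) := by
    rw [hPK, hR, Polynomial.C_1, one_mul]
  rw [← rm_prod α0 β0 hα0 hK0 y, ← rm_prod α' β' hα' hκ' y, ← hPK']

theorem plucker (a b O q r : Fin 3 → ℂ) : det3 a q O * det3 r b O - det3 a r O * det3 q b O =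
    -(det3 a b O * det3 q r O) := by
  simp only [det3]; ring

theorem x_eq_iff {a b O q r : Fin 3 → ℂ} (hD : det3 a b O ≠ 0) (hr : det3 r b O ≠ 0)
    (hg : ¬ propor q r → det3 q r O ≠ 0) :
    det3 a q O = det3 q b O * (det3 a r O / det3 r b O) ↔ propor q r := by
  have hpl := plucker a b O q r
  rw [mul_div_assoc', eq_div_iff hr]
  have h1 : det3 a q O * det3 r b O = det3 q b O * det3 a r O ↔ det3 q r O = 0 := by
    constructor
    · intro h
      rw [h, mul_comm, sub_self] at hpl
      exact (mul_eq_zero.mp (neg_eq_zero.mp hpl.symm)).resolve_left hD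
    · intro h
      rw [h] at hpl
      simp only [mul_zero, neg_zero] at hpl
      rw [sub_eq_zero] at hpl
      rw [hpl, mul_comm]
  rw [h1]
  constructor
  · intro h
    by_contra h2
    exact hg h2 h
  · rintro ⟨c, hc, rfl⟩
    simp [det3]; ring

end compare

section sequences

structure Dat (G : P3) (w : Fin 3 → ℂ) (p : Fin 3 → Fin 3 → ℂ) (P : ℕ → P3) (N : ℕ)
    (s : Fin 6 → Fin 3 → ℂ) (m : ℕ) (r : Fin m → Fin 3 → ℂ) : Prop where
  hG : IsSmoothCurve G 3
  hw : w ≠ 0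
  hpne : ∀ i, p i ≠ 0
  hponY : ∀ i, MvPolynomial.eval (p i) G = 0
  hponZ : ∀ i, dotv w (p i) = 0
  hdist : ∀ i j, i ≠ j → ¬ propor (p i) (p j)
  hP : P 0 = linForm w * G
  hom : ∀ t, (fam P (N + 2) t).IsHomogeneous 4
  hr : Enum G m r
  hs : ∀ j, s j ≠ 0 ∧ dotv w (s j) = 0 ∧ MvPolynomial.eval (s j) G ≠ 0
  hz : ∀ (l : ℂ) (b O : Fin 3 → ℂ), b = p 1 + l • p 0 → det3 (p 0) (p 1) O ≠ 0 →
    ∃ κ : ℂ, κ ≠ 0 ∧ ∀ x : ℂ, sig G (P 1) b (p 0 + x • b) * MvPolynomial.eval (p 0 + x • b) G ^ 3 =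
      κ * (∏ j, (det3 (p 0) (s j) O - det3 (s j) b O * x)) *
        (∏ i, (det3 (p 0) (p i) O - det3 (p i) b O * x)) ^ 3

def LL (s : Fin 6 → Fin 3 → ℂ) (p : Fin 3 → Fin 3 → ℂ) {m : ℕ} (r : Fin m → Fin 3 → ℂ) :
    Fin 6 ⊕ ((Fin 3 × Fin 3) ⊕ Fin m) → Fin 3 → ℂ :=
  Sum.elim s (Sum.elim (fun x => p x.1) r)

theorem LL_ne {G : P3} {w : Fin 3 → ℂ} {p : Fin 3 → Fin 3 → ℂ} {P : ℕ → P3} {N : ℕ}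
    {s : Fin 6 → Fin 3 → ℂ} {m : ℕ} {r : Fin m → Fin 3 → ℂ} (D : Dat G w p P N s m r)
    (i) : LL s p r i ≠ 0 := by
  rcases i with j | ⟨i, k⟩ | j
  · exact (D.hs j).1
  · exact D.hpne i
  · exact (enum_fw D.hr j).1

theorem det_b {p0 p1 O : Fin 3 → ℂ} (l : ℂ) : det3 p0 (p1 + l • p0) O = det3 p0 p1 O := by
  simp [det3]; ring

theorem limP {G : P3} {w : Fin 3 → ℂ} {p : Fin 3 → Fin 3 → ℂ} {P : ℕ → P3} {N : ℕ}
    {s : Fin 6 → Fin 3 → ℂ} {m : ℕ} {r : Fin m → Fin 3 → ℂ} (D : Dat G w p P N s m r)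
    {l : ℂ} {O : Fin 3 → ℂ} (hD : det3 (p 0) (p 1) O ≠ 0) (hO : MvPolynomial.eval O G ≠ 0)
    (h1 : ∀ j, det3 (r j) (p 1 + l • p 0) O ≠ 0)
    (h2 : ∀ j j', ¬ propor (r j) (r j') → det3 (r j) (r j') O ≠ 0)
    (h3 : ∀ j, dotv (gradVec G (r j)) O ≠ 0) :
    dotv w O ≠ 0 ∧ ∃ κ : ℂ, κ ≠ 0 ∧ ∀ t : ℕ → ℂ, Tendsto t atTop (nhds 0) → (∀ n, t n ≠ 0) → ∀ x : ℂ,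
      κ * ∏ i, (det3 (p 0) (LL s p r i) O - det3 (LL s p r i) (p 1 + l • p 0) O * x) ≠ 0 →
      Tendsto (fun n => (Nres (p 0) (p 1 + l • p 0) O (fam P (N + 2) (t n)) 4).eval x / t n) atTop
        (nhds (κ * ∏ i, (det3 (p 0) (LL s p r i) O -
          det3 (LL s p r i) (p 1 + l • p 0) O * x))) := by
  set b := p 1 + l • p 0 with hb
  have hD' : det3 (p 0) b O ≠ 0 := by rw [hb, det_b]; exact hD
  have hwO : dotv w O ≠ 0 := fun h =>
    D.hw (eq_zero_of_basis hD (D.hponZ 0) (D.hponZ 1) h)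
  have hwb : dotv w b = 0 := by
    rw [hb, dotv_add, dotv_smul, D.hponZ 0, D.hponZ 1]; simp
  obtain ⟨κ1, hκ1, e1⟩ := D.hz l b O hb hD
  obtain ⟨κ2, hκ2, e2⟩ := Nfac D.hG (by norm_num) hD' hO D.hr h1 h2
    (fun j => by rw [← dotv_grad]; exact h3 j)
  have e3 : ∀ x : ℂ, (Nres (p 0) b O G 3).eval x =
      κ2 * ∏ j, (det3 (p 0) (r j) O - det3 (r j) b O * x) := by
    intro x
    rw [e2, eval_lin_prod]
  refine ⟨hwO, -(dotv w O) ^ 19 * κ1 * κ2, mul_ne_zero (mul_ne_zero (neg_ne_zero.mpr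
    (pow_ne_zero _ hwO)) hκ1) hκ2, ?_⟩
  intro t ht ht0 x hx
  have e4 : (-(dotv w O) ^ 19 * κ1 * κ2) * ∏ i, (det3 (p 0) (LL s p r i) O -
      det3 (LL s p r i) b O * x) = -(dotv w O) ^ 19 * (sig G (P 1) b (p 0 + x • b) *
        MvPolynomial.eval (p 0 + x • b) G ^ 3 * (Nres (p 0) b O G 3).eval x) := by
    rw [e1, e3, Fintype.prod_sum_type, Fintype.prod_sum_type, Fintype.prod_prod_type]
    simp only [LL, Sum.elim_inl, Sum.elim_inr, Finset.prod_const, Finset.card_univ,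
      Fintype.card_fin, Finset.prod_pow]
    ring
  rw [e4] at hx ⊢
  refine Nlim D.hG.1 (D.hponZ 0) hwb hwO hO P N D.hP ht ht0 (fun n => D.hom _) x ?_
  intro h
  rw [h] at hx
  simp at hx

theorem setup_generic {G : P3} {w : Fin 3 → ℂ} {p : Fin 3 → Fin 3 → ℂ} {P : ℕ → P3} {N : ℕ}
    {s : Fin 6 → Fin 3 → ℂ} {m : ℕ} {r : Fin m → Fin 3 → ℂ} (D : Dat G w p P N s m r)
    (Qs : Set (Fin 3 → ℂ)) (hQ : Qs.Countable) (hQ0 : ∀ q ∈ Qs, q ≠ 0)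
    (S : Set (Fin 3 → ℂ)) (hS : S.Countable) (h0 : ∀ g ∈ S, g ≠ 0) :
    ∃ (l : ℂ) (O : Fin 3 → ℂ), det3 (p 0) (p 1) O ≠ 0 ∧ MvPolynomial.eval O G ≠ 0 ∧
      (∀ q ∈ Qs, det3 q (p 1 + l • p 0) O ≠ 0) ∧
      (∀ q ∈ Qs, ∀ q' ∈ Qs, ¬ propor q q' → det3 q q' O ≠ 0) ∧
      (∀ g ∈ S, dotv g O ≠ 0) := by
  refine generic_choice (D.hpne 0) (D.hpne 1) (D.hdist 0 1 (by decide)) (D.hs 0).1 ?_ G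
    (D.hs 0).2.2 Qs hQ hQ0 S hS h0
  rintro ⟨c, hc, e⟩
  apply (D.hs 0).2.2
  rw [e, eval_scale D.hG.1, D.hponY 0, mul_zero]

theorem eval_fam_ne {G : P3} {w : Fin 3 → ℂ} {p : Fin 3 → Fin 3 → ℂ} {P : ℕ → P3} {N : ℕ}
    {s : Fin 6 → Fin 3 → ℂ} {m : ℕ} {r : Fin m → Fin 3 → ℂ} (D : Dat G w p P N s m r)
    {O : Fin 3 → ℂ} (hO : MvPolynomial.eval O G ≠ 0) (hw : dotv w O ≠ 0) {t : ℕ → ℂ}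
    (ht : Tendsto t atTop (nhds 0)) :
    ∀ᶠ n in atTop, MvPolynomial.eval O (fam P (N + 2) (t n)) ≠ 0 := by
  have h := eval_fam_tendsto P (N + 1) ht (tendsto_const_nhds (x := O))
  rw [D.hP, map_mul, eval_linForm] at h
  exact h.eventually_ne (mul_ne_zero hw hO)

theorem grad_ne {F : P3} {d : ℕ} (hF : IsSmoothCurve F d) {k : ℕ} {q : Fin k → Fin 3 → ℂ}
    (hE : Enum F k q) (j : Fin k) : gradVec F (q j) ≠ 0 :=
  smooth_grad hF (enum_fw hE j).1 (fw_zero (enum_fw hE j).2)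

theorem LL_generic {G : P3} {w : Fin 3 → ℂ} {p : Fin 3 → Fin 3 → ℂ} {P : ℕ → P3} {N : ℕ}
    {s : Fin 6 → Fin 3 → ℂ} {m : ℕ} {r : Fin m → Fin 3 → ℂ} (D : Dat G w p P N s m r)
    (Qs : Set (Fin 3 → ℂ)) (hQ : Qs.Countable) (hQ0 : ∀ q ∈ Qs, q ≠ 0)
    (S : Set (Fin 3 → ℂ)) (hS : S.Countable) (h0 : ∀ g ∈ S, g ≠ 0) :
    ∃ (l : ℂ) (O : Fin 3 → ℂ), det3 (p 0) (p 1) O ≠ 0 ∧ MvPolynomial.eval O G ≠ 0 ∧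
      dotv w O ≠ 0 ∧
      (∀ q ∈ Qs, det3 q (p 1 + l • p 0) O ≠ 0) ∧
      (∀ q ∈ Qs, ∀ q' ∈ Qs, ¬ propor q q' → det3 q q' O ≠ 0) ∧
      (∀ g ∈ S, dotv g O ≠ 0) ∧
      (∀ i, det3 (LL s p r i) (p 1 + l • p 0) O ≠ 0) ∧
      (∀ i, ∀ q ∈ Qs, ¬ propor (LL s p r i) q → det3 (LL s p r i) q O ≠ 0) ∧
      ∃ κ : ℂ, κ ≠ 0 ∧ ∀ t : ℕ → ℂ, Tendsto t atTop (nhds 0) → (∀ n, t n ≠ 0) → ∀ x : ℂ,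
      κ * ∏ i, (det3 (p 0) (LL s p r i) O - det3 (LL s p r i) (p 1 + l • p 0) O * x) ≠ 0 →
      Tendsto (fun n => (Nres (p 0) (p 1 + l • p 0) O (fam P (N + 2) (t n)) 4).eval x / t n) atTop
        (nhds (κ * ∏ i, (det3 (p 0) (LL s p r i) O -
          det3 (LL s p r i) (p 1 + l • p 0) O * x))) := by
  obtain ⟨l, O, g1, g2, g3, g4, g5⟩ := setup_generic D (Qs ∪ Set.range (LL s p r))
    (hQ.union (Set.countable_range _)) (by
      rintro q (hq | ⟨i, rfl⟩)
      · exact hQ0 q hq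
      · exact LL_ne D i) (S ∪ Set.range fun j => gradVec G (r j))
    (hS.union (Set.countable_range _)) (by
      rintro q (hq | ⟨i, rfl⟩)
      · exact h0 q hq
      · exact grad_ne D.hG D.hr i)
  have hL : ∀ i, LL s p r i ∈ Qs ∪ Set.range (LL s p r) := fun i => Or.inr ⟨i, rfl⟩
  have hr : ∀ j, r j ∈ Qs ∪ Set.range (LL s p r) := fun j => hL (Sum.inr (Sum.inr j))
  obtain ⟨k1, k2⟩ := limP D (l := l) g1 g2 (fun j => g3 _ (hr j)) (fun j j' => g4 _ (hr j) _ (hr j'))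
    (fun j => g5 _ (Or.inr ⟨j, rfl⟩))
  exact ⟨l, O, g1, g2, k1, fun q hq => g3 q (Or.inl hq),
    fun q hq q' hq' => g4 q (Or.inl hq) q' (Or.inl hq'), fun g hg => g5 g (Or.inl hg),
    fun i => g3 _ (hL i), fun i q hq => g4 _ (hL i) q (Or.inl hq), k2⟩

theorem ev_enum {G : P3} {w : Fin 3 → ℂ} {p : Fin 3 → Fin 3 → ℂ} {P : ℕ → P3} {N : ℕ}
    {s : Fin 6 → Fin 3 → ℂ} {m : ℕ} {r : Fin m → Fin 3 → ℂ} (D : Dat G w p P N s m r)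
    {t : ℕ → ℂ} (ht : Tendsto t atTop (nhds 0)) (ht0 : ∀ n, t n ≠ 0)
    (hsm : ∀ n, IsSmoothCurve (fam P (N + 2) (t n)) 4) :
    ∀ᶠ n in atTop, ∃ k q, Enum (fam P (N + 2) (t n)) k q := by
  obtain ⟨l, O, g1, g2, gw, -, -, -, g3, -, κ, hκ, hlim⟩ := LL_generic D ∅ Set.countable_empty
    (by simp) ∅ Set.countable_empty (by simp)
  have hne := lin_prod_ne _ (fun i => det3 (p 0) (LL s p r i) O) g3 hκ
  obtain ⟨x, hx⟩ := (Polynomial.finite_setOfPred_isRoot hne).infinite_compl.nonempty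
  have hx' : ¬ (_ = _) := hx
  rw [eval_lin_prod] at hx'
  have hl := hlim t ht ht0 x hx'
  filter_upwards [hl.eventually_ne hx', eval_fam_ne D g2 gw ht] with n h1 h2
  have hN : Nres (p 0) (p 1 + l • p 0) O (fam P (N + 2) (t n)) 4 ≠ 0 := by
    intro h
    rw [h] at h1
    simp at h1
  obtain ⟨T, hT⟩ := finite_flex (hsm n) (by norm_num) (by rw [det_b]; exact g1) h2 hN
  exact exists_enum (hsm n).1 T hT

theorem bdd_enum {G : P3} {w : Fin 3 → ℂ} {p : Fin 3 → Fin 3 → ℂ} {P : ℕ → P3} {N : ℕ}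
    {s : Fin 6 → Fin 3 → ℂ} {m : ℕ} {r : Fin m → Fin 3 → ℂ} (D : Dat G w p P N s m r)
    {t : ℕ → ℂ} (ht : Tendsto t atTop (nhds 0))
    (hsm : ∀ n, IsSmoothCurve (fam P (N + 2) (t n)) 4) (k : ℕ → ℕ)
    (q : ∀ n, Fin (k n) → Fin 3 → ℂ) (hE : ∀ n, Enum (fam P (N + 2) (t n)) (k n) (q n)) :
    ∀ᶠ n in atTop, k n ≤ 144 := by
  obtain ⟨l, O, g1, g2, gw, g3, g4, g5, -, -, -⟩ := LL_generic D
    (Set.range fun x : Σ n, Fin (k n) => q x.1 x.2) (Set.countable_range _)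
    (by rintro _ ⟨x, rfl⟩; exact (enum_fw (hE x.1) x.2).1)
    (Set.range fun x : Σ n, Fin (k n) => gradVec (fam P (N + 2) (t x.1)) (q x.1 x.2))
    (Set.countable_range _)
    (by rintro _ ⟨x, rfl⟩; exact grad_ne (hsm x.1) (hE x.1) x.2)
  filter_upwards [eval_fam_ne D g2 gw ht] with n h2
  have hα : ∀ j, det3 (q n j) (p 1 + l • p 0) O ≠ 0 := fun j => g3 _ ⟨⟨n, j⟩, rfl⟩
  obtain ⟨κ, hκ, e⟩ := Nfac (hsm n) (by norm_num) (a := p 0) (b := p 1 + l • p 0)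
    (by rw [det_b]; exact g1) h2 (hE n) hα
    (fun j j' => g4 _ ⟨⟨n, j⟩, rfl⟩ _ ⟨⟨n, j'⟩, rfl⟩)
    (fun j => by rw [← dotv_grad]; exact g5 _ ⟨⟨n, j⟩, rfl⟩)
  exact Nfac_card (hsm n).1 (by norm_num) _ _ _ hα hκ e

theorem cycle_limit {G : P3} {w : Fin 3 → ℂ} {p : Fin 3 → Fin 3 → ℂ} {P : ℕ → P3} {N : ℕ}
    {s : Fin 6 → Fin 3 → ℂ} {m : ℕ} {r : Fin m → Fin 3 → ℂ} (D : Dat G w p P N s m r)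
    {t : ℕ → ℂ} (ht : Tendsto t atTop (nhds 0)) (ht0 : ∀ n, t n ≠ 0)
    (hsm : ∀ n, IsSmoothCurve (fam P (N + 2) (t n)) 4) {k : ℕ}
    {q : ℕ → Fin k → Fin 3 → ℂ} (hE : ∀ n, Enum (fam P (N + 2) (t n)) k (q n))
    {q0 : Fin k → Fin 3 → ℂ} (hq : Tendsto q atTop (nhds q0)) (x : Fin 3 → ℂ) (hx : x ≠ 0) :
    {j | propor (q0 j) x}.ncard = {i | propor (LL s p r i) x}.ncard := by
  have hqj : ∀ j, Tendsto (fun n => q n j) atTop (nhds (q0 j)) := fun j =>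
    (tendsto_pi_nhds.mp hq) j
  have hq00 : ∀ j, q0 j ≠ 0 := by
    intro j h
    have h1 := (hqj j).norm
    simp_rw [fun n => (hE n).1 j] at h1
    rw [h, norm_zero] at h1
    exact one_ne_zero (tendsto_nhds_unique tendsto_const_nhds h1)
  obtain ⟨l, O, g1, g2, gw, g3, g4, g5, g6, g7, κ, hκ, hlim⟩ := LL_generic D
    (({x} ∪ Set.range q0) ∪ Set.range fun x : ℕ × Fin k => q x.1 x.2)
    (((Set.countable_singleton _).union (Set.countable_range _)).union (Set.countable_range _))
    (by
      rintro _ ((h | ⟨j, rfl⟩) | ⟨x, rfl⟩)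
      · rw [Set.mem_singleton_iff] at h
        rw [h]; exact hx
      · exact hq00 j
      · exact (enum_fw (hE x.1) x.2).1)
    (Set.range fun x : ℕ × Fin k => gradVec (fam P (N + 2) (t x.1)) (q x.1 x.2))
    (Set.countable_range _)
    (by rintro _ ⟨x, rfl⟩; exact grad_ne (hsm x.1) (hE x.1) x.2)
  have mq : ∀ n j, q n j ∈ (({x} ∪ Set.range q0) ∪ Set.range fun x : ℕ × Fin k => q x.1 x.2) :=
    fun n j => Or.inr ⟨(n, j), rfl⟩
  have mq0 : ∀ j, q0 j ∈ (({x} ∪ Set.range q0) ∪ Set.range fun x : ℕ × Fin k => q x.1 x.2) :=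
    fun j => Or.inl (Or.inr ⟨j, rfl⟩)
  have mx : x ∈ (({x} ∪ Set.range q0) ∪ Set.range fun x : ℕ × Fin k => q x.1 x.2) :=
    Or.inl (Or.inl rfl)
  set b := p 1 + l • p 0 with hb
  have hD' : det3 (p 0) b O ≠ 0 := by rw [hb, det_b]; exact g1
  have hκn : ∀ n, ∃ κ' : ℂ, MvPolynomial.eval O (fam P (N + 2) (t n)) ≠ 0 →
      ∀ x, (Nres (p 0) b O (fam P (N + 2) (t n)) 4).eval x =
        κ' * ∏ j, (det3 (p 0) (q n j) O - det3 (q n j) b O * x) := by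
    intro n
    by_cases h : MvPolynomial.eval O (fam P (N + 2) (t n)) ≠ 0
    · obtain ⟨κ', -, e⟩ := Nfac (hsm n) (by norm_num) hD' h (hE n) (fun j => g3 _ (mq n j))
        (fun j j' => g4 _ (mq n j) _ (mq n j'))
        (fun j => by rw [← dotv_grad]; exact g5 _ ⟨(n, j), rfl⟩)
      refine ⟨κ', fun _ x => ?_⟩
      rw [e, eval_lin_prod]
    · exact ⟨0, fun h' => absurd h' h⟩
  choose κn hκn using hκn
  have c1 : ∀ u v : Fin 3 → ℂ, Continuous fun z : Fin 3 → ℂ => det3 u z v := by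
    intro u v; unfold det3; fun_prop
  have c2 : ∀ u v : Fin 3 → ℂ, Continuous fun z : Fin 3 → ℂ => det3 z u v := by
    intro u v; unfold det3; fun_prop
  have key := limit_fac (α := fun n j => det3 (q n j) b O) (β := fun n j => det3 (p 0) (q n j) O)
    (α0 := fun j => det3 (q0 j) b O) (β0 := fun j => det3 (p 0) (q0 j) O)
    (α' := fun i => det3 (LL s p r i) b O) (β' := fun i => det3 (p 0) (LL s p r i) O)
    (fun j => ((c2 b O).tendsto _).comp (hqj j)) (fun j => ((c1 (p 0) O).tendsto _).comp (hqj j))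
    (fun j => g3 _ (mq0 j)) g6 hκ κn t
    (fun n x => (Nres (p 0) b O (fam P (N + 2) (t n)) 4).eval x)
    (by
      filter_upwards [eval_fam_ne D g2 gw ht] with n h2
      exact hκn n h2) (hlim t ht ht0) (det3 (p 0) x O / det3 x b O)
  have s1 : {j | propor (q0 j) x} = {j | det3 (p 0) (q0 j) O =
      det3 (q0 j) b O * (det3 (p 0) x O / det3 x b O)} := by
    ext j
    exact (x_eq_iff hD' (g3 _ mx) (g4 _ (mq0 j) _ mx)).symm
  have s2 : {i | propor (LL s p r i) x} = {i | det3 (p 0) (LL s p r i) O =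
      det3 (LL s p r i) b O * (det3 (p 0) x O / det3 x b O)} := by
    ext j
    exact (x_eq_iff hD' (g3 _ mx) (g7 j _ mx)).symm
  rw [s1, s2]
  exact key

open Classical in
def indic (A : Prop) : ℕ := if A then 1 else 0

theorem nc {ι : Type*} [Fintype ι] (A : ι → Prop) :
    {i | A i}.ncard = ∑ i, indic (A i) := by
  classical
  rw [Set.ncard_eq_toFinset_card', Set.toFinset_ofPred, Finset.card_filter]
  refine Finset.sum_congr rfl fun i _ => ?_
  unfold indic
  congr

theorem LL_count {G : P3} {w : Fin 3 → ℂ} {p : Fin 3 → Fin 3 → ℂ} {P : ℕ → P3} {N : ℕ}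
    {s : Fin 6 → Fin 3 → ℂ} {m : ℕ} {r : Fin m → Fin 3 → ℂ} (D : Dat G w p P N s m r)
    (x : Fin 3 → ℂ) (hx : x ≠ 0) : {i | propor (LL s p r i) x}.ncard =
      flexWeightAt G x + {j : Fin 6 | propor (s j) x}.ncard +
          3 * {i : Fin 3 | propor (p i) x}.ncard := by
  classical
  rw [D.hr.2 x hx]
  simp only [nc]
  rw [Fintype.sum_sum_type, Fintype.sum_sum_type, Fintype.sum_prod_type]
  simp only [LL, Sum.elim_inl, Sum.elim_inr, Fin.sum_univ_three]
  ring

end sequences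

section assembly

theorem far_line {L x : Fin 3 → ℂ} (hx : x ≠ 0) (h : ¬ propor L x) :
    ∀ᶠ ε in nhdsWithin (0 : ℝ) (Set.Ioi 0), ∀ c : ℂ, 2 * ε ≤ ‖c • L - x‖ := by
  have hcl : IsClosed ((Submodule.span ℂ {L} : Submodule ℂ (Fin 3 → ℂ)) : Set (Fin 3 → ℂ)) :=
    Submodule.closed_of_finiteDimensional _
  have hnot : x ∉ ((Submodule.span ℂ {L} : Submodule ℂ (Fin 3 → ℂ)) : Set (Fin 3 → ℂ)) := by
    intro hm
    obtain ⟨c, hc⟩ := Submodule.mem_span_singleton.mp hm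
    have hc0 : c ≠ 0 := by
      rintro rfl
      rw [zero_smul] at hc
      exact hx hc.symm
    exact h (propor_symm ⟨c, hc0, hc.symm⟩)
  obtain ⟨δ, hδ, hb⟩ := Metric.isOpen_iff.mp hcl.isOpen_compl x hnot
  have h1 : ∀ᶠ ε in nhdsWithin (0 : ℝ) (Set.Ioi 0), ε < δ / 2 :=
    nhdsWithin_le_nhds (Iio_mem_nhds (by positivity))
  filter_upwards [h1] with ε hε c
  by_contra hlt
  push Not at hlt
  have : c • L ∈ Metric.ball x δ := by
    rw [Metric.mem_ball, dist_eq_norm]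
    linarith
  exact hb this (Submodule.mem_span_singleton.mpr ⟨c, rfl⟩)

theorem near_ev {q : ℕ → Fin 3 → ℂ} {q0 x : Fin 3 → ℂ} (hq : Tendsto q atTop (nhds q0))
    (h : propor q0 x) {ε : ℝ} (hε : 0 < ε) : ∀ᶠ n in atTop, projNear ε (q n) x := by
  obtain ⟨c, hc, e⟩ := propor_symm h
  have h1 : Tendsto (fun n => ‖c • q n - x‖) atTop (nhds 0) := by
    have := ((hq.const_smul c).sub_const x).norm
    rw [← e, sub_self, norm_zero] at this
    exact this
  filter_upwards [h1.eventually (Iio_mem_nhds hε)] with n hn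
  exact ⟨c, hn⟩

theorem far_ev {q : ℕ → Fin 3 → ℂ} {q0 x : Fin 3 → ℂ} (hq : Tendsto q atTop (nhds q0))
    (hn1 : ∀ n, ‖q n‖ = 1) {ε : ℝ} (hε : 0 < ε) (h : ∀ c : ℂ, 2 * ε ≤ ‖c • q0 - x‖) :
    ∀ᶠ n in atTop, ¬ projNear ε (q n) x := by
  have h1 : Tendsto (fun n => (‖x‖ + ε) * ‖q0 - q n‖) atTop (nhds 0) := by
    have := ((hq.const_sub q0).norm).const_mul (‖x‖ + ε)
    rw [sub_self, norm_zero, mul_zero] at this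
    exact this
  filter_upwards [h1.eventually (Iio_mem_nhds hε)] with n hn
  rintro ⟨c, hc⟩
  have hcn : ‖c‖ ≤ ‖x‖ + ε := by
    have e1 : ‖c • q n‖ = ‖c‖ := by rw [norm_smul, hn1, mul_one]
    have e2 : ‖c • q n‖ ≤ ‖c • q n - x‖ + ‖x‖ := by
      have := norm_add_le (c • q n - x) x
      rwa [sub_add_cancel] at this
    linarith
  have e3 : c • q0 - x = c • (q0 - q n) + (c • q n - x) := by
    rw [smul_sub]; abel
  have e4 := h c
  have e5 : ‖c • q0 - x‖ ≤ ‖c‖ * ‖q0 - q n‖ + ‖c • q n - x‖ := by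
    rw [e3, ← norm_smul]
    exact norm_add_le _ _
  have e6 : ‖c‖ * ‖q0 - q n‖ ≤ (‖x‖ + ε) * ‖q0 - q n‖ :=
    mul_le_mul_of_nonneg_right hcn (norm_nonneg _)
  have e7 : (‖x‖ + ε) * ‖q0 - q n‖ < ε := hn
  linarith

theorem seq_limit {G : P3} {w : Fin 3 → ℂ} {p : Fin 3 → Fin 3 → ℂ} {P : ℕ → P3} {N : ℕ}
    {s : Fin 6 → Fin 3 → ℂ} {m : ℕ} {r : Fin m → Fin 3 → ℂ} (D : Dat G w p P N s m r)
    {t : ℕ → ℂ} (ht : Tendsto t atTop (nhds 0)) (ht0 : ∀ n, t n ≠ 0)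
    (hsm : ∀ n, IsSmoothCurve (fam P (N + 2) (t n)) 4) {x : Fin 3 → ℂ} (hx : x ≠ 0) {ε : ℝ}
    (hε : 0 < ε) (hfar : ∀ i, ¬ propor (LL s p r i) x → ∀ c : ℂ, 2 * ε ≤ ‖c • LL s p r i - x‖) :
    ∃ n, flexNear (fam P (N + 2) (t n)) x ε = {i | propor (LL s p r i) x}.ncard := by
  obtain ⟨n0, hn0⟩ := eventually_atTop.mp (ev_enum D ht ht0 hsm)
  have hE0 : ∀ n, ∃ k q, Enum (fam P (N + 2) (t (n + n0))) k q := fun n => hn0 _ (by omega)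
  choose k q hE using hE0
  have ht1 : Tendsto (fun n => t (n + n0)) atTop (nhds 0) :=
    ht.comp (tendsto_add_atTop_nat n0)
  have hb := bdd_enum D ht1 (fun n => hsm _) k q hE
  have hk : ∃ K, ∃ᶠ n in atTop, k n = K := by
    by_contra hno
    push Not at hno
    have h1 : ∀ᶠ n in atTop, ∀ K ∈ Finset.range 145, ¬ k n = K := by
      rw [eventually_all_finset]
      intro K _
      exact hno K
    obtain ⟨n, h2, h3⟩ := (h1.and hb).exists
    exact h2 (k n) (Finset.mem_range.mpr (by omega)) rfl
  obtain ⟨K, hK⟩ := hk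
  obtain ⟨φ, hφ, hφK⟩ := extraction_of_frequently_atTop hK
  have hE1 : ∀ n, ∃ q, Enum (fam P (N + 2) (t (φ n + n0))) K q := by
    intro n
    have := hE (φ n)
    have e := hφK n
    generalize q (φ n) = qq at this
    revert qq
    rw [e]
    intro qq h
    exact ⟨qq, h⟩
  choose q1 hE1 using hE1
  have hcomp : IsCompact (Set.pi Set.univ fun _ : Fin K => Metric.sphere (0 : Fin 3 → ℂ) 1) :=
    isCompact_univ_pi fun _ => isCompact_sphere _ _
  obtain ⟨q0, -, ψ, hψ, hlim⟩ := hcomp.tendsto_subseq (x := q1) (by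
    intro n j _
    rw [mem_sphere_zero_iff_norm]
    exact (hE1 n).1 j)
  have ht2 : Tendsto (fun n => t (φ (ψ n) + n0)) atTop (nhds 0) :=
    (ht1.comp hφ.tendsto_atTop).comp hψ.tendsto_atTop
  have hE2 : ∀ n, Enum (fam P (N + 2) (t (φ (ψ n) + n0))) K (q1 (ψ n)) := fun n => hE1 _
  have hcl := cycle_limit D ht2 (fun n => ht0 _) (fun n => hsm _) hE2 hlim
  have hqj : ∀ j, Tendsto (fun n => q1 (ψ n) j) atTop (nhds (q0 j)) := fun j =>
    (tendsto_pi_nhds.mp hlim) j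
  have hq00 : ∀ j, q0 j ≠ 0 := by
    intro j h
    have h1 := (hqj j).norm
    simp_rw [fun n => (hE2 n).1 j] at h1
    rw [h, norm_zero] at h1
    exact one_ne_zero (tendsto_nhds_unique tendsto_const_nhds h1)
  have hL : ∀ j, ∃ i, propor (LL s p r i) (q0 j) := by
    intro j
    have h1 := hcl (q0 j) (hq00 j)
    have h2 : {j' | propor (q0 j') (q0 j)}.ncard ≠ 0 := by
      exact Set.ncard_ne_zero_of_mem (a := j) (propor_refl _)
    rw [h1] at h2
    exact Set.nonempty_of_ncard_ne_zero h2
  have hev : ∀ᶠ n in atTop, ∀ j, (projNear ε (q1 (ψ n) j) x ↔ propor (q0 j) x) := by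
    rw [eventually_all]
    intro j
    by_cases h : propor (q0 j) x
    · filter_upwards [near_ev (hqj j) h hε] with n hn
      exact iff_of_true hn h
    · obtain ⟨i, c, hc, e⟩ := hL j
      have hi : ¬ propor (LL s p r i) x := fun hp =>
        h (propor_trans (propor_symm ⟨c, hc, e⟩) hp)
      have hf : ∀ c' : ℂ, 2 * ε ≤ ‖c' • q0 j - x‖ := by
        intro c'
        have h3 := hfar i hi (c' / c)
        rwa [e, smul_smul, div_mul_cancel₀ _ hc] at h3
      filter_upwards [far_ev (hqj j) (fun n => (hE2 n).1 j) hε hf] with n hn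
      exact iff_of_false hn h
  obtain ⟨n, hn⟩ := hev.exists
  refine ⟨φ (ψ n) + n0, ?_⟩
  rw [flexNear_enum (hE2 n), ← hcl x hx]
  congr 1
  ext j
  exact hn j

theorem limit_ev {G : P3} {w : Fin 3 → ℂ} {p : Fin 3 → Fin 3 → ℂ} {P : ℕ → P3} {N : ℕ}
    {s : Fin 6 → Fin 3 → ℂ} {m : ℕ} {r : Fin m → Fin 3 → ℂ} (D : Dat G w p P N s m r)
    (hsm : ∀ᶠ t in nhdsWithin (0 : ℂ) {0}ᶜ, IsSmoothCurve (fam P (N + 2) t) 4)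
    {x : Fin 3 → ℂ} (hx : x ≠ 0) :
    ∀ᶠ ε in nhdsWithin (0 : ℝ) (Set.Ioi 0), ∀ᶠ t in nhdsWithin (0 : ℂ) {0}ᶜ,
      flexNear (fam P (N + 2) t) x ε = {i | propor (LL s p r i) x}.ncard := by
  have h1 : ∀ᶠ ε in nhdsWithin (0 : ℝ) (Set.Ioi 0), ∀ i, ¬ propor (LL s p r i) x →
      ∀ c : ℂ, 2 * ε ≤ ‖c • LL s p r i - x‖ := by
    rw [eventually_all]
    intro i
    by_cases h : propor (LL s p r i) x
    · exact Eventually.of_forall fun ε h' => absurd h h'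
    · filter_upwards [far_line hx h] with ε hε _
      exact hε
  filter_upwards [h1, self_mem_nhdsWithin] with ε hfar hε
  by_contra hno
  have h2 := ((not_eventually.mp hno).and_eventually hsm).and_eventually
    (self_mem_nhdsWithin (a := (0 : ℂ)) (s := {0}ᶜ))
  obtain ⟨t, ht, htt⟩ := exists_seq_forall_of_frequently h2
  obtain ⟨n, hn⟩ := seq_limit D (ht.mono_right nhdsWithin_le_nhds) (fun n => (htt n).2)
    (fun n => (htt n).1.2) hx hε hfar
  exact (htt n).1.1 hn

end assembly

theorem limit_weierstrass_cycle_of_cubic_plus_line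
    -- `Y = {G = 0}` a smooth irreducible cubic:
    (G : MvPolynomial (Fin 3) ℂ) (hG : IsSmoothCurve G 3)
    -- `Z` the line with dual vector `w`:
    (w : Fin 3 → ℂ) (hw : w ≠ 0)
    -- `C = Y ∪ Z` with `Y ∩ Z = {p₁, p₂, p₃}` (three distinct points, so that `C` is
    -- nodal):
    (p : Fin 3 → Fin 3 → ℂ)
    (hpne : ∀ i, p i ≠ 0) (hponY : ∀ i, eval (p i) G = 0)
    (hponZ : ∀ i, dotv w (p i) = 0)
    (hdist : ∀ i j, i ≠ j → ¬ propor (p i) (p j))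
    (hYZ : ∀ q : Fin 3 → ℂ, q ≠ 0 → dotv w q = 0 → eval q G = 0 → ∃ i, propor q (p i))
    -- `f : 𝒞 → B` a regular smoothing of `C = {(linForm w) · G = 0}`: the total space
    -- is smooth at the points of `C` lying on both components:
    (Q : MvPolynomial (Fin 4) ℂ) (hQ : IsQuarticSmoothing Q (linForm w * G))
    (hreg : ∀ i, TotalSpaceSmoothAt Q (p i)) :
    -- `[W_{f,0}] = R + (s₁ + ⋯ + s₆) + 3(p₁ + p₂ + p₃)`:
    ∃ (c : (Fin 3 → ℂ) → ℕ) (s : Fin 6 → Fin 3 → ℂ),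
      IsLimitWeierstrassCycle Q c ∧
      -- `s₁, …, s₆` lie on `Z` and in the smooth locus of `C`:
      (∀ j, s j ≠ 0 ∧ dotv w (s j) = 0 ∧ eval (s j) G ≠ 0) ∧
      -- the cycle decomposition, where `R` is the inflection (ramification) divisor
      -- of `|𝒪_Y(1)|` on the smooth cubic `Y`:
      (∀ x : Fin 3 → ℂ, x ≠ 0 →
        c x = flexWeightAt G x + {j : Fin 6 | propor (s j) x}.ncard +
          3 * {i : Fin 3 | propor (p i) x}.ncard) := by
  obtain ⟨hQ0, hQhom, hQsm⟩ := hQ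
  obtain ⟨N, P, hfam, hP0, hP1, hP1e⟩ := exists_fam Q hQhom
  have hHp : ∀ i, MvPolynomial.eval (p i) (P 1) ≠ 0 := by
    intro i
    rw [hP1e]
    exact node_ne hQ0 (hponY i) (hponZ i) (hreg i)
  obtain ⟨s, hs, hz⟩ := zcoord hG.1 hP1 hw hpne hponY hponZ hdist hYZ hHp
  obtain ⟨m, r, hr⟩ := cubic_enum hG hw hpne hponY hponZ hdist (hs 0).1 (hs 0).2.1 (hs 0).2.2
  have D : Dat G w p P N s m r :=
    { hG := hG, hw := hw, hpne := hpne, hponY := hponY, hponZ := hponZ, hdist := hdist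
      hP := by rw [hP0, hQ0]
      hom := fun t => by rw [← hfam t]; exact hQhom t
      hr := hr, hs := hs, hz := hz }
  refine ⟨fun x => {i | propor (LL s p r i) x}.ncard, s, ⟨?_, ?_⟩, hs, ?_⟩
  · intro u hu x
    dsimp only
    congr 1
    ext i
    have hux : propor (u • x) x := ⟨u, hu, rfl⟩
    exact ⟨fun h => propor_trans h hux, fun h => propor_trans h (propor_symm hux)⟩
  · intro x hx
    simp_rw [hfam]
    refine limit_ev D ?_ hx
    filter_upwards [hQsm] with t h
    rw [← hfam t]
    exact h
  · intro x hx
    exact LL_count D x hx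

end Infl
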